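/- arXiv:1712.08311 — 3 statements merged into one kernel-verified Lean document; each statement's English description precedes it below -/
import Mathlib

section
/- Let (W,S) be a Coxeter system with W finite and let w ∈ W. Suppose that for each descent d of w there exists a join-irreducible element w_d ∈ W such that w_d ≤ w in the right weak order and the set of cover reflections of w_d equals {w s_d w⁻¹}. Then {w_d : d a descent of w} is the canonical join representation of w in the right weak order. -/
/-- The right weak order on a Coxeter group: `u ≤ w` iff `ℓ(w) = ℓ(u) + ℓ(u⁻¹w)`. -/
def CoxeterSystem.weakLE {B W : Type*} [Group W] {M : CoxeterMatrix B}
    (cs : CoxeterSystem M W) (u w : W) : Prop :=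
  cs.length w = cs.length u + cs.length (u⁻¹ * w)

/-- `w` is a least upper bound of `S` in the right weak order. -/
def CoxeterSystem.IsWeakLUB {B W : Type*} [Group W] {M : CoxeterMatrix B}
    (cs : CoxeterSystem M W) (S : Set W) (w : W) : Prop :=
  (∀ x ∈ S, cs.weakLE x w) ∧ ∀ z : W, (∀ x ∈ S, cs.weakLE x z) → cs.weakLE w z

/-- `w` is join-irreducible in the right weak order. -/
def CoxeterSystem.IsJoinIrreducible {B W : Type*} [Group W] {M : CoxeterMatrix B}
    (cs : CoxeterSystem M W) (w : W) : Prop :=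
  w ≠ 1 ∧ ∀ u v : W, cs.IsWeakLUB {u, v} w → u = w ∨ v = w

/-- The set of cover reflections of `w`: the elements `w sᵢ w⁻¹` for `i` a right descent. -/
def CoxeterSystem.coverReflections {B W : Type*} [Group W] {M : CoxeterMatrix B}
    (cs : CoxeterSystem M W) (w : W) : Set W :=
  {t | ∃ i : B, cs.IsRightDescent w i ∧ t = w * cs.simple i * w⁻¹}

/-- `U` is the canonical join representation of `w`: `U` is finite, `w` is a least upper bound
of `U` in the right weak order, no proper subset of `U` has `w` as a least upper bound, and
for every finite `V` with the same two properties, each `u ∈ U` is below some `v ∈ V`. -/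
def CoxeterSystem.IsCanonicalJoinRep {B W : Type*} [Group W] {M : CoxeterMatrix B}
    (cs : CoxeterSystem M W) (w : W) (U : Set W) : Prop :=
  U.Finite ∧ cs.IsWeakLUB U w ∧ (∀ U' ⊂ U, ¬ cs.IsWeakLUB U' w) ∧
    ∀ V : Set W, V.Finite → cs.IsWeakLUB V w → (∀ V' ⊂ V, ¬ cs.IsWeakLUB V' w) →
      ∀ u ∈ U, ∃ v ∈ V, cs.weakLE u v

namespace CoxeterSystem

open List

variable {B W : Type*} [Group W] {M : CoxeterMatrix B} (cs : CoxeterSystem M W)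

/-! ### The reflection cocycle -/

open Classical in
/-- The involution `(t, ε) ↦ (sᵢ t sᵢ, ε + [t = sᵢ])` of `W × ZMod 2`. -/
noncomputable def reflectionPerm (i : B) : Equiv.Perm (W × ZMod 2) :=
  Function.Involutive.toPerm
    (fun p ↦ (cs.simple i * p.1 * cs.simple i, p.2 + if p.1 = cs.simple i then 1 else 0)) <| by
    rintro ⟨t, ε⟩
    have h : cs.simple i * t * cs.simple i = cs.simple i ↔ t = cs.simple i := by
      constructor
      · intro h
        simpa [mul_assoc] using congrArg (fun x ↦ cs.simple i * x * cs.simple i) h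
      · rintro rfl
        simp
    have h2 : (1 : ZMod 2) + 1 = 0 := by decide
    by_cases ht : t = cs.simple i
    · subst ht
      simp [add_assoc, h2]
    · simp [← mul_assoc, h, ht]

open Classical in
theorem reflectionPerm_apply (i : B) (t : W) (ε : ZMod 2) :
    cs.reflectionPerm i (t, ε) =
      (cs.simple i * t * cs.simple i, ε + if t = cs.simple i then 1 else 0) := rfl

theorem reflectionPerm_inv (i : B) : (cs.reflectionPerm i)⁻¹ = cs.reflectionPerm i :=
  Function.Involutive.toPerm_symm _

open Classical in
theorem count_map_conj_simple (l : List W) (i : B) (t : W) :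
    (l.map (MulAut.conj (cs.simple i))).count t =
      l.count (cs.simple i * t * cs.simple i) := by
  have h : t = MulAut.conj (cs.simple i) (cs.simple i * t * cs.simple i) := by
    simp [mul_assoc]
  conv_lhs => rw [h]
  exact count_map_of_injective _ _ (MulAut.conj (cs.simple i)).injective _

open Classical in
theorem prod_map_reflectionPerm_inv_apply (ω : List B) (t : W) (ε : ZMod 2) :
    (ω.map cs.reflectionPerm).prod⁻¹ (t, ε) =
      ((cs.wordProd ω)⁻¹ * t * cs.wordProd ω, ε + ((cs.leftInvSeq ω).count t : ZMod 2)) := by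
  induction ω generalizing t ε with
  | nil => simp
  | cons i ω ih =>
    rw [map_cons, prod_cons, mul_inv_rev, Equiv.Perm.mul_apply, reflectionPerm_inv,
      reflectionPerm_apply, ih, leftInvSeq, count_cons, count_map_conj_simple, wordProd_cons]
    ext
    · simp [mul_assoc]
    · by_cases h : t = cs.simple i
      · simp [h, add_comm, add_left_comm]
      · simp [h, Ne.symm h]

theorem prod_map_alternatingWord {G : Type*} [Group G] (f : B → G) (i j : B) (m : ℕ) :
    ((alternatingWord i j (2 * m)).map f).prod = (f i * f j) ^ m := by
  induction m with
  | zero => simp [alternatingWord]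
  | succ m ih =>
    rw [show 2 * (m + 1) = 2 * m + 1 + 1 by ring, alternatingWord_succ, alternatingWord_succ,
      pow_succ, ← ih]
    simp

open Classical in
theorem even_count_leftInvSeq_alternatingWord (i j : B) (t : W) :
    Even ((cs.leftInvSeq (alternatingWord i j (2 * M i j))).count t) := by
  set l := cs.leftInvSeq (alternatingWord i j (2 * M i j)) with hl
  have hlen : l.length = 2 * M i j := by simp [hl]
  have hdrop : l.drop (M i j) = l.take (M i j) := by
    apply List.ext_getElem
    · simp [hlen]; lia
    · intro k h₁ h₂
      have hk : k < M i j := by simp at h₂; lia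
      rw [getElem_drop, getElem_take]
      simp only [hl]
      rw [getElem_leftInvSeq_alternatingWord _ _ _ _ _ (by lia),
        getElem_leftInvSeq_alternatingWord _ _ _ _ _ (by lia),
        prod_alternatingWord_eq_mul_pow, prod_alternatingWord_eq_mul_pow]
      have e₁ : (2 * (M i j + k) + 1) / 2 = M i j + k := by lia
      have e₂ : (2 * k + 1) / 2 = k := by lia
      rw [e₁, e₂, pow_add, simple_mul_simple_pow']
      simp
  rw [← take_append_drop (M i j) l, hdrop, count_append]
  exact ⟨_, rfl⟩

theorem isLiftable_reflectionPerm : M.IsLiftable cs.reflectionPerm := by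
  classical
  intro i j
  rw [← prod_map_alternatingWord, ← inv_eq_one]
  ext1 ⟨t, ε⟩
  rw [prod_map_reflectionPerm_inv_apply,
    (ZMod.natCast_eq_zero_iff_even).2 (cs.even_count_leftInvSeq_alternatingWord i j t)]
  have h : cs.wordProd (alternatingWord i j (2 * M i j)) = 1 := by
    simp [prod_alternatingWord_eq_mul_pow]
  simp [h]

/-- The action of `W` on `W × ZMod 2` extending `reflectionPerm`. -/
noncomputable def reflectionAction : W →* Equiv.Perm (W × ZMod 2) :=
  cs.lift ⟨cs.reflectionPerm, cs.isLiftable_reflectionPerm⟩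

theorem reflectionAction_wordProd (ω : List B) :
    cs.reflectionAction (cs.wordProd ω) = (ω.map cs.reflectionPerm).prod := by
  rw [wordProd, map_list_prod, map_map]
  congr 2
  ext1 i
  exact cs.lift_apply_simple cs.isLiftable_reflectionPerm i

/-- The set of elements occurring an odd number of times in the left inversion sequence of some
(equivalently, every) word for `w`. -/
def inversionSet (w : W) : Set W :=
  {t | (cs.reflectionAction w⁻¹ (t, 0)).2 = 1}

open Classical in
theorem mem_inversionSet_wordProd {ω : List B} {t : W} :
    t ∈ cs.inversionSet (cs.wordProd ω) ↔ Odd ((cs.leftInvSeq ω).count t) := by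
  rw [inversionSet, Set.mem_ofPred_eq, map_inv, reflectionAction_wordProd,
    prod_map_reflectionPerm_inv_apply, zero_add, ZMod.natCast_eq_one_iff_odd]

theorem mem_inversionSet_mul {u v t : W} :
    t ∈ cs.inversionSet (u * v) ↔
      ¬(t ∈ cs.inversionSet u ↔ u⁻¹ * t * u ∈ cs.inversionSet v) := by
  classical
  obtain ⟨ω, rfl⟩ := cs.wordProd_surjective u
  obtain ⟨ω', rfl⟩ := cs.wordProd_surjective v
  simp only [inversionSet, Set.mem_ofPred_eq, mul_inv_rev, map_mul, Equiv.Perm.mul_apply]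
  simp only [map_inv, reflectionAction_wordProd, prod_map_reflectionPerm_inv_apply, zero_add]
  generalize (count t (cs.leftInvSeq ω) : ZMod 2) = a
  generalize (count _ (cs.leftInvSeq ω') : ZMod 2) = b
  revert a b
  decide

theorem inversionSet_one : cs.inversionSet 1 = ∅ := by
  ext t
  simp [inversionSet]

theorem mem_inversionSet_simple {i : B} {t : W} :
    t ∈ cs.inversionSet (cs.simple i) ↔ t = cs.simple i := by
  classical
  rw [← wordProd_singleton, mem_inversionSet_wordProd, leftInvSeq_singleton, count_singleton]
  by_cases h : t = cs.simple i <;> simp [h, eq_comm (a := cs.simple i)]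

theorem mem_inversionSet_inv {u t : W} :
    t ∈ cs.inversionSet u⁻¹ ↔ u * t * u⁻¹ ∈ cs.inversionSet u := by
  have h := cs.mem_inversionSet_mul (u := u) (v := u⁻¹) (t := u * t * u⁻¹)
  rw [mul_inv_cancel, inversionSet_one] at h
  simp only [mul_assoc, inv_mul_cancel_left, inv_mul_cancel, mul_one] at h ⊢
  simp only [Set.mem_empty_iff_false] at h
  tauto

theorem mem_inversionSet_iff_of_isReduced {ω : List B} (hω : cs.IsReduced ω) {t : W} :
    t ∈ cs.inversionSet (cs.wordProd ω) ↔ t ∈ cs.leftInvSeq ω := by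
  classical
  rw [mem_inversionSet_wordProd, hω.nodup_leftInvSeq.count]
  split_ifs <;> simp [*]

theorem length_mul_lt_of_mem_inversionSet {w t : W} (h : t ∈ cs.inversionSet w) :
    cs.length (t * w) < cs.length w := by
  obtain ⟨ω, hω, rfl⟩ := cs.exists_isReduced w
  exact (cs.isLeftInversion_of_mem_leftInvSeq hω
    ((cs.mem_inversionSet_iff_of_isReduced hω).1 h)).2

theorem isReflection_of_mem_inversionSet {w t : W} (h : t ∈ cs.inversionSet w) :
    cs.IsReflection t := by
  obtain ⟨ω, hω, rfl⟩ := cs.exists_isReduced w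
  exact cs.isReflection_of_mem_leftInvSeq ω ((cs.mem_inversionSet_iff_of_isReduced hω).1 h)

theorem inversionSet_finite (w : W) : (cs.inversionSet w).Finite := by
  obtain ⟨ω, hω, rfl⟩ := cs.exists_isReduced w
  exact (cs.leftInvSeq ω).finite_toSet.subset
    fun t ↦ (cs.mem_inversionSet_iff_of_isReduced hω).1

theorem ncard_inversionSet (w : W) : (cs.inversionSet w).ncard = cs.length w := by
  classical
  obtain ⟨ω, hω, rfl⟩ := cs.exists_isReduced w
  have h : cs.inversionSet (cs.wordProd ω) = ((cs.leftInvSeq ω).toFinset : Set W) := by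
    ext t
    simp [mem_inversionSet_iff_of_isReduced, hω]
  rw [h, Set.ncard_coe_finset, toFinset_card_of_nodup hω.nodup_leftInvSeq, length_leftInvSeq,
    hω.eq]

/-- A reflection is an inversion of itself. -/
theorem IsReflection.mem_inversionSet_self {cs : CoxeterSystem M W} {t : W}
    (ht : cs.IsReflection t) : t ∈ cs.inversionSet t := by
  obtain ⟨u, i, rfl⟩ := ht
  rw [mul_assoc, mem_inversionSet_mul, mem_inversionSet_mul, mem_inversionSet_inv]
  simp [mul_assoc, mem_inversionSet_simple]

theorem IsReflection.mem_inversionSet_iff {cs : CoxeterSystem M W} {t w : W}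
    (ht : cs.IsReflection t) : t ∈ cs.inversionSet w ↔ cs.length (t * w) < cs.length w := by
  refine ⟨cs.length_mul_lt_of_mem_inversionSet, fun h ↦ ?_⟩
  by_contra hn
  have h₁ : t ∈ cs.inversionSet (t * w) := by
    rw [mem_inversionSet_mul]
    simpa [ht.mem_inversionSet_self] using hn
  have h₂ := cs.length_mul_lt_of_mem_inversionSet h₁
  rw [← mul_assoc, ht.mul_self, one_mul] at h₂
  exact h.not_gt h₂

/-! ### The right weak order and inversion sets -/

theorem weakLE_iff_inversionSet_subset {u w : W} :
    cs.weakLE u w ↔ cs.inversionSet u ⊆ cs.inversionSet w := by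
  obtain ⟨v, rfl⟩ : ∃ v, w = u * v := ⟨u⁻¹ * w, by simp⟩
  set N := cs.inversionSet u with hN
  set N' := MulAut.conj u '' cs.inversionSet v with hN'
  have hmem {t : W} : t ∈ N' ↔ u⁻¹ * t * u ∈ cs.inversionSet v := by
    constructor
    · rintro ⟨x, hx, rfl⟩
      simpa [mul_assoc] using hx
    · intro h
      exact ⟨_, h, by simp [mul_assoc]⟩
  have hNv : N'.ncard = cs.length v := by
    rw [hN', Set.ncard_image_of_injective _ (MulAut.conj u).injective, ncard_inversionSet]
  have hf : N.Finite := cs.inversionSet_finite u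
  have hf' : N'.Finite := (cs.inversionSet_finite v).image _
  have hmul : cs.inversionSet (u * v) = (N ∪ N') \ (N ∩ N') := by
    ext t
    simp only [mem_inversionSet_mul, Set.mem_sdiff, Set.mem_union, Set.mem_inter_iff, hmem, ← hN]
    tauto
  have hcard : cs.length (u * v) + 2 * (N ∩ N').ncard = cs.length u + cs.length v := by
    have h₁ := Set.ncard_sdiff_add_ncard_of_subset
      (Set.inter_subset_left.trans Set.subset_union_left : N ∩ N' ⊆ N ∪ N') (hf.union hf')
    have h₂ := Set.ncard_union_add_ncard_inter N N' hf hf'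
    rw [← hmul, ncard_inversionSet] at h₁
    rw [hN, ncard_inversionSet, ← hN, hNv] at h₂
    lia
  have hiff : cs.weakLE u (u * v) ↔ (N ∩ N').ncard = 0 := by
    rw [weakLE, inv_mul_cancel_left]
    lia
  rw [hiff, Set.ncard_eq_zero (hf.inter_of_left _), hmul]
  constructor
  · intro h t ht
    exact ⟨Or.inl ht, by simp [h]⟩
  · intro h
    ext t
    simp only [Set.mem_inter_iff, Set.mem_empty_iff_false, iff_false]
    exact fun ht ↦ (h ht.1).2 ht

theorem weakLE.trans {cs : CoxeterSystem M W} {u v w : W} (h : cs.weakLE u v) (h' : cs.weakLE v w) :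
    cs.weakLE u w := by
  rw [weakLE_iff_inversionSet_subset] at *
  exact h.trans h'

theorem weakLE.antisymm {cs : CoxeterSystem M W} {u v : W} (h : cs.weakLE u v) (h' : cs.weakLE v u) :
    u = v := by
  have h₀ : cs.length (u⁻¹ * v) = 0 := by
    unfold weakLE at h
    have := cs.ncard_inversionSet v
    have h₁ : cs.inversionSet u = cs.inversionSet v :=
      (cs.weakLE_iff_inversionSet_subset.1 h).antisymm (cs.weakLE_iff_inversionSet_subset.1 h')
    rw [← h₁, ncard_inversionSet] at this
    lia
  rw [length_eq_zero_iff] at h₀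
  exact eq_of_inv_mul_eq_one h₀

theorem one_weakLE (w : W) : cs.weakLE 1 w := by
  simp [weakLE]

theorem isRightDescent_iff_mem_inversionSet {w : W} {i : B} :
    cs.IsRightDescent w i ↔ w * cs.simple i * w⁻¹ ∈ cs.inversionSet w := by
  have h : cs.IsReflection (w * cs.simple i * w⁻¹) := ⟨w, i, rfl⟩
  rw [h.mem_inversionSet_iff]
  simp [IsRightDescent]

theorem mem_inversionSet_mul_simple {w : W} {i : B} (h : cs.IsRightDescent w i) {t : W} :
    t ∈ cs.inversionSet (w * cs.simple i) ↔
      t ∈ cs.inversionSet w ∧ t ≠ w * cs.simple i * w⁻¹ := by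
  have h' := cs.isRightDescent_iff_mem_inversionSet.1 h
  have e : w⁻¹ * t * w = cs.simple i ↔ t = w * cs.simple i * w⁻¹ := by
    constructor
    · intro e
      simp [← e, mul_assoc]
    · rintro rfl
      simp [mul_assoc]
  rw [mem_inversionSet_mul, mem_inversionSet_simple, e]
  by_cases ht : t = w * cs.simple i * w⁻¹
  · simp [ht, h']
  · simp [ht]

/-- If `u < w` then `u ≤ w sᵢ` for some descent `i` of `w`. -/
theorem weakLE.eq_or_exists_isRightDescent {cs : CoxeterSystem M W} {u w : W}
    (h : cs.weakLE u w) :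
    u = w ∨ ∃ i, cs.IsRightDescent w i ∧ cs.weakLE u (w * cs.simple i) := by
  by_cases hv : u⁻¹ * w = 1
  · exact .inl (eq_of_inv_mul_eq_one hv)
  obtain ⟨i, hi⟩ := cs.exists_rightDescent_of_ne_one hv
  rw [isRightDescent_iff] at hi
  have h₁ := cs.length_mul_le u (u⁻¹ * w * cs.simple i)
  have h₂ := cs.length_mul_simple w i
  simp only [weakLE, isRightDescent_iff] at *
  simp only [mul_assoc, mul_inv_cancel_left] at *
  exact .inr ⟨i, by lia, by lia⟩

theorem weakLE.simple_mul {cs : CoxeterSystem M W} {u x : W} {i : B} (h : cs.weakLE u x)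
    (hi : cs.simple i ∈ cs.inversionSet u ↔ cs.simple i ∈ cs.inversionSet x) :
    cs.weakLE (cs.simple i * u) (cs.simple i * x) := by
  rw [weakLE_iff_inversionSet_subset] at *
  intro t ht
  rw [mem_inversionSet_mul, mem_inversionSet_simple] at *
  by_cases e : t = cs.simple i
  · subst e
    simp only [inv_mul_cancel, one_mul] at *
    tauto
  · have := @h ((cs.simple i)⁻¹ * t * cs.simple i)
    tauto

theorem simple_mem_inversionSet_simple_mul {x : W} {i : B} :
    cs.simple i ∈ cs.inversionSet (cs.simple i * x) ↔ cs.simple i ∉ cs.inversionSet x := by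
  rw [mem_inversionSet_mul, mem_inversionSet_simple]
  simp

theorem weakLE.mem_inversionSet_inv_mul {cs : CoxeterSystem M W} {x w : W} (h : cs.weakLE x w)
    {t : W} :
    t ∈ cs.inversionSet (w⁻¹ * x) ↔
      w * t * w⁻¹ ∈ cs.inversionSet w ∧ w * t * w⁻¹ ∉ cs.inversionSet x := by
  rw [mem_inversionSet_mul, mem_inversionSet_inv, inv_inv]
  have h' := cs.weakLE_iff_inversionSet_subset.1 h
  have := @h' (w * t * w⁻¹)
  tauto

/-! ### Standard parabolic subgroups -/

theorem exists_word_of_mem_closure {J : Set B} {y : W}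
    (hy : y ∈ Subgroup.closure (cs.simple '' J)) :
    ∃ ω : List B, (∀ i ∈ ω, i ∈ J) ∧ cs.wordProd ω = y := by
  induction hy using Subgroup.closure_induction with
  | mem x hx =>
    obtain ⟨i, hi, rfl⟩ := hx
    exact ⟨[i], by simpa using hi, by simp⟩
  | one => exact ⟨[], by simp, by simp⟩
  | mul x y _ _ hx hy =>
    obtain ⟨ω, hω, rfl⟩ := hx
    obtain ⟨ω', hω', rfl⟩ := hy
    refine ⟨ω ++ ω', fun i hi ↦ ?_, cs.wordProd_append ω ω'⟩
    exact (mem_append.1 hi).elim (hω i) (hω' i)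
  | inv x _ hx =>
    obtain ⟨ω, hω, rfl⟩ := hx
    exact ⟨ω.reverse, by simpa using hω, cs.wordProd_reverse ω⟩

/-- An element of a standard parabolic subgroup `W_J` without left descents in `J` is trivial. -/
theorem eq_one_of_mem_closure {J : Set B} {y : W} (hy : y ∈ Subgroup.closure (cs.simple '' J))
    (h : ∀ i ∈ J, cs.simple i ∉ cs.inversionSet y) : y = 1 := by
  classical
  have hex : ∃ n, ∃ ω : List B, (∀ i ∈ ω, i ∈ J) ∧ cs.wordProd ω = y ∧ ω.length = n := by
    obtain ⟨ω, hω, rfl⟩ := cs.exists_word_of_mem_closure hy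
    exact ⟨_, ω, hω, rfl, rfl⟩
  obtain ⟨ω, hω, rfl, hlen⟩ := Nat.find_spec hex
  cases ω with
  | nil => simp
  | cons i ω =>
    exfalso
    have hi := h i (hω i mem_cons_self)
    rw [mem_inversionSet_wordProd, leftInvSeq, count_cons_self, count_map_conj_simple,
      simple_mul_simple_self, one_mul, Nat.odd_add_one, not_not] at hi
    obtain ⟨k, hk, hk'⟩ := getElem_of_mem (count_pos_iff.1 hi.pos)
    have hprod : cs.wordProd (i :: ω) = cs.wordProd (ω.eraseIdx k) := by
      rw [← getD_leftInvSeq_mul_wordProd, getD_eq_getElem _ _ hk, hk', wordProd_cons]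
    have hk₂ : k < ω.length := by simpa using hk
    refine Nat.find_min hex (m := ω.length - 1) ?_ ⟨ω.eraseIdx k, fun j hj ↦ ?_, hprod.symm, ?_⟩
    · rw [← hlen, length_cons]
      lia
    · exact hω j (mem_cons_of_mem _ (mem_of_mem_eraseIdx hj))
    · rw [length_eraseIdx_of_lt hk₂]

theorem inversionSet_subset_closure {J : Set B} {u : W}
    (hu : u ∈ Subgroup.closure (cs.simple '' J)) :
    cs.inversionSet u ⊆ Subgroup.closure (cs.simple '' J) := by
  induction hu using Subgroup.closure_induction with
  | mem x hx =>
    obtain ⟨i, hi, rfl⟩ := hx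
    intro t ht
    rw [mem_inversionSet_simple] at ht
    subst ht
    exact Subgroup.subset_closure ⟨i, hi, rfl⟩
  | one => simp [inversionSet_one]
  | mul x y hx hy ihx ihy =>
    intro t ht
    rw [mem_inversionSet_mul] at ht
    by_cases h : t ∈ cs.inversionSet x
    · exact ihx h
    · have h' : x⁻¹ * t * x ∈ cs.inversionSet y := by tauto
      have := mul_mem (mul_mem hx (ihy h')) (inv_mem hx)
      simpa [mul_assoc] using this
  | inv x hx ih =>
    intro t ht
    rw [mem_inversionSet_inv] at ht
    have := mul_mem (mul_mem (inv_mem hx) (ih ht)) hx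
    simpa [mul_assoc] using this

variable [Finite W]

theorem exists_longest_mem_closure (J : Set B) :
    ∃ p ∈ Subgroup.closure (cs.simple '' J), ∀ t, t ∈ cs.inversionSet p ↔
      t ∈ Subgroup.closure (cs.simple '' J) ∧ cs.IsReflection t := by
  obtain ⟨p, hp, hmax⟩ := (Set.toFinite
    (Subgroup.closure (cs.simple '' J) : Set W)).exists_maximalFor cs.length _ ⟨1, one_mem _⟩
  refine ⟨p, hp, fun t ↦ ⟨fun h ↦ ⟨cs.inversionSet_subset_closure hp h,
    cs.isReflection_of_mem_inversionSet h⟩, fun ⟨h, ht⟩ ↦ ?_⟩⟩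
  rw [ht.mem_inversionSet_iff]
  have h₁ := ht.length_mul_right_ne p
  have h₂ := hmax (mul_mem h hp : t * p ∈ Subgroup.closure (cs.simple '' J))
  by_contra hn
  exact h₁ (le_antisymm (h₂ (not_lt.1 hn)) (not_lt.1 hn))

/-- If every `sᵢ` with `i ∈ J` is an inversion of `x`, then so is every reflection in `W_J`. -/
theorem IsReflection.mem_inversionSet_of_mem_closure {cs : CoxeterSystem M W} {J : Set B} {x t : W}
    (ht : cs.IsReflection t) (hx : ∀ i ∈ J, cs.simple i ∈ cs.inversionSet x)
    (htJ : t ∈ Subgroup.closure (cs.simple '' J)) : t ∈ cs.inversionSet x := by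
  set D := Subgroup.closure (cs.simple '' J)
  obtain ⟨d, hd, hmin⟩ := (Set.toFinite (D : Set W)).exists_minimalFor
    (fun d ↦ cs.length (d * x)) _ ⟨1, one_mem _⟩
  have hv (t : W) (ht : t ∈ D) : t ∉ cs.inversionSet (d * x) := by
    intro h
    have h₁ := cs.length_mul_lt_of_mem_inversionSet h
    have h₂ := hmin (mul_mem ht hd : t * d ∈ D)
    simp only [mul_assoc] at h₁ h₂
    exact h₁.not_ge (h₂ h₁.le)
  have hconj (t : W) (ht : t ∈ D) : d * t * d⁻¹ ∈ D := mul_mem (mul_mem hd ht) (inv_mem hd)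
  have hu (t : W) (ht : t ∈ D) : t ∈ cs.inversionSet x ↔ t ∈ cs.inversionSet d⁻¹ := by
    have h := cs.mem_inversionSet_mul (u := d⁻¹) (v := d * x) (t := t)
    rw [inv_mul_cancel_left, inv_inv] at h
    have := hv _ (hconj t ht)
    tauto
  obtain ⟨p, hp, hpN⟩ := cs.exists_longest_mem_closure J
  have hmem (t : W) (ht : t ∈ D) (htr : cs.IsReflection t) :
      t ∈ cs.inversionSet (d⁻¹ * p) ↔ t ∉ cs.inversionSet x := by
    rw [mem_inversionSet_mul, inv_inv, hpN, ← hu t ht]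
    have := hconj t ht
    have := htr.conj d
    tauto
  have hone : d⁻¹ * p = 1 := by
    refine cs.eq_one_of_mem_closure (J := J) (mul_mem (inv_mem hd) hp) fun i hi ↦ ?_
    rw [hmem _ (Subgroup.subset_closure ⟨i, hi, rfl⟩) (cs.isReflection_simple i), not_not]
    exact hx i hi
  have h := hmem t htJ ht
  rw [hone, inversionSet_one] at h
  simpa using h

/-- A finite Coxeter group has an element of which every reflection is an inversion. -/
theorem exists_forall_isReflection_mem_inversionSet :
    ∃ w₀ : W, ∀ t, cs.IsReflection t → t ∈ cs.inversionSet w₀ := by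
  obtain ⟨p, -, hp⟩ := cs.exists_longest_mem_closure Set.univ
  refine ⟨p, fun t ht ↦ (hp t).2 ⟨?_, ht⟩⟩
  rw [Set.image_univ, subgroup_closure_range_simple]
  exact Subgroup.mem_top t

/-! ### Meets in the right weak order -/

/-- Any two elements of a finite Coxeter group have a greatest lower bound in the right weak
order. -/
theorem exists_weak_meet (x y : W) :
    ∃ m, cs.weakLE m x ∧ cs.weakLE m y ∧ ∀ u, cs.weakLE u x → cs.weakLE u y → cs.weakLE u m := by
  induction hn : cs.length x using Nat.strong_induction_on generalizing x y with
  | _ n ih =>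
  have hmeet (i : B) (hx : cs.simple i ∈ cs.inversionSet x)
      (hy : cs.simple i ∈ cs.inversionSet y) :
      ∃ m, cs.weakLE m x ∧ cs.weakLE m y ∧ cs.simple i ∈ cs.inversionSet m ∧
        ∀ u, cs.simple i ∈ cs.inversionSet u → cs.weakLE u x → cs.weakLE u y → cs.weakLE u m := by
    obtain ⟨m, hmx, hmy, hm⟩ := ih _ (hn ▸ cs.length_mul_lt_of_mem_inversionSet hx)
      (cs.simple i * x) (cs.simple i * y) rfl
    have hix : cs.simple i ∉ cs.inversionSet (cs.simple i * x) := by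
      simpa [simple_mem_inversionSet_simple_mul] using hx
    have hiy : cs.simple i ∉ cs.inversionSet (cs.simple i * y) := by
      simpa [simple_mem_inversionSet_simple_mul] using hy
    have him : cs.simple i ∉ cs.inversionSet m :=
      fun h ↦ hix (cs.weakLE_iff_inversionSet_subset.1 hmx h)
    refine ⟨cs.simple i * m, ?_, ?_, cs.simple_mem_inversionSet_simple_mul.2 him, ?_⟩
    · simpa using hmx.simple_mul (iff_of_false him hix)
    · simpa using hmy.simple_mul (iff_of_false him hiy)
    · intro u hu hux huy
      have hiu : cs.simple i ∉ cs.inversionSet (cs.simple i * u) := by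
        simpa [simple_mem_inversionSet_simple_mul] using hu
      simpa using (hm _ (hux.simple_mul (iff_of_true hu hx))
        (huy.simple_mul (iff_of_true hu hy))).simple_mul (iff_of_false hiu him)
  have hdesc {u : W} (hu : u ≠ 1) : ∃ i, cs.simple i ∈ cs.inversionSet u := by
    obtain ⟨i, hi⟩ := cs.exists_leftDescent_of_ne_one hu
    exact ⟨i, (cs.isReflection_simple i).mem_inversionSet_iff.2 hi⟩
  by_cases hcommon : ∃ i, cs.simple i ∈ cs.inversionSet x ∧ cs.simple i ∈ cs.inversionSet y
  · obtain ⟨i, hix, hiy⟩ := hcommon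
    obtain ⟨m, hmx, hmy, him, hm⟩ := hmeet i hix hiy
    refine ⟨m, hmx, hmy, fun u hux huy ↦ ?_⟩
    by_cases hu : u = 1
    · rw [hu]
      exact cs.one_weakLE m
    obtain ⟨j, hju⟩ := hdesc hu
    have hjx := cs.weakLE_iff_inversionSet_subset.1 hux hju
    have hjy := cs.weakLE_iff_inversionSet_subset.1 huy hju
    obtain ⟨m', hmx', hmy', hjm', hm'⟩ := hmeet j hjx hjy
    obtain ⟨p, -, hp⟩ := cs.exists_longest_mem_closure {i, j}
    have hpz {z : W} (hi : cs.simple i ∈ cs.inversionSet z)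
        (hj : cs.simple j ∈ cs.inversionSet z) : cs.weakLE p z := by
      rw [weakLE_iff_inversionSet_subset]
      intro t ht
      obtain ⟨htD, htr⟩ := (hp t).1 ht
      refine htr.mem_inversionSet_of_mem_closure (J := {i, j}) ?_ htD
      rintro k (rfl | rfl) <;> assumption
    have hip : cs.simple i ∈ cs.inversionSet p :=
      (hp _).2 ⟨Subgroup.subset_closure ⟨i, by simp, rfl⟩, cs.isReflection_simple i⟩
    have hjp : cs.simple j ∈ cs.inversionSet p :=
      (hp _).2 ⟨Subgroup.subset_closure ⟨j, by simp, rfl⟩, cs.isReflection_simple j⟩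
    have him' := cs.weakLE_iff_inversionSet_subset.1
      (hm' p hjp (hpz hix hjx) (hpz hiy hjy)) hip
    exact (hm' u hju hux huy).trans (hm m' him' hmx' hmy')
  · refine ⟨1, cs.one_weakLE x, cs.one_weakLE y, fun u hux huy ↦ ?_⟩
    by_cases hu : u = 1
    · rw [hu]
      exact cs.one_weakLE 1
    obtain ⟨i, hi⟩ := hdesc hu
    exact absurd ⟨i, cs.weakLE_iff_inversionSet_subset.1 hux hi,
      cs.weakLE_iff_inversionSet_subset.1 huy hi⟩ hcommon

/-! ### Minimal elements with a given inversion -/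

/-- For a descent `i` of `w`, there is a least element among those below `w` that have the cover
reflection `w sᵢ w⁻¹` as an inversion. -/
theorem exists_least_mem_inversionSet {w : W} {i : B} (hi : cs.IsRightDescent w i) :
    ∃ j, w * cs.simple i * w⁻¹ ∈ cs.inversionSet j ∧
      ∀ x, cs.weakLE x w → w * cs.simple i * w⁻¹ ∈ cs.inversionSet x → cs.weakLE j x := by
  obtain ⟨w₀, hw₀⟩ := cs.exists_forall_isReflection_mem_inversionSet
  have hc {t : W} (ht : cs.IsReflection t) :
      t ∈ cs.inversionSet (cs.simple i * w₀) ↔ t ≠ cs.simple i := by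
    have h := hw₀ _ (ht.conj (cs.simple i)⁻¹)
    rw [inv_inv] at h
    rw [mem_inversionSet_mul, mem_inversionSet_simple]
    tauto
  obtain ⟨m, hmw, hmc, hm⟩ := cs.exists_weak_meet w⁻¹ (cs.simple i * w₀)
  have hj {t : W} : t ∈ cs.inversionSet (w * m) ↔
      t ∈ cs.inversionSet w ∧ w⁻¹ * t * w ∉ cs.inversionSet m := by
    have h := hmw.mem_inversionSet_inv_mul (t := t)
    simpa [mem_inversionSet_inv, mul_assoc] using h
  refine ⟨w * m, ?_, fun x hxw hx ↦ ?_⟩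
  · rw [hj]
    refine ⟨cs.isRightDescent_iff_mem_inversionSet.1 hi, fun h ↦ ?_⟩
    have h' := cs.weakLE_iff_inversionSet_subset.1 hmc h
    rw [hc (cs.isReflection_of_mem_inversionSet h)] at h'
    simp [mul_assoc] at h'
  · have hxm : cs.weakLE (w⁻¹ * x) m := by
      refine hm _ ?_ ?_ <;> rw [weakLE_iff_inversionSet_subset] <;> intro t ht
      · rw [hxw.mem_inversionSet_inv_mul] at ht
        exact cs.mem_inversionSet_inv.2 ht.1
      · rw [hc (cs.isReflection_of_mem_inversionSet ht)]
        rintro rfl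
        exact (hxw.mem_inversionSet_inv_mul.1 ht).2 hx
    rw [weakLE_iff_inversionSet_subset] at hxm ⊢
    intro t ht
    rw [hj] at ht
    by_contra hn
    refine ht.2 (hxm (hxw.mem_inversionSet_inv_mul.2 ?_))
    simpa [mul_assoc] using ⟨ht.1, hn⟩

/-- An element `u ≤ w` whose only cover reflection is the cover reflection `w sᵢ w⁻¹` of `w` is
the least element below `w` having `w sᵢ w⁻¹` as an inversion. -/
theorem mem_inversionSet_and_weakLE_of_coverReflections_eq {u w : W} {i : B}
    (hi : cs.IsRightDescent w i) (huw : cs.weakLE u w)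
    (hu : cs.coverReflections u = {w * cs.simple i * w⁻¹}) :
    w * cs.simple i * w⁻¹ ∈ cs.inversionSet u ∧
      ∀ x, cs.weakLE x w → w * cs.simple i * w⁻¹ ∈ cs.inversionSet x → cs.weakLE u x := by
  have hmem : w * cs.simple i * w⁻¹ ∈ cs.inversionSet u := by
    obtain ⟨k, hk, e⟩ : w * cs.simple i * w⁻¹ ∈ cs.coverReflections u := by simp [hu]
    rw [e]
    exact cs.isRightDescent_iff_mem_inversionSet.1 hk
  obtain ⟨j, hj, hmin⟩ := cs.exists_least_mem_inversionSet hi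
  refine ⟨hmem, ?_⟩
  obtain rfl | ⟨k, hk, hjk⟩ := (hmin u huw hmem).eq_or_exists_isRightDescent
  · exact hmin
  · have hk' : u * cs.simple k * u⁻¹ ∈ cs.coverReflections u := ⟨k, hk, rfl⟩
    rw [hu, Set.mem_singleton_iff] at hk'
    have h := cs.weakLE_iff_inversionSet_subset.1 hjk hj
    rw [mem_inversionSet_mul_simple _ hk] at h
    exact absurd hk'.symm h.2

end CoxeterSystem

/-- Let `(W,S)` be a Coxeter system with `W` finite and let `w ∈ W`.  Suppose that for each
descent `d` of `w` there is a join-irreducible element `w_d ≤ w` whose set of cover reflections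
is `{w s_d w⁻¹}`.  Then `{w_d : d a descent of w}` is the canonical join representation of `w`
in the right weak order. -/
theorem isCanonicalJoinRep_of_forall_descent
    {B W : Type*} [Group W] [Finite W] {M : CoxeterMatrix B}
    (cs : CoxeterSystem M W) (w : W) (f : B → W)
    (hf : ∀ d : B, cs.IsRightDescent w d →
      cs.IsJoinIrreducible (f d) ∧ cs.weakLE (f d) w ∧
        cs.coverReflections (f d) = {w * cs.simple d * w⁻¹}) :
    cs.IsCanonicalJoinRep w {x | ∃ d : B, cs.IsRightDescent w d ∧ x = f d} := by
  have key (d : B) (hd : cs.IsRightDescent w d) :=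
    cs.mem_inversionSet_and_weakLE_of_coverReflections_eq hd (hf d hd).2.1 (hf d hd).2.2
  have sep (d : B) (hd : cs.IsRightDescent w d) : ¬ cs.weakLE (f d) (w * cs.simple d) := by
    intro h
    have h₁ := cs.weakLE_iff_inversionSet_subset.1 h (key d hd).1
    exact ((cs.mem_inversionSet_mul_simple hd).1 h₁).2 rfl
  have exists_mem (V : Set W) (hV : cs.IsWeakLUB V w) (d : B) (hd : cs.IsRightDescent w d) :
      ∃ v ∈ V, cs.weakLE (f d) v := by
    by_contra! hn
    have hw : cs.weakLE w (w * cs.simple d) := by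
      refine hV.2 _ fun v hv ↦ cs.weakLE_iff_inversionSet_subset.2 fun t ht ↦ ?_
      refine (cs.mem_inversionSet_mul_simple hd).2
        ⟨cs.weakLE_iff_inversionSet_subset.1 (hV.1 v hv) ht, ?_⟩
      rintro rfl
      exact hn v hv ((key d hd).2 v (hV.1 v hv) ht)
    exact sep d hd ((hf d hd).2.1.trans hw)
  refine ⟨Set.toFinite _, ⟨?_, ?_⟩, ?_, ?_⟩
  · rintro _ ⟨d, hd, rfl⟩
    exact (hf d hd).2.1
  · intro z hz
    obtain ⟨m, hmw, hmz, hm⟩ := cs.exists_weak_meet w z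
    obtain rfl | ⟨i, hi, hmi⟩ := hmw.eq_or_exists_isRightDescent
    · exact hmz
    · exact absurd ((hm _ (hf i hi).2.1 (hz _ ⟨i, hi, rfl⟩)).trans hmi) (sep i hi)
  · intro U' hU' hlub
    obtain ⟨_, ⟨d, hd, rfl⟩, hdU⟩ := Set.exists_of_ssubset hU'
    obtain ⟨v, hv, hdv⟩ := exists_mem U' hlub d hd
    obtain ⟨e, he, rfl⟩ := hU'.1 hv
    have hne : w * cs.simple d * w⁻¹ ≠ w * cs.simple e * w⁻¹ := by
      intro h
      have hs : cs.simple d = cs.simple e := by simpa using h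
      have hed : cs.weakLE (f e) (f d) :=
        (key e he).2 _ (hf d hd).2.1 (h ▸ (key d hd).1)
      exact hdU (hdv.antisymm hed ▸ hv)
    have hmem : w * cs.simple e * w⁻¹ ∈ cs.inversionSet w :=
      cs.isRightDescent_iff_mem_inversionSet.1 he
    have hle : cs.weakLE (f e) (w * cs.simple d) := by
      refine (key e he).2 _ (cs.weakLE_iff_inversionSet_subset.2 fun t ht ↦
        ((cs.mem_inversionSet_mul_simple hd).1 ht).1) ?_
      exact (cs.mem_inversionSet_mul_simple hd).2 ⟨hmem, hne.symm⟩
    exact sep d hd (hdv.trans hle)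
  · rintro V - hV - _ ⟨d, hd, rfl⟩
    exact exists_mem V hV d hd
end

section
/- Let w ∈ W(D_n). For each descent d of w set a_d = w(d), b_d = w(|d|+1), X_d = w({|d|+1,…,n}), and define R_d as follows, where [x,y] denotes the set of nonzero integers k with x ≤ k ≤ y, −Y = {−y : y ∈ Y}, and ±Y = Y ∪ (−Y): (A) if a_d + b_d < 0 and w({1,…,|d|}) ⊆ ±[a_d, n], then R_d = {−a_d} ∪ ((±[1, a_d−1]) ∩ X_d) ∪ ([a_d+1, −b_d−1] ∖ (−X_d)) ∪ [−b_d+1, n] when a_d > 0, and R_d = ([−a_d, −b_d−1] ∖ (−X_d)) ∪ [−b_d+1, n] when a_d < 0; (B) otherwise, R_d = ([b_d, a_d−1] ∩ X_d) ∪ [a_d+1, n] when a_d + b_d > 0, and R_d = ([b_d, a_d−1] ∩ X_d) ∪ ([a_d+1, −b_d−1] ∖ (−X_d)) ∪ [−b_d+1, n] when a_d + b_d < 0. Then for each descent d of w there exists a unique join-irreducible element w_d ∈ W(D_n) with R(w_d) = R_d, and the set {w_d : d a descent of w} is the canonical join representation of w in the right weak order on W(D_n). -/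
/-- An element of the Coxeter group `W(D_n)`, modelled as a permutation of `ℤ` fixing
everything outside `{±1,…,±n}`, with `w(−i) = −w(i)` and an even number of
`i ∈ {1,…,n}` with `w(i) < 0`. -/
def IsDPerm (n : ℕ) (w : Equiv.Perm ℤ) : Prop :=
  (∀ i : ℤ, ¬(1 ≤ |i| ∧ |i| ≤ (n : ℤ)) → w i = i) ∧
  (∀ i : ℤ, w (-i) = -(w i)) ∧
  Even ((Finset.Icc (1 : ℤ) (n : ℤ)).filter (fun i => w i < 0)).card

/-- `l` is a descent of `w ∈ W(D_n)`: `l ∈ {−1} ∪ {1,…,n−1}` and `w(l) > w(|l|+1)`. -/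
def IsDescentD (n : ℕ) (w : Equiv.Perm ℤ) (l : ℤ) : Prop :=
  (l = -1 ∨ (1 ≤ l ∧ l ≤ (n : ℤ) - 1)) ∧ w (|l| + 1) < w l

/-- The inversion set of `w ∈ W(D_n)`:
`inv(w) = {(a,b) : a,b ∈ {±1,…,±n}, a > |b|, w⁻¹(a) < w⁻¹(b)}`. -/
def invSetD (n : ℕ) (w : Equiv.Perm ℤ) : Set (ℤ × ℤ) :=
  {p | (1 ≤ |p.1| ∧ |p.1| ≤ (n : ℤ)) ∧ (1 ≤ |p.2| ∧ |p.2| ≤ (n : ℤ)) ∧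
    |p.2| < p.1 ∧ w.symm p.1 < w.symm p.2}

/-- The right weak order on `W(D_n)`: `u ≤ w` iff `inv(u) ⊆ inv(w)`. -/
def weakLED (n : ℕ) (u w : Equiv.Perm ℤ) : Prop :=
  invSetD n u ⊆ invSetD n w

/-- `w` is a least upper bound of `S ⊆ W(D_n)` in the right weak order on `W(D_n)`. -/
def IsWeakLUBD (n : ℕ) (S : Set (Equiv.Perm ℤ)) (w : Equiv.Perm ℤ) : Prop :=
  (∀ x ∈ S, weakLED n x w) ∧ ∀ z, IsDPerm n z → (∀ x ∈ S, weakLED n x z) → weakLED n w z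

/-- `w` is join-irreducible in the right weak order on `W(D_n)`. -/
def IsJoinIrreducibleD (n : ℕ) (w : Equiv.Perm ℤ) : Prop :=
  w ≠ 1 ∧ ∀ u v, IsDPerm n u → IsDPerm n v → IsWeakLUBD n {u, v} w → u = w ∨ v = w

/-- `[x,y]`: the set of nonzero integers `k` with `x ≤ k ≤ y`. -/
def nzIcc (x y : ℤ) : Set ℤ := {k | k ≠ 0 ∧ x ≤ k ∧ k ≤ y}

/-- `−Y = {−y : y ∈ Y}`. -/
def negSet (Y : Set ℤ) : Set ℤ := {k | -k ∈ Y}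

/-- `±Y = Y ∪ (−Y)`. -/
def pmSet (Y : Set ℤ) : Set ℤ := Y ∪ negSet Y

open Classical in
/-- The set `R_d` attached to a descent `d` of `w ∈ W(D_n)`, where `a_d = w(d)`,
`b_d = w(|d|+1)` and `X_d = w({|d|+1,…,n})`:
(A) if `a_d + b_d < 0` and `w({1,…,|d|}) ⊆ ±[a_d, n]`, then
`R_d = {−a_d} ∪ ((±[1,a_d−1]) ∩ X_d) ∪ ([a_d+1,−b_d−1] ∖ (−X_d)) ∪ [−b_d+1,n]` if `a_d > 0`,
and `R_d = ([−a_d,−b_d−1] ∖ (−X_d)) ∪ [−b_d+1,n]` if `a_d < 0`;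
(B) otherwise, `R_d = ([b_d,a_d−1] ∩ X_d) ∪ [a_d+1,n]` if `a_d + b_d > 0`, and
`R_d = ([b_d,a_d−1] ∩ X_d) ∪ ([a_d+1,−b_d−1] ∖ (−X_d)) ∪ [−b_d+1,n]` if `a_d + b_d < 0`. -/
noncomputable def RsetD (n : ℕ) (w : Equiv.Perm ℤ) (d : ℤ) : Set ℤ :=
  let a := w d
  let b := w (|d| + 1)
  let X := ⇑w '' Set.Icc (|d| + 1) (n : ℤ)
  if a + b < 0 ∧ ⇑w '' Set.Icc 1 |d| ⊆ pmSet (nzIcc a (n : ℤ)) then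
    if 0 < a then
      {-a} ∪ (pmSet (nzIcc 1 (a - 1)) ∩ X) ∪ (nzIcc (a + 1) (-b - 1) \ negSet X) ∪
        nzIcc (-b + 1) (n : ℤ)
    else
      (nzIcc (-a) (-b - 1) \ negSet X) ∪ nzIcc (-b + 1) (n : ℤ)
  else
    if 0 < a + b then
      (nzIcc b (a - 1) ∩ X) ∪ nzIcc (a + 1) (n : ℤ)
    else
      (nzIcc b (a - 1) ∩ X) ∪ (nzIcc (a + 1) (-b - 1) \ negSet X) ∪
        nzIcc (-b + 1) (n : ℤ)

/-- `u` is a join-irreducible element of `W(D_n)` with `R(u) = R`, where `R(u)` is the image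
under `u` of `{|l|+1,…,n}` for `l` the unique descent (the type) of `u`. -/
def IsJoinIrrWithR (n : ℕ) (u : Equiv.Perm ℤ) (R : Set ℤ) : Prop :=
  IsDPerm n u ∧ IsJoinIrreducibleD n u ∧
    ∃ l : ℤ, IsDescentD n u l ∧ (∀ l', IsDescentD n u l' → l' = l) ∧
      ⇑u '' Set.Icc (|l| + 1) (n : ℤ) = R

/-- `U` is the canonical join representation of `w` in the right weak order on `W(D_n)`. -/
def IsCanonicalJoinRepD (n : ℕ) (w : Equiv.Perm ℤ) (U : Set (Equiv.Perm ℤ)) : Prop :=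
  U.Finite ∧ (∀ u ∈ U, IsDPerm n u) ∧ IsWeakLUBD n U w ∧ (∀ U' ⊂ U, ¬ IsWeakLUBD n U' w) ∧
    ∀ V : Set (Equiv.Perm ℤ), V.Finite → (∀ v ∈ V, IsDPerm n v) → IsWeakLUBD n V w →
      (∀ V' ⊂ V, ¬ IsWeakLUBD n V' w) → ∀ u ∈ U, ∃ v ∈ V, weakLED n u v

/-- `k ∈ {±1,…,±n}`. -/
def PmRange (n : ℕ) (k : ℤ) : Prop := k ≠ 0 ∧ -(n : ℤ) ≤ k ∧ k ≤ n

lemma pmRange_iff_abs (n : ℕ) (k : ℤ) : PmRange n k ↔ 1 ≤ |k| ∧ |k| ≤ (n : ℤ) := by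
  unfold PmRange
  rw [abs_le, ← abs_pos, Int.lt_iff_add_one_le, zero_add]

lemma PmRange.neg {n : ℕ} {k : ℤ} (h : PmRange n k) : PmRange n (-k) := by
  unfold PmRange at *
  omega

/-- A signed permutation of `{±1,…,±n}`, extended by the identity to `ℤ`. -/
def IsSignedPerm (n : ℕ) (w : Equiv.Perm ℤ) : Prop :=
  (∀ i, ¬ PmRange n i → w i = i) ∧ ∀ i, w (-i) = -(w i)

namespace IsSignedPerm

variable {n : ℕ} {u v w : Equiv.Perm ℤ}

lemma symm_neg (hw : IsSignedPerm n w) (i : ℤ) : w.symm (-i) = -(w.symm i) := by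
  rw [Equiv.symm_apply_eq, hw.2, Equiv.apply_symm_apply]

lemma pmRange_apply (hw : IsSignedPerm n w) {i : ℤ} (hi : PmRange n i) : PmRange n (w i) := by
  by_contra h
  have := w.injective (hw.1 _ h)
  rw [this] at h
  exact h hi

lemma inv (hw : IsSignedPerm n w) : IsSignedPerm n w⁻¹ := by
  refine ⟨fun i hi => ?_, hw.symm_neg⟩
  rw [Equiv.Perm.inv_eq_iff_eq, hw.1 i hi]

lemma pmRange_symm (hw : IsSignedPerm n w) {i : ℤ} (hi : PmRange n i) :
    PmRange n (w.symm i) :=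
  hw.inv.pmRange_apply hi

lemma mul (hu : IsSignedPerm n u) (hv : IsSignedPerm n v) : IsSignedPerm n (u * v) := by
  refine ⟨fun i hi => ?_, fun i => ?_⟩
  · rw [Equiv.Perm.mul_apply, hv.1 i hi, hu.1 i hi]
  · simp [hu.2, hv.2]

end IsSignedPerm

/-- The sign of an integer, with `0` counted as positive. -/
def posSign (x : ℤ) : ℤ := if x < 0 then -1 else 1

lemma posSign_neg {x : ℤ} (hx : x ≠ 0) : posSign (-x) = -posSign x := by
  unfold posSign
  split_ifs <;> omega

/-- The product of the signs of `w(1),…,w(n)`. -/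
noncomputable def signProd (n : ℕ) (w : Equiv.Perm ℤ) : ℤ :=
  ∏ i ∈ Finset.Icc (1 : ℤ) n, posSign (w i)

lemma even_card_iff_signProd (n : ℕ) (w : Equiv.Perm ℤ) :
    Even ((Finset.Icc (1 : ℤ) (n : ℤ)).filter (fun i => w i < 0)).card ↔ signProd n w = 1 := by
  unfold signProd posSign
  rw [Finset.prod_ite, Finset.prod_const, Finset.prod_const_one, mul_one,
    neg_one_pow_eq_one_iff_even (by norm_num)]

lemma isDPerm_iff (n : ℕ) (w : Equiv.Perm ℤ) :
    IsDPerm n w ↔ IsSignedPerm n w ∧ signProd n w = 1 := by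
  unfold IsDPerm IsSignedPerm
  simp only [even_card_iff_signProd, pmRange_iff_abs, and_assoc]

lemma pmRange_of_mem_Icc {n : ℕ} {i : ℤ} (hi : i ∈ Finset.Icc (1 : ℤ) n) : PmRange n i := by
  rw [Finset.mem_Icc] at hi
  unfold PmRange
  omega

lemma abs_mem_Icc {n : ℕ} {i : ℤ} (hi : PmRange n i) : |i| ∈ Finset.Icc (1 : ℤ) n := by
  rw [Finset.mem_Icc]
  exact (pmRange_iff_abs n i).1 hi

lemma IsSignedPerm.abs_abs_symm {n : ℕ} {v : Equiv.Perm ℤ} (hv : IsSignedPerm n v) {i : ℤ}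
    (hi : 0 ≤ i) : |v (|v.symm i|)| = i := by
  rcases abs_choice (v.symm i) with h | h <;> rw [h]
  · simpa using hi
  · rw [hv.2]
    simpa using hi

lemma signProd_mul {n : ℕ} {u v : Equiv.Perm ℤ} (hu : IsSignedPerm n u)
    (hv : IsSignedPerm n v) : signProd n (u * v) = signProd n u * signProd n v := by
  have h1 : ∀ i ∈ Finset.Icc (1 : ℤ) n,
      posSign ((u * v) i) = posSign (u |v i|) * posSign (v i) := by
    intro i hi
    have hvi := hv.pmRange_apply (pmRange_of_mem_Icc hi)
    have huv := hu.pmRange_apply hvi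
    rw [Equiv.Perm.mul_apply]
    rcases lt_or_gt_of_ne hvi.1 with h | h
    · rw [abs_of_neg h, hu.2, posSign_neg huv.1]
      simp [posSign, h]
    · rw [abs_of_pos h]
      simp [posSign, not_lt.2 h.le]
  unfold signProd
  rw [Finset.prod_congr rfl h1, Finset.prod_mul_distrib]
  congr 1
  refine Finset.prod_nbij' (fun i => |v i|) (fun i => |v.symm i|) ?_ ?_ ?_ ?_ ?_
  · exact fun i hi => abs_mem_Icc (hv.pmRange_apply (pmRange_of_mem_Icc hi))
  · exact fun i hi => abs_mem_Icc (hv.pmRange_symm (pmRange_of_mem_Icc hi))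
  · intro i hi
    exact hv.inv.abs_abs_symm (zero_le_one.trans (Finset.mem_Icc.1 hi).1)
  · intro i hi
    exact hv.abs_abs_symm (zero_le_one.trans (Finset.mem_Icc.1 hi).1)
  · exact fun _ _ => rfl

namespace IsDPerm

variable {n : ℕ} {u v w : Equiv.Perm ℤ}

lemma signed (hw : IsDPerm n w) : IsSignedPerm n w := ((isDPerm_iff n w).1 hw).1

lemma mul (hu : IsDPerm n u) (hv : IsDPerm n v) : IsDPerm n (u * v) := by
  rw [isDPerm_iff] at *
  exact ⟨hu.1.mul hv.1, by rw [signProd_mul hu.1 hv.1, hu.2, hv.2, mul_one]⟩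

lemma inv (hu : IsDPerm n u) : IsDPerm n u⁻¹ := by
  rw [isDPerm_iff] at *
  refine ⟨hu.1.inv, ?_⟩
  have h := signProd_mul hu.1 hu.1.inv
  rw [mul_inv_cancel, hu.2, one_mul] at h
  rw [← h]
  refine Finset.prod_eq_one fun i hi => ?_
  have := (Finset.mem_Icc.1 hi).1
  rw [Equiv.Perm.one_apply]
  exact if_neg (by omega)

end IsDPerm

/-- The simple reflection of `W(D_n)` indexed by `d ∈ {−1} ∪ {1,…,n−1}`. -/
def simpleRefl (d : ℤ) : Equiv.Perm ℤ :=
  Equiv.swap d (|d| + 1) * Equiv.swap (-d) (-(|d| + 1))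

lemma simpleRefl_apply {d : ℤ} (hd : d = -1 ∨ 1 ≤ d) (i : ℤ) :
    simpleRefl d i = if i = d then |d| + 1 else if i = |d| + 1 then d else
      if i = -d then -(|d| + 1) else if i = -(|d| + 1) then -d else i := by
  have h : |d| = d ∧ 1 ≤ d ∨ |d| = 1 ∧ d = -1 := by
    rcases hd with rfl | h
    · right; simp
    · left; exact ⟨abs_of_pos (by omega), h⟩
  simp only [simpleRefl, Equiv.Perm.mul_apply, Equiv.swap_apply_def]
  split_ifs <;> omega

lemma simpleRefl_simpleRefl {d : ℤ} (hd : d = -1 ∨ 1 ≤ d) (i : ℤ) :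
    simpleRefl d (simpleRefl d i) = i := by
  have h : |d| = d ∧ 1 ≤ d ∨ |d| = 1 ∧ d = -1 := by
    rcases hd with rfl | h
    · right; simp
    · left; exact ⟨abs_of_pos (by omega), h⟩
  simp only [simpleRefl_apply hd]
  split_ifs <;> omega

lemma isDPerm_simpleRefl {n : ℕ} (hn : 2 ≤ n) {d : ℤ}
    (hd : d = -1 ∨ (1 ≤ d ∧ d ≤ (n : ℤ) - 1)) : IsDPerm n (simpleRefl d) := by
  have hd' : d = -1 ∨ 1 ≤ d := hd.imp_right And.left
  have h : |d| = d ∧ 1 ≤ d ∧ d ≤ (n : ℤ) - 1 ∨ |d| = 1 ∧ d = -1 := by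
    rcases hd with rfl | h
    · right; simp
    · left; exact ⟨abs_of_pos (by omega), h⟩
  rw [isDPerm_iff, ← even_card_iff_signProd]
  refine ⟨⟨fun i hi => ?_, fun i => ?_⟩, ?_⟩
  · unfold PmRange at hi
    rw [simpleRefl_apply hd']
    split_ifs <;> omega
  · simp only [simpleRefl_apply hd']
    split_ifs <;> omega
  · rcases h with ⟨h, h1, h2⟩ | ⟨h, h1⟩
    · rw [Finset.filter_false_of_mem]
      · simp
      · intro i hi
        rw [Finset.mem_Icc] at hi
        rw [simpleRefl_apply hd']
        split_ifs <;> omega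
    · have : (Finset.Icc (1 : ℤ) (n : ℤ)).filter (fun i => simpleRefl d i < 0) = {1, 2} := by
        ext i
        rw [Finset.mem_filter, Finset.mem_Icc, simpleRefl_apply hd', Finset.mem_insert,
          Finset.mem_singleton]
        split_ifs <;> omega
      rw [this]
      decide

lemma weakLED_iff {n : ℕ} {u w : Equiv.Perm ℤ} (hu : IsSignedPerm n u)
    (hw : IsSignedPerm n w) :
    weakLED n u w ↔ ∀ p q, PmRange n p → PmRange n q → q < p → p ≠ -q →
      u.symm p < u.symm q → w.symm p < w.symm q := by
  simp only [weakLED, invSetD, ← pmRange_iff_abs, Set.ofPred_subset_ofPred, Prod.forall, abs_lt]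
  constructor
  · intro h p q hp hq hqp hpq hlt
    rcases lt_or_gt_of_ne hpq with h1 | h1
    · have := (h (-q) (-p) ⟨hq.neg, hp.neg, by omega, by
        rw [hu.symm_neg, hu.symm_neg]; omega⟩).2.2.2
      rw [hw.symm_neg, hw.symm_neg] at this
      omega
    · exact (h p q ⟨hp, hq, by omega, hlt⟩).2.2.2
  · intro h p q ⟨hp, hq, hpq, hlt⟩
    exact ⟨hp, hq, hpq, h p q hp hq (by omega) (by omega) hlt⟩

lemma weakLED.refl (n : ℕ) (w : Equiv.Perm ℤ) : weakLED n w w := Set.Subset.refl _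

lemma weakLED.trans {n : ℕ} {u v w : Equiv.Perm ℤ} (h : weakLED n u v) (h' : weakLED n v w) :
    weakLED n u w := Set.Subset.trans h h'

lemma lt_of_forall_lt_succ {f : ℤ → ℤ} {lo hi : ℤ}
    (h : ∀ i, lo ≤ i → i < hi → f i < f (i + 1)) {i j : ℤ} (hi' : lo ≤ i) (hij : i < j)
    (hj : j ≤ hi) : f i < f j := by
  induction j, hij using Int.leInduction with
  | base => exact h i hi' hj
  | succ k hk ih => exact (ih (by omega)).trans (h k (by omega) (by omega))

lemma IsSignedPerm.lt_of_no_descent {n : ℕ} {y : Equiv.Perm ℤ} (hy : IsSignedPerm n y) {k : ℤ}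
    (hk : 2 ≤ k) (hkn : k ≤ n) (h : ∀ l, IsDescentD n y l → k ≤ l) {p q : ℤ} (hp : p ≠ 0)
    (hq : q ≠ 0) (hpk : -k ≤ p) (hpq : p < q) (hqk : q ≤ k) (hne : p ≠ -q) : y p < y q := by
  have h0 : ∀ i j, 1 ≤ i → i < j → j ≤ k → y i < y j := by
    intro i j hi hij hj
    refine lt_of_forall_lt_succ (lo := 1) (hi := k) ?_ hi hij hj
    intro i hi hik
    by_contra hc
    have h1 : y (i + 1) ≠ y i := fun hc => by simpa using y.injective hc
    have := h i ⟨Or.inr ⟨hi, by omega⟩, by rw [abs_of_pos (by omega)]; omega⟩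
    omega
  have h1 : -(y 1) < y 2 := by
    by_contra hc
    have h1 : y 2 ≠ y (-1) := fun hc => by simpa using y.injective hc
    rw [hy.2] at h1
    have := h (-1) ⟨Or.inl rfl, by
      rw [hy.2 1, show |(-1 : ℤ)| + 1 = 2 by norm_num]; omega⟩
    omega
  have h2 := h0 1 2 le_rfl (by norm_num) hk
  have h3 : ∀ i j, 1 ≤ i → i < j → j ≤ k → -(y i) < y j := by
    intro i j hi hij hj
    have h4 : y 2 ≤ y j := by
      rcases eq_or_lt_of_le (show 2 ≤ j by omega) with h | h
      · rw [h]
      · exact (h0 _ _ (by norm_num) h hj).le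
    rcases eq_or_lt_of_le hi with h | h
    · rw [← h]
      omega
    · have := h0 1 i le_rfl h (by omega)
      have := h0 i j hi hij hj
      rcases eq_or_lt_of_le (show 2 ≤ i by omega) with h | h
      · rw [← h] at *
        omega
      · have := h0 2 i (by omega) h (by omega)
        omega
  rcases lt_or_gt_of_ne hp with hp0 | hp0
  · have hyp : y p = -(y (-p)) := by rw [hy.2, neg_neg]
    rcases lt_or_gt_of_ne hq with hq0 | hq0
    · have hyq : y q = -(y (-q)) := by rw [hy.2, neg_neg]
      have := h0 (-q) (-p) (by omega) (by omega) (by omega)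
      omega
    · rcases lt_or_gt_of_ne (show -p ≠ q by omega) with h4 | h4
      · have := h3 (-p) q (by omega) h4 hqk
        omega
      · have := h3 q (-p) (by omega) h4 (by omega)
        omega
  · exact h0 p q hp0 hpq hqk

lemma IsDPerm.eq_one_of_no_descent {n : ℕ} (hn : 2 ≤ n) {v : Equiv.Perm ℤ} (hv : IsDPerm n v)
    (h : ∀ l, ¬ IsDescentD n v l) : v = 1 := by
  have hlt : ∀ p q : ℤ, p ≠ 0 → q ≠ 0 → -(n : ℤ) ≤ p → p < q → q ≤ n → p ≠ -q → v p < v q :=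
    fun p q hp hq h1 h2 h3 h4 => hv.signed.lt_of_no_descent (by omega) le_rfl
      (fun l hl => absurd hl (h l)) hp hq h1 h2 h3 h4
  have hr : ∀ i : ℤ, 1 ≤ i → i ≤ n → PmRange n (v i) := fun i h1 h2 =>
    hv.signed.pmRange_apply ⟨by omega, by omega, h2⟩
  have hle : ∀ m : ℕ, ∀ i : ℤ, 1 ≤ i → i + m = n → v i ≤ i := by
    intro m
    induction m with
    | zero =>
      intro i hi him
      have := (hr i hi (by omega)).2.2
      omega
    | succ m ih =>
      intro i hi him
      have h1 := ih (i + 1) (by omega) (by omega)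
      have h2 := hlt i (i + 1) (by omega) (by omega) (by omega) (by omega) (by omega) (by omega)
      omega
  have hle' : ∀ i : ℤ, 1 ≤ i → i ≤ n → v i ≤ i := fun i h1 h2 =>
    hle (n - i).toNat i h1 (by omega)
  have h12 := hlt 1 2 (by norm_num) (by norm_num) (by omega) (by norm_num) (by omega) (by norm_num)
  have h12' := hlt (-1) 2 (by norm_num) (by norm_num) (by omega) (by norm_num) (by omega)
    (by norm_num)
  rw [hv.signed.2] at h12'
  have h1 := (hr 1 le_rfl (by omega)).1
  have hge : ∀ i : ℤ, 2 ≤ i → i ≤ n → i ≤ v i := by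
    intro i hi
    induction i, hi using Int.leInduction with
    | base => omega
    | succ i hi ih =>
      intro hin
      have := ih (by omega)
      have := hlt i (i + 1) (by omega) (by omega) (by omega) (by omega) (by omega) (by omega)
      omega
  have heq : ∀ i : ℤ, 2 ≤ i → i ≤ n → v i = i := fun i h1 h2 =>
    le_antisymm (hle' i (by omega) h2) (hge i h1 h2)
  have hv1 : v 1 = 1 := by
    have h2 := heq 2 le_rfl (by omega)
    have h3 := hle' 1 le_rfl (by omega)
    by_contra hc
    have h4 : v 1 = -1 := by omega
    have hev := hv.2.2
    have : (Finset.Icc (1 : ℤ) (n : ℤ)).filter (fun i => v i < 0) = {1} := by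
      ext i
      rw [Finset.mem_filter, Finset.mem_Icc, Finset.mem_singleton]
      constructor
      · rintro ⟨⟨h5, h6⟩, h7⟩
        by_contra hi
        have := heq i (by omega) h6
        omega
      · rintro rfl
        omega
    rw [this] at hev
    exact absurd hev (by decide)
  have hpos : ∀ i : ℤ, 1 ≤ i → v i = i := by
    intro i hi
    by_cases hin : i ≤ n
    · rcases eq_or_lt_of_le hi with h | h
      · rw [← h, hv1]
      · exact heq i h hin
    · exact hv.signed.1 i fun hc => hin hc.2.2
  ext i
  rw [Equiv.Perm.one_apply]
  rcases lt_trichotomy i 0 with hi | rfl | hi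
  · have := hv.signed.2 (-i)
    rw [neg_neg, hpos (-i) (by omega)] at this
    omega
  · exact hv.signed.1 0 fun hc => hc.1 rfl
  · exact hpos i hi

lemma IsDescentD.abs_eq {n : ℕ} {w : Equiv.Perm ℤ} {d : ℤ} (hd : IsDescentD n w d) :
    |d| = d ∧ 1 ≤ d ∧ d ≤ (n : ℤ) - 1 ∨ |d| = 1 ∧ d = -1 := by
  rcases hd.1 with rfl | h
  · right; simp
  · left; exact ⟨abs_of_pos (by omega), h⟩

lemma IsDescentD.simple {n : ℕ} {w : Equiv.Perm ℤ} {d : ℤ} (hd : IsDescentD n w d) :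
    d = -1 ∨ 1 ≤ d := hd.1.imp_right And.left

lemma IsDescentD.pmRange {n : ℕ} (hn : 2 ≤ n) {w : Equiv.Perm ℤ} {d : ℤ}
    (hd : IsDescentD n w d) : PmRange n d ∧ PmRange n (|d| + 1) := by
  have := hd.abs_eq
  unfold PmRange
  omega

/-- Apart from the two pairs it swaps, a simple reflection preserves the order of pairs of
positions which are not opposite. -/
lemma simpleRefl_lt {d : ℤ} (hd : d = -1 ∨ 1 ≤ d) {P Q : ℤ} (hP : P ≠ 0) (hQ : Q ≠ 0)
    (hPQ : P < Q) (hne : P ≠ -Q) (h1 : ¬(P = d ∧ Q = |d| + 1))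
    (h2 : ¬(P = -(|d| + 1) ∧ Q = -d)) : simpleRefl d P < simpleRefl d Q := by
  have h : |d| = d ∧ 1 ≤ d ∨ |d| = 1 ∧ d = -1 := by
    rcases hd with rfl | h
    · right; simp
    · left; exact ⟨abs_of_pos (by omega), h⟩
  simp only [simpleRefl_apply hd]
  split_ifs <;> omega

lemma mul_simpleRefl_symm {d : ℤ} (hd : d = -1 ∨ 1 ≤ d) (w : Equiv.Perm ℤ) (i : ℤ) :
    (w * simpleRefl d).symm i = simpleRefl d (w.symm i) := by
  rw [Equiv.symm_apply_eq, Equiv.Perm.mul_apply, simpleRefl_simpleRefl hd,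
    Equiv.apply_symm_apply]

lemma IsSignedPerm.symm_ne_neg {n : ℕ} {w : Equiv.Perm ℤ} (hw : IsSignedPerm n w) {p q : ℤ}
    (h : p ≠ -q) : w.symm p ≠ -(w.symm q) := by
  rw [← hw.symm_neg]
  exact fun hc => h (w.symm.injective hc)

lemma IsDPerm.mul_simpleRefl {n : ℕ} (hn : 2 ≤ n) {w : Equiv.Perm ℤ} (hw : IsDPerm n w) {d : ℤ}
    (hd : IsDescentD n w d) : IsDPerm n (w * simpleRefl d) :=
  hw.mul (isDPerm_simpleRefl hn hd.1)

/-- The values of `w` at a descent. -/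
lemma IsDescentD.pmRange_apply {n : ℕ} (hn : 2 ≤ n) {w : Equiv.Perm ℤ} (hw : IsDPerm n w) {d : ℤ}
    (hd : IsDescentD n w d) : PmRange n (w d) ∧ PmRange n (w (|d| + 1)) ∧ w d ≠ -(w (|d| + 1)) := by
  refine ⟨hw.signed.pmRange_apply (hd.pmRange hn).1, hw.signed.pmRange_apply (hd.pmRange hn).2, ?_⟩
  rw [← hw.signed.2]
  intro hc
  have := w.injective hc
  have := hd.abs_eq
  omega

lemma weakLED_mul_simpleRefl {n : ℕ} (hn : 2 ≤ n) {u w : Equiv.Perm ℤ} (hu : IsDPerm n u)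
    (hw : IsDPerm n w) (h : weakLED n u w) {d : ℤ} (hd : IsDescentD n w d)
    (hni : ¬ u.symm (w d) < u.symm (w (|d| + 1))) : weakLED n u (w * simpleRefl d) := by
  rw [weakLED_iff hu.signed (hw.mul_simpleRefl hn hd).signed]
  rw [weakLED_iff hu.signed hw.signed] at h
  intro p q hp hq hqp hne hlt
  rw [mul_simpleRefl_symm hd.simple, mul_simpleRefl_symm hd.simple]
  refine simpleRefl_lt hd.simple (hw.signed.pmRange_symm hp).1 (hw.signed.pmRange_symm hq).1
    (h p q hp hq hqp hne hlt) (hw.signed.symm_ne_neg hne) ?_ ?_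
  · rintro ⟨h1, h2⟩
    rw [Equiv.symm_apply_eq] at h1 h2
    rw [← h1, ← h2] at hni
    exact hni hlt
  · rintro ⟨h1, h2⟩
    rw [Equiv.symm_apply_eq, hw.signed.2] at h1 h2
    rw [show w (|d| + 1) = -p by omega, show w d = -q by omega, hu.signed.symm_neg,
      hu.signed.symm_neg] at hni
    omega

lemma mul_simpleRefl_weakLED {n : ℕ} (hn : 2 ≤ n) {w : Equiv.Perm ℤ}
    (hw : IsDPerm n w) {d : ℤ} (hd : IsDescentD n w d) : weakLED n (w * simpleRefl d) w := by
  rw [weakLED_iff (hw.mul_simpleRefl hn hd).signed hw.signed]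
  intro p q hp hq hqp hne hlt
  rw [mul_simpleRefl_symm hd.simple, mul_simpleRefl_symm hd.simple] at hlt
  by_contra hc
  have h0 : w.symm q ≠ w.symm p := fun hc => hqp.ne (w.symm.injective hc)
  have hlt' := hd.2
  have := simpleRefl_lt hd.simple (hw.signed.pmRange_symm hq).1 (hw.signed.pmRange_symm hp).1
    (by omega) (hw.signed.symm_ne_neg (by omega)) ?_ ?_
  · omega
  · rintro ⟨h1, h2⟩
    rw [Equiv.symm_apply_eq] at h1 h2
    omega
  · rintro ⟨h1, h2⟩
    rw [Equiv.symm_apply_eq, hw.signed.2] at h1 h2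
    omega

lemma mul_simpleRefl_not_inverted {n : ℕ} {w : Equiv.Perm ℤ} {d : ℤ}
    (hd : IsDescentD n w d) :
    ¬ (w * simpleRefl d).symm (w d) < (w * simpleRefl d).symm (w (|d| + 1)) := by
  have h := hd.abs_eq
  rw [mul_simpleRefl_symm hd.simple, mul_simpleRefl_symm hd.simple, Equiv.symm_apply_apply,
    Equiv.symm_apply_apply]
  simp only [simpleRefl_apply hd.simple]
  split_ifs <;> omega

lemma not_weakLED_mul_simpleRefl {n : ℕ} (hn : 2 ≤ n) {w : Equiv.Perm ℤ} (hw : IsDPerm n w)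
    {d : ℤ} (hd : IsDescentD n w d) : ¬ weakLED n w (w * simpleRefl d) := by
  intro h
  obtain ⟨h1, h2, h3⟩ := hd.pmRange_apply hn hw
  rw [weakLED_iff hw.signed (hw.mul_simpleRefl hn hd).signed] at h
  refine mul_simpleRefl_not_inverted hd (h _ _ h1 h2 hd.2 h3 ?_)
  have := hd.abs_eq
  rw [Equiv.symm_apply_apply, Equiv.symm_apply_apply]
  omega

/-- Going down along the descent `d` keeps every inversion other than the one at `d`. -/
lemma mul_simpleRefl_inverted {n : ℕ} {w : Equiv.Perm ℤ} (hw : IsDPerm n w)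
    {d : ℤ} (hd : IsDescentD n w d) {p q : ℤ} (hp : PmRange n p) (hq : PmRange n q)
    (hne : p ≠ -q) (hlt : w.symm p < w.symm q)
    (h1 : ¬(w d = p ∧ w (|d| + 1) = q)) (h2 : ¬(w d = -q ∧ w (|d| + 1) = -p)) :
    (w * simpleRefl d).symm p < (w * simpleRefl d).symm q := by
  rw [mul_simpleRefl_symm hd.simple, mul_simpleRefl_symm hd.simple]
  refine simpleRefl_lt hd.simple (hw.signed.pmRange_symm hp).1 (hw.signed.pmRange_symm hq).1
    hlt (hw.signed.symm_ne_neg hne) ?_ ?_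
  · rintro ⟨h3, h4⟩
    rw [Equiv.symm_apply_eq] at h3 h4
    exact h1 ⟨h3.symm, h4.symm⟩
  · rintro ⟨h3, h4⟩
    rw [Equiv.symm_apply_eq, hw.signed.2] at h3 h4
    exact h2 ⟨by omega, by omega⟩

lemma finite_invSetD (n : ℕ) (w : Equiv.Perm ℤ) : (invSetD n w).Finite := by
  refine ((Set.finite_Icc (-(n : ℤ)) n).prod (Set.finite_Icc (-(n : ℤ)) n)).subset ?_
  rintro ⟨p, q⟩ ⟨hp, hq, -⟩
  exact ⟨abs_le.1 hp.2, abs_le.1 hq.2⟩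

/-- Two descents whose values agree up to negation and reversal are equal. -/
lemma IsDescentD.eq_of_values {n : ℕ} {w : Equiv.Perm ℤ} (hw : IsSignedPerm n w) {d e : ℤ}
    (hd : IsDescentD n w d) (he : IsDescentD n w e)
    (h : (w d = w e ∧ w (|d| + 1) = w (|e| + 1)) ∨
      (w d = -(w (|e| + 1)) ∧ w (|d| + 1) = -(w e))) : d = e := by
  rcases h with ⟨h, -⟩ | ⟨h1, h2⟩
  · exact w.injective h
  · rw [← hw.2] at h1 h2
    have h1 := w.injective h1
    have h2 := w.injective h2
    have := hd.abs_eq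
    have := he.abs_eq
    omega

/-- Below every element in which `a` precedes `b` there is one with the same property, all of
whose descents are at the pair `a, b`. -/
lemma exists_single_descent {n : ℕ} (hn : 2 ≤ n) {a b : ℤ} (ha : PmRange n a)
    (hb : PmRange n b) (hba : b < a) (hne : a ≠ -b) {y : Equiv.Perm ℤ} (hy : IsDPerm n y)
    (hinv : y.symm a < y.symm b) :
    ∃ x, IsDPerm n x ∧ weakLED n x y ∧ x.symm a < x.symm b ∧
      ∃ l, IsDescentD n x l ∧ (∀ l', IsDescentD n x l' → l' = l) ∧
        ((x l = a ∧ x (|l| + 1) = b) ∨ (x l = -b ∧ x (|l| + 1) = -a)) := by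
  induction hm : (invSetD n y).ncard using Nat.strong_induction_on generalizing y with
  | _ m ih =>
  by_cases hall : ∀ e, IsDescentD n y e →
      ((y e = a ∧ y (|e| + 1) = b) ∨ (y e = -b ∧ y (|e| + 1) = -a))
  · refine ⟨y, hy, weakLED.refl n y, hinv, ?_⟩
    have hex : ∃ l, IsDescentD n y l := by
      by_contra hc
      push Not at hc
      have := hy.eq_one_of_no_descent hn hc
      rw [this] at hinv
      exact absurd hinv (not_lt.2 hba.le)
    obtain ⟨l, hl⟩ := hex
    refine ⟨l, hl, fun l' hl' => ?_, hall l hl⟩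
    refine hl'.eq_of_values hy.signed hl ?_
    have := hall l hl
    have := hall l' hl'
    omega
  · push Not at hall
    obtain ⟨e, he, h1, h2⟩ := hall
    have hle := mul_simpleRefl_weakLED hn hy he
    obtain ⟨x, hx, hxy, h⟩ := ih _ (by
        rw [← hm]
        exact Set.ncard_lt_ncard ⟨hle, not_weakLED_mul_simpleRefl hn hy he⟩
          (finite_invSetD n y)) (hy.mul_simpleRefl hn he)
      (mul_simpleRefl_inverted hy he ha hb hne hinv (fun h => h1 h.1 h.2)
        fun h => h2 h.1 h.2) rfl
    exact ⟨x, hx, hxy.trans hle, h⟩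

lemma lt_of_no_descent_above {n : ℕ} {y : Equiv.Perm ℤ} {k : ℤ} (hk : 0 ≤ k)
    (h : ∀ l, IsDescentD n y l → l ≤ k) {p q : ℤ} (hp : k + 1 ≤ p) (hpq : p < q)
    (hq : q ≤ n) : y p < y q := by
  refine lt_of_forall_lt_succ (lo := k + 1) (hi := n) ?_ hp hpq hq
  intro i hi hin
  by_contra hc
  have h1 : y (i + 1) ≠ y i := fun hc => by simpa using y.injective hc
  have := h i ⟨Or.inr ⟨by omega, by omega⟩, by rw [abs_of_pos (by omega)]; omega⟩
  omega

lemma IsDescentD.of_not_lt {n : ℕ} {x : Equiv.Perm ℤ} {d : ℤ}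
    (hd : d = -1 ∨ (1 ≤ d ∧ d ≤ (n : ℤ) - 1)) (h : ¬ x d < x (|d| + 1)) :
    IsDescentD n x d := by
  refine ⟨hd, lt_of_le_of_ne (not_lt.1 h) fun hc => ?_⟩
  have := x.injective hc
  rcases hd with rfl | hd
  · simp at this
  · rw [abs_of_pos (by omega)] at this
    omega

/-- An element with a single descent is determined by the set `R`. -/
lemma eq_of_single_descent {n : ℕ} (hn : 2 ≤ n) {x y : Equiv.Perm ℤ} (hx : IsDPerm n x)
    (hy : IsDPerm n y) {l l' : ℤ} (hl : IsDescentD n x l) (hl' : IsDescentD n y l')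
    (hlu : ∀ e, IsDescentD n x e → e = l) (hlu' : ∀ e, IsDescentD n y e → e = l')
    (hR : ⇑x '' Set.Icc (|l| + 1) (n : ℤ) = ⇑y '' Set.Icc (|l'| + 1) (n : ℤ)) : x = y := by
  have hla := hl.abs_eq
  have hla' := hl'.abs_eq
  have hk : |l'| = |l| := by
    have h := congrArg Set.ncard hR
    rw [Set.ncard_image_of_injective _ x.injective, Set.ncard_image_of_injective _ y.injective,
      ← Finset.coe_Icc, ← Finset.coe_Icc, Set.ncard_coe_finset, Set.ncard_coe_finset,
      Int.card_Icc, Int.card_Icc] at h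
    omega
  rw [hk] at hR hla'
  have hv : IsDPerm n (y⁻¹ * x) := hy.inv.mul hx
  have hvy : ∀ i, y ((y⁻¹ * x) i) = x i := fun i => by simp
  generalize hvdef : y⁻¹ * x = v at hv hvy
  have hbig : ∀ i, |l| + 1 ≤ i → i ≤ n → |l| + 1 ≤ v i ∧ v i ≤ n := by
    intro i h1 h2
    have : x i ∈ ⇑y '' Set.Icc (|l| + 1) (n : ℤ) := hR ▸ ⟨i, ⟨h1, h2⟩, rfl⟩
    obtain ⟨j, hj, hji⟩ := this
    rw [← hvy] at hji
    rw [← y.injective hji]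
    exact hj
  have hsmall' : ∀ i, PmRange n i → i ≤ |l| → v i ≤ |l| := by
    intro i h1 h2
    by_contra hc
    have h3 := (hv.signed.pmRange_apply h1).2.2
    have : y (v i) ∈ ⇑x '' Set.Icc (|l| + 1) (n : ℤ) := hR ▸ ⟨v i, ⟨by omega, h3⟩, rfl⟩
    obtain ⟨j, hj, hji⟩ := this
    rw [hvy] at hji
    have := hj.1
    rw [x.injective hji] at this
    omega
  have hsmall : ∀ i, PmRange n i → -|l| ≤ i → i ≤ |l| → -|l| ≤ v i ∧ v i ≤ |l| := by
    intro i h1 h2 h3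
    refine ⟨?_, hsmall' i h1 h3⟩
    have := hsmall' (-i) h1.neg (by omega)
    rw [hv.signed.2] at this
    omega
  have hone : v = 1 := by
    refine hv.eq_one_of_no_descent hn fun e he => ?_
    have hea := he.abs_eq
    have hlt := he.2
    obtain ⟨he1, he2⟩ := he.pmRange hn
    by_cases h1 : |l| < |e|
    · have h2 := hbig e (by omega) (by omega)
      have h3 := hbig (|e| + 1) (by omega) (by omega)
      have h4 := lt_of_no_descent_above (y := y) (n := n) (k := |l|) (abs_nonneg l)
        (fun e he => by rw [hlu' e he]; omega) h3.1 hlt h2.2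
      rw [hvy, hvy] at h4
      have := hlu e ⟨he.1, h4⟩
      rw [this] at h1
      omega
    · by_cases h2 : |e| = |l|
      · have h3 := hbig (|e| + 1) (by omega) (by omega)
        have h4 := hsmall e he1 (by omega) (by omega)
        omega
      · have h3 := hsmall e he1 (by omega) (by omega)
        have h4 := hsmall (|e| + 1) he2 (by omega) (by omega)
        have hne : v (|e| + 1) ≠ -(v e) := by
          rw [← hv.signed.2]
          intro hc
          have := v.injective hc
          omega
        have h5 := hy.signed.lt_of_no_descent (k := |l|) (by omega) (by omega)
          (fun e he => by rw [hlu' e he]; omega) (hv.signed.pmRange_apply he2).1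
          (hv.signed.pmRange_apply he1).1 h4.1 hlt h3.2 hne
        rw [hvy, hvy] at h5
        have := hlu e ⟨he.1, h5⟩
        rw [this] at h2
        omega
  rw [hone] at hvdef
  exact (inv_mul_eq_one.1 hvdef).symm

lemma eq_of_weakLED_of_inverted {n : ℕ} (hn : 2 ≤ n) {u x : Equiv.Perm ℤ} (hu : IsDPerm n u)
    (hx : IsDPerm n x) (h : weakLED n u x)
    (hinv : ∀ e, IsDescentD n x e → u.symm (x e) < u.symm (x (|e| + 1))) : u = x := by
  have hone : u⁻¹ * x = 1 := by
    refine (hu.inv.mul hx).eq_one_of_no_descent hn fun e he => ?_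
    have hlt : u.symm (x (|e| + 1)) < u.symm (x e) := he.2
    have hea := he.abs_eq
    obtain ⟨he1, he2⟩ := he.pmRange hn
    by_cases hxe : IsDescentD n x e
    · exact lt_asymm hlt (hinv e hxe)
    · have h1 : x e < x (|e| + 1) := by
        by_contra hc
        exact hxe (.of_not_lt he.1 hc)
      rw [weakLED_iff hu.signed hx.signed] at h
      have := h _ _ (hx.signed.pmRange_apply he2) (hx.signed.pmRange_apply he1) h1 (by
        rw [← hx.signed.2]
        intro hc
        have := x.injective hc
        omega) hlt
      rw [Equiv.symm_apply_apply, Equiv.symm_apply_apply] at this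
      omega
  exact inv_mul_eq_one.1 hone

lemma isJoinIrreducibleD_of_single_descent {n : ℕ} (hn : 2 ≤ n) {x : Equiv.Perm ℤ}
    (hx : IsDPerm n x) {l : ℤ} (hl : IsDescentD n x l) (hlu : ∀ e, IsDescentD n x e → e = l) :
    IsJoinIrreducibleD n x := by
  constructor
  · rintro rfl
    have h1 := hl.2
    have h2 := hl.abs_eq
    simp only [Equiv.Perm.one_apply] at h1
    omega
  · intro u v hu hv ⟨hub, hleast⟩
    by_contra! hc
    have key : ∀ t, IsDPerm n t → t ≠ x → weakLED n t x → weakLED n t (x * simpleRefl l) := by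
      intro t ht hne hle
      refine weakLED_mul_simpleRefl hn ht hx hle hl fun hinv => hne ?_
      exact eq_of_weakLED_of_inverted hn ht hx hle fun e he => by rw [hlu e he]; exact hinv
    refine not_weakLED_mul_simpleRefl hn hx hl (hleast _ (hx.mul_simpleRefl hn hl) ?_)
    rintro t (rfl | rfl)
    · exact key t hu hc.1 (hub t (by simp))
    · exact key t hv hc.2 (hub t (by simp))

/-- The shape of an element with a single descent `l`: the middle block `{±1,…,±|l|}` has values
bounded by `x(l) > 0`, and the last block has least value `x(|l|+1)`. -/
lemma single_descent_bounds {n : ℕ} (hn : 2 ≤ n) {x : Equiv.Perm ℤ} (hx : IsDPerm n x) {l : ℤ}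
    (hl : IsDescentD n x l) (hlu : ∀ e, IsDescentD n x e → e = l) :
    0 < x l ∧ (|l| = 1 → -(x l) < x (|l| + 1)) ∧
    (∀ i, i ≠ 0 → -|l| ≤ i → i ≤ |l| → -(x l) ≤ x i ∧ x i ≤ x l) ∧
    ∀ i, |l| + 1 ≤ i → i ≤ n → x (|l| + 1) ≤ x i := by
  have hla := hl.abs_eq
  have hlt := hl.2
  have hinc : ∀ i, |l| + 1 ≤ i → i ≤ n → x (|l| + 1) ≤ x i := by
    intro i h1 h2
    rcases eq_or_lt_of_le h1 with h | h
    · rw [h]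
    · exact (lt_of_no_descent_above (abs_nonneg l)
        (fun e he => by rw [hlu e he]; omega) le_rfl h h2).le
  by_cases h1 : |l| = 1
  · have h2 : -(x l) < x (|l| + 1) := by
      by_contra hc
      have h3 : IsDescentD n x (-l) := .of_not_lt (by have := hl.1; omega) (by
        rw [abs_neg, hx.signed.2]
        exact hc)
      have := hlu _ h3
      omega
    refine ⟨by omega, fun _ => h2, fun i hi h3 h4 => ?_, hinc⟩
    have h5 : i = l ∨ i = -l := by omega
    rcases h5 with rfl | rfl
    · omega
    · rw [hx.signed.2]
      omega
  · have hll : |l| = l := by omega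
    have hmid : ∀ i, i ≠ 0 → -l < i → i < l → x i < x l := fun i h2 h3 h4 =>
      hx.signed.lt_of_no_descent (k := l) (by omega) (by omega)
        (fun e he => (hlu e he).ge) h2 (by omega) h3.le h4 le_rfl (by omega)
    have h2 := hmid 1 (by norm_num) (by omega) (by omega)
    have h3 := hmid (-1) (by norm_num) (by omega) (by omega)
    rw [hx.signed.2] at h3
    refine ⟨by omega, fun h => absurd h h1, fun i hi h4 h5 => ?_, hinc⟩
    by_cases h6 : i = l
    · rw [h6]
      omega
    · by_cases h7 : i = -l
      · rw [h7, hx.signed.2]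
        omega
      · have h8 := hmid i hi (by omega) (by omega)
        have h9 := hmid (-i) (by omega) (by omega) (by omega)
        rw [hx.signed.2] at h9
        omega

lemma mem_image_Icc_iff {n : ℕ} {x : Equiv.Perm ℤ} (hx : IsSignedPerm n x) {k c : ℤ}
    (hc : PmRange n c) : c ∈ ⇑x '' Set.Icc k (n : ℤ) ↔ k ≤ x.symm c := by
  constructor
  · rintro ⟨i, hi, rfl⟩
    rw [Equiv.symm_apply_apply]
    exact hi.1
  · intro h
    exact ⟨x.symm c, ⟨h, (hx.pmRange_symm hc).2.2⟩, x.apply_symm_apply c⟩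

lemma pmRange_of_mem_image_Icc {n : ℕ} {x : Equiv.Perm ℤ} (hx : IsSignedPerm n x) {k c : ℤ}
    (hk : 1 ≤ k) (hc : c ∈ ⇑x '' Set.Icc k (n : ℤ)) : PmRange n c := by
  obtain ⟨i, hi, rfl⟩ := hc
  have h1 := hi.1
  have h2 := hi.2
  exact hx.pmRange_apply ⟨by omega, by omega, h2⟩

/-- Values between `x(|l|+1)` and `x(l)` compare in `w` with those two as they do in `x`. -/
lemma single_descent_compare {n : ℕ} (hn : 2 ≤ n) {x w : Equiv.Perm ℤ} (hx : IsDPerm n x)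
    (hw : IsDPerm n w) (hxw : weakLED n x w) {l : ℤ} (hl : IsDescentD n x l) {c : ℤ}
    (hc : PmRange n c) :
    (c < x l → c ≠ -(x l) → l < x.symm c → w.symm (x l) < w.symm c) ∧
    (x (|l| + 1) < c → c ≠ -(x (|l| + 1)) → x.symm c < |l| + 1 →
      w.symm c < w.symm (x (|l| + 1))) := by
  obtain ⟨hp, hq, -⟩ := hl.pmRange_apply hn hx
  rw [weakLED_iff hx.signed hw.signed] at hxw
  refine ⟨fun h1 h2 h3 => hxw _ _ hp hc h1 (by omega) ?_,
    fun h1 h2 h3 => hxw _ _ hc hq h1 h2 ?_⟩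
  · rwa [Equiv.symm_apply_apply]
  · rwa [Equiv.symm_apply_apply]

lemma exists_small_of_sum_neg {n : ℕ} (hn : 2 ≤ n) {x w : Equiv.Perm ℤ} (hx : IsDPerm n x)
    (hw : IsDPerm n w) (hxw : weakLED n x w) {l : ℤ} (hl : IsDescentD n x l)
    (hlu : ∀ e, IsDescentD n x e → e = l) (hneg : x l + x (|l| + 1) < 0) :
    ∃ m, PmRange n m ∧ -(x l) < m ∧ m < x l ∧ w.symm m < w.symm (x (|l| + 1)) ∧
      -(w.symm m) < w.symm (x (|l| + 1)) := by
  obtain ⟨h0, h1, h2, -⟩ := single_descent_bounds hn hx hl hlu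
  have hla := hl.abs_eq
  have hl1 : |l| ≠ 1 := fun h => by have := h1 h; omega
  have hr : PmRange n 1 := ⟨by norm_num, by omega, by omega⟩
  have h3 := h2 1 (by norm_num) (by omega) (by omega)
  have h4 : x 1 ≠ x l := fun h => by have := x.injective h; omega
  have h5 : x 1 ≠ -(x l) := fun h => by
    rw [← hx.signed.2] at h
    have := x.injective h
    omega
  have hm := hx.signed.pmRange_apply hr
  have h6 := (single_descent_compare hn hx hw hxw hl hm).2 (by omega) (by omega)
    (by rw [Equiv.symm_apply_apply]; omega)
  have h7 := (single_descent_compare hn hx hw hxw hl hm.neg).2 (by omega) (by omega)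
    (by rw [hx.signed.symm_neg, Equiv.symm_apply_apply]; omega)
  rw [hw.signed.symm_neg] at h7
  exact ⟨x 1, hm, by omega, by omega, h6, h7⟩

lemma IsSignedPerm.symm_eq_iff {n : ℕ} {x : Equiv.Perm ℤ} (hx : IsSignedPerm n x) (c i : ℤ) :
    (x.symm c = i ↔ c = x i) ∧ (x.symm c = -i ↔ c = -(x i)) := by
  rw [Equiv.symm_apply_eq, Equiv.symm_apply_eq, hx.2]
  exact ⟨Iff.rfl, Iff.rfl⟩

lemma image_subset_pmSet_iff {n : ℕ} (hn : 2 ≤ n) {w : Equiv.Perm ℤ} (hw : IsDPerm n w) {d : ℤ}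
    (hd : IsDescentD n w d) : ⇑w '' Set.Icc 1 |d| ⊆ pmSet (nzIcc (w d) (n : ℤ)) ↔
      ∀ m, PmRange n m → -|d| ≤ w.symm m → w.symm m ≤ |d| → w d ≤ m ∨ w d ≤ -m := by
  have hda := hd.abs_eq
  constructor
  · intro h m hm h1 h2
    have hP := (hw.signed.pmRange_symm hm).1
    have key : ∀ c, 0 < w.symm c → w.symm c ≤ |d| → w d ≤ c ∨ w d ≤ -c := by
      intro c h3 h4
      rcases h ⟨w.symm c, ⟨h3, h4⟩, w.apply_symm_apply c⟩ with h5 | h5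
      · exact Or.inl h5.2.1
      · exact Or.inr h5.2.1
    rcases lt_or_gt_of_ne hP with h3 | h3
    · have := key (-m) (by rw [hw.signed.symm_neg]; omega) (by rw [hw.signed.symm_neg]; omega)
      rw [neg_neg] at this
      exact this.symm
    · exact key m h3 h2
  · rintro h _ ⟨i, ⟨h1, h2⟩, rfl⟩
    have hm : PmRange n (w i) := hw.signed.pmRange_apply ⟨by omega, by omega, by omega⟩
    have := h (w i) hm (by rw [Equiv.symm_apply_apply]; omega)
      (by rw [Equiv.symm_apply_apply]; omega)
    simp only [pmSet, nzIcc, negSet, Set.mem_union, Set.mem_ofPred_eq]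
    unfold PmRange at hm
    omega

open Classical in
lemma mem_RsetD_iff {n : ℕ} (hn : 2 ≤ n) {w : Equiv.Perm ℤ} (hw : IsDPerm n w) {d : ℤ}
    (hd : IsDescentD n w d) (c : ℤ) :
    c ∈ RsetD n w d ↔ PmRange n c ∧
      if w d + w (|d| + 1) < 0 ∧
        (∀ m, PmRange n m → -|d| ≤ w.symm m → w.symm m ≤ |d| → w d ≤ m ∨ w d ≤ -m) then
        if 0 < w d then
          c = -(w d) ∨ (((1 ≤ c ∧ c ≤ w d - 1) ∨ (1 ≤ -c ∧ -c ≤ w d - 1)) ∧ |d| + 1 ≤ w.symm c) ∨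
            ((w d + 1 ≤ c ∧ c ≤ -(w (|d| + 1)) - 1) ∧ ¬ |d| + 1 ≤ -(w.symm c)) ∨
            -(w (|d| + 1)) + 1 ≤ c
        else
          ((-(w d) ≤ c ∧ c ≤ -(w (|d| + 1)) - 1) ∧ ¬ |d| + 1 ≤ -(w.symm c)) ∨
            -(w (|d| + 1)) + 1 ≤ c
      else
        if 0 < w d + w (|d| + 1) then
          ((w (|d| + 1) ≤ c ∧ c ≤ w d - 1) ∧ |d| + 1 ≤ w.symm c) ∨ w d + 1 ≤ c
        else
          ((w (|d| + 1) ≤ c ∧ c ≤ w d - 1) ∧ |d| + 1 ≤ w.symm c) ∨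
            ((w d + 1 ≤ c ∧ c ≤ -(w (|d| + 1)) - 1) ∧ ¬ |d| + 1 ≤ -(w.symm c)) ∨
            -(w (|d| + 1)) + 1 ≤ c := by
  have hda := hd.abs_eq
  obtain ⟨h1, h2, -⟩ := hd.pmRange_apply hn hw
  by_cases hc : PmRange n c
  · have hX := mem_image_Icc_iff hw.signed (k := |d| + 1) hc
    have hX' := mem_image_Icc_iff hw.signed (k := |d| + 1) hc.neg
    rw [hw.signed.symm_neg] at hX'
    simp only [RsetD, image_subset_pmSet_iff hn hw hd, hc, true_and]
    unfold PmRange at hc h1 h2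
    split_ifs <;>
    simp only [pmSet, nzIcc, negSet, Set.mem_union, Set.mem_inter_iff, Set.mem_sdiff,
      Set.mem_singleton_iff, Set.mem_ofPred_eq, hX, hX'] <;> omega
  · simp only [hc, false_and, iff_false]
    have hX : c ∉ ⇑w '' Set.Icc (|d| + 1) (n : ℤ) := fun h =>
      hc (pmRange_of_mem_image_Icc hw.signed (by omega) h)
    simp only [RsetD]
    unfold PmRange at hc h1 h2
    split_ifs <;>
    simp only [pmSet, nzIcc, negSet, Set.mem_union, Set.mem_inter_iff, Set.mem_sdiff,
      Set.mem_singleton_iff, Set.mem_ofPred_eq, hX, and_false, false_or, or_false] <;> omega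

lemma arith_left {a b c d l C P D k : ℤ} (hd : D = d ∧ 1 ≤ d ∨ D = 1 ∧ d = -1)
    (hl : k = l ∧ 1 ≤ l ∨ k = 1 ∧ l = -1) (hba : b < a) (hab : a ≠ -b) (hc : c ≠ 0) (hP : P ≠ 0)
    (hpos : 0 < a) 
    (hPa : (P = d ↔ c = a) ∧ (P = -d ↔ c = -a))
    (hPb : (P = D + 1 ↔ c = b) ∧ (P = -(D + 1) ↔ c = -b))
    (hCa : (C = l ↔ c = a) ∧ (C = -l ↔ c = -a))
    (hCb : (C = k + 1 ↔ c = b) ∧ (C = -(k + 1) ↔ c = -b))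
    (hR : k + 1 ≤ C → b ≤ c) (hM : -k ≤ C → C ≤ k → -a ≤ c ∧ c ≤ a) (hR' : k + 1 ≤ -C → b ≤ -c)
    (h1 : c < a → c ≠ -a → l < C → d < P) (h2 : b < c → c ≠ -b → C < k + 1 → P < D + 1)
    (h1' : -c < a → -c ≠ -a → l < -C → d < -P)
    (h2' : b < -c → -c ≠ -b → -C < k + 1 → -P < D + 1) :
    k + 1 ≤ C ↔ if 0 < a + b then ((b ≤ c ∧ c ≤ a - 1) ∧ D + 1 ≤ P) ∨ a + 1 ≤ c
      else ((b ≤ c ∧ c ≤ a - 1) ∧ D + 1 ≤ P) ∨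
        ((a + 1 ≤ c ∧ c ≤ -b - 1) ∧ ¬ D + 1 ≤ -P) ∨ -b + 1 ≤ c := by
  by_cases ha : c = a
  · have e1 := hCa.1.2 ha
    clear hR hM hR' h1 h2 h1' h2'
    split_ifs <;> omega
  by_cases ha' : c = -a
  · have e1 := hCa.2.2 ha'
    have e2 := hPa.2.2 ha'
    clear hR hM hR' h1 h2 h1' h2' hPa hCa
    split_ifs <;> omega
  by_cases hb : c = b
  · have e1 := hCb.1.2 hb
    have e2 := hPb.1.2 hb
    clear hR hM hR' h1 h2 h1' h2' hPa hCa hPb hCb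
    split_ifs <;> omega
  by_cases hb' : c = -b
  · have e1 := hCb.2.2 hb'
    have e2 := hPb.2.2 hb'
    clear hR hM hR' h1 h2 h1' h2' hPa hCa hPb hCb
    split_ifs <;> omega
  simp only [ha, ha', hb, hb', iff_false] at hPa hPb hCa hCb
  obtain ⟨p1, p2⟩ := hPa
  obtain ⟨p3, p4⟩ := hPb
  obtain ⟨p5, p6⟩ := hCa
  obtain ⟨p7, p8⟩ := hCb
  have q1 : c < b → C < k + 1 := by clear * - hR; omega
  have q2 : b < c → c < a → k + 1 ≤ C → D + 1 ≤ P := by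
    clear h2 h1' h2' hM hR' hR
    intro e1 e2 e3
    have e4 := h1 e2 ha' (by clear * - hl e3; omega)
    clear * - e4 hd p1 p2 hP
    omega
  have q3 : b < c → c < a → C < k + 1 → P < D + 1 := fun e1 e2 e3 => h2 e1 hb' e3
  have q4 : a < c → -b < c → k + 1 ≤ C := by
    intro e1 e2
    by_contra e3
    by_cases e4 : k + 1 ≤ -C
    · have e5 := hR' e4
      clear * - e5 e2 e1 hba
      omega
    · have e5 := (hM (by clear * - e4; omega) (by clear * - e3; omega)).2
      clear * - e5 e1
      omega
  have q5 : a < c → c < -b → k + 1 ≤ C → -P < D + 1 := by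
    intro e1 e2 e3
    exact h2' (by clear * - e2; omega) (by clear * - hb; omega) (by clear * - e3 hl; omega)
  have q6 : a < c → c < -b → C < k + 1 → D + 1 ≤ -P := by
    intro e1 e2 e3
    have e4 : k + 1 ≤ -C := by
      by_contra e5
      have e6 := (hM (by clear * - e5; omega) (by clear * - e3; omega)).2
      clear * - e6 e1
      omega
    have e6 : l < -C := by clear * - hl e4; omega
    have e7 := h1' (by clear * - e1 hba hpos; omega) (by clear * - ha; omega) e6
    clear * - e7 hd p1 p2 hP
    omega
  clear h1 h2 h1' h2' hM hR' hR p1 p2 p3 p4 p5 p6 p7 p8 hd hl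
  split_ifs <;> omega

lemma arith_right {a b c d l C P D k : ℤ} (hd : D = d ∧ 1 ≤ d ∨ D = 1 ∧ d = -1)
    (hl : k = l ∧ 1 ≤ l ∨ k = 1 ∧ l = -1) (hba : b < a) (hab : a + b < 0) (hc : c ≠ 0) (hP : P ≠ 0)
    (hA : -D ≤ P → P ≤ D → a ≤ c ∨ a ≤ -c)
    (hPa : (P = d ↔ c = a) ∧ (P = -d ↔ c = -a))
    (hPb : (P = D + 1 ↔ c = b) ∧ (P = -(D + 1) ↔ c = -b))
    (hCb : (C = l ↔ c = -b) ∧ (C = -l ↔ c = b))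
    (hCa : (C = k + 1 ↔ c = -a) ∧ (C = -(k + 1) ↔ c = a))
    (hR : k + 1 ≤ C → -a ≤ c) (hM : -k ≤ C → C ≤ k → b ≤ c ∧ c ≤ -b) (hR' : k + 1 ≤ -C → -a ≤ -c)
    (h1 : c < -b → c ≠ b → l < C → -(D + 1) < P) (h2 : -a < c → c ≠ a → C < k + 1 → P < -d) :
    k + 1 ≤ C ↔ if 0 < a then
          c = -a ∨ (((1 ≤ c ∧ c ≤ a - 1) ∨ (1 ≤ -c ∧ -c ≤ a - 1)) ∧ D + 1 ≤ P) ∨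
            ((a + 1 ≤ c ∧ c ≤ -b - 1) ∧ ¬ D + 1 ≤ -P) ∨ -b + 1 ≤ c
        else ((-a ≤ c ∧ c ≤ -b - 1) ∧ ¬ D + 1 ≤ -P) ∨ -b + 1 ≤ c := by
  by_cases ha : c = a
  · have e1 := hCa.2.2 ha
    clear hR hM hR' h1 h2
    split_ifs <;> omega
  by_cases ha' : c = -a
  · have e1 := hCa.1.2 ha'
    have e2 := hPa.2.2 ha'
    clear hR hM hR' h1 h2 hPa hCa
    split_ifs <;> omega
  by_cases hb : c = b
  · have e1 := hCb.2.2 hb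
    have e2 := hPb.1.2 hb
    clear hR hM hR' h1 h2 hPa hCa hPb hCb
    split_ifs <;> omega
  by_cases hb' : c = -b
  · have e1 := hCb.1.2 hb'
    have e2 := hPb.2.2 hb'
    clear hR hM hR' h1 h2 hPa hCa hPb hCb
    split_ifs <;> omega
  simp only [ha, ha', hb, hb', iff_false] at hPa hPb hCa hCb
  obtain ⟨p1, p2⟩ := hPa
  obtain ⟨p3, p4⟩ := hPb
  obtain ⟨p5, p6⟩ := hCa
  obtain ⟨p7, p8⟩ := hCb
  have q1 : c < -a → C < k + 1 := by clear * - hR; omega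
  have q2 : c < -b → k + 1 ≤ C → -P < D + 1 := by
    intro e1 e3
    have e4 := h1 e1 hb (by clear * - hl e3; omega)
    clear * - e4
    omega
  have q3 : -a < c → C < k + 1 → D + 1 ≤ -P := by
    intro e1 e2
    have e3 := h2 e1 ha e2
    clear * - e3 hd p1 p2 hP
    omega
  have q4 : -b < c → k + 1 ≤ C := by
    intro e2
    by_contra e3
    by_cases e4 : k + 1 ≤ -C
    · have e5 := hR' e4
      clear * - e5 e2 hab hba
      omega
    · have e5 := (hM (by clear * - e4; omega) (by clear * - e3; omega)).2
      clear * - e5 e2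
      omega
  have hD : 1 ≤ D := by clear * - hd; omega
  clear h1 h2 hM hR' hR p1 p2 p3 p4 p5 p6 p7 p8 hd hl
  split_ifs <;> omega

/-- An element with a single descent, lying below `w` and inverting the pair at a descent `d` of
`w`, has `R = R_d`. -/
lemma image_eq_RsetD {n : ℕ} (hn : 2 ≤ n) {x w : Equiv.Perm ℤ} (hx : IsDPerm n x)
    (hw : IsDPerm n w) (hxw : weakLED n x w) {d l : ℤ} (hd : IsDescentD n w d)
    (hl : IsDescentD n x l) (hlu : ∀ e, IsDescentD n x e → e = l)
    (h : (x l = w d ∧ x (|l| + 1) = w (|d| + 1)) ∨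
      (x l = -(w (|d| + 1)) ∧ x (|l| + 1) = -(w d))) :
    ⇑x '' Set.Icc (|l| + 1) (n : ℤ) = RsetD n w d := by
  have hda := hd.abs_eq
  have hla := hl.abs_eq
  have hdlt := hd.2
  obtain ⟨hra, hrb, hab⟩ := hd.pmRange_apply hn hw
  obtain ⟨hpos, hk1, hmid, hlast⟩ := single_descent_bounds hn hx hl hlu
  have hsmall := exists_small_of_sum_neg hn hx hw hxw hl hlu
  have facts : ∀ c, PmRange n c →
      (|l| + 1 ≤ x.symm c → x (|l| + 1) ≤ c) ∧
      (-|l| ≤ x.symm c → x.symm c ≤ |l| → -(x l) ≤ c ∧ c ≤ x l) := by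
    intro c hc
    have hC := hx.signed.pmRange_symm hc
    refine ⟨fun h => ?_, fun h1 h2 => ?_⟩
    · simpa using hlast (x.symm c) h hC.2.2
    · simpa using hmid (x.symm c) hC.1 h1 h2
  ext c
  rw [mem_RsetD_iff hn hw hd]
  by_cases hc : PmRange n c
  swap
  · simp only [hc, false_and, iff_false]
    exact fun h => hc (pmRange_of_mem_image_Icc hx.signed (by omega) h)
  rw [mem_image_Icc_iff hx.signed hc]
  simp only [hc, true_and]
  have hcmp := fun {c : ℤ} (hc : PmRange n c) =>
    single_descent_compare hn hx hw hxw hl hc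
  have hP0 := (hw.signed.pmRange_symm hc).1
  have hc0 := hc.1
  have hPd := hw.signed.symm_eq_iff c d
  have hPd' := hw.signed.symm_eq_iff c (|d| + 1)
  have hCl := hx.signed.symm_eq_iff c l
  have hCl' := hx.signed.symm_eq_iff c (|l| + 1)
  have hf := facts c hc
  have hf' := facts (-c) hc.neg
  have hc1 := hcmp hc
  have hc2 := hcmp hc.neg
  rw [hx.signed.symm_neg] at hf' hc2
  rw [hw.signed.symm_neg] at hc2
  rcases h with ⟨hp, hq⟩ | ⟨hp, hq⟩
  · simp only [hp, hq, Equiv.symm_apply_apply] at hsmall hf hf' hc1 hc2 hCl hCl' hk1 hpos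
    have hA : ¬ (w d + w (|d| + 1) < 0 ∧
        ∀ m, PmRange n m → -|d| ≤ w.symm m → w.symm m ≤ |d| → w d ≤ m ∨ w d ≤ -m) := by
      rintro ⟨h1, h2⟩
      obtain ⟨m, hm, h3, h4, h5, h6⟩ := hsmall h1
      have h7 : -|d| ≤ w.symm m := by clear * - h6; omega
      have h8 : w.symm m ≤ |d| := by clear * - h5; omega
      have h9 := h2 m hm h7 h8
      clear * - h9 h3 h4
      omega
    rw [if_neg hA]
    exact arith_left (hda.imp_left fun h => ⟨h.1, h.2.1⟩)
      (hla.imp_left fun h => ⟨h.1, h.2.1⟩) hdlt hab hc0 hP0 hpos hPd hPd' hCl hCl' hf.1 hf.2 hf'.1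
      hc1.1 hc1.2
      hc2.1 hc2.2
  · have hwd : ∀ i, w.symm (-(w i)) = -i := fun i => by
      rw [hw.signed.symm_neg, Equiv.symm_apply_apply]
    simp only [hp, hq, hwd, neg_neg] at hsmall hf hf' hc1 hc2 hCl hCl' hk1 hpos
    have hneg : w d + w (|d| + 1) < 0 := by
      by_contra hcon
      obtain ⟨m, hm, h3, h4, h5, h6⟩ := hsmall (by clear * - hcon hab; omega)
      have h7 := (hw.signed.pmRange_symm hm).1
      have h8 := hw.signed.symm_eq_iff m d
      clear * - h3 h4 h5 h6 h7 h8 hda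
      omega
    have hA : ∀ m, PmRange n m → -|d| ≤ w.symm m → w.symm m ≤ |d| → w d ≤ m ∨ w d ≤ -m := by
      intro m hm h1 h2
      have hm1 := (hcmp hm).2
      have hm2 := (hcmp hm.neg).2
      have hm3 := hw.signed.symm_eq_iff m d
      rw [hx.signed.symm_neg, hw.signed.symm_neg] at hm2
      simp only [hq, hwd, neg_neg] at hm1 hm2
      have hm5 := (hw.signed.pmRange_symm hm).1
      by_contra hcon
      push Not at hcon
      obtain ⟨h3, h4⟩ := hcon
      have h5 := hm1 (by clear * - h4; omega) (by clear * - h3; omega)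
      have h6 := hm2 (by clear * - h3; omega) (by clear * - h4; omega)
      clear * - h1 h2 h3 h4 h5 h6 hm3 hm5 hda hla
      omega
    rw [if_pos ⟨hneg, hA⟩]
    exact arith_right (hda.imp_left fun h => ⟨h.1, h.2.1⟩)
      (hla.imp_left fun h => ⟨h.1, h.2.1⟩) hdlt hneg hc0 hP0 (hA c hc) hPd hPd' hCl hCl'
      hf.1 hf.2 hf'.1
      hc1.1 hc1.2

/-- If `x ≤ w` inverts `(a, b)`, and neither `(a, p)` nor `(q, b)` is inverted in `w`, then every
element above `x` inverts `(p, q)`. -/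
lemma inverted_of_inverted_between {n : ℕ} {x w z : Equiv.Perm ℤ} (hx : IsDPerm n x)
    (hw : IsDPerm n w) (hz : IsDPerm n z) (hxw : weakLED n x w) (hxz : weakLED n x z)
    {p q a b : ℤ} (hp : PmRange n p) (hq : PmRange n q) (ha : PmRange n a) (hb : PmRange n b)
    (hab : x.symm a < x.symm b) (hqp : q < p) (hpq : p ≠ -q)
    (hpa : p ≤ a) (hpa' : w.symm p ≤ w.symm a) (hap : a ≠ -p)
    (hbq : b ≤ q) (hbq' : w.symm b ≤ w.symm q) (hqb : b ≠ -q) : z.symm p < z.symm q := by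
  rw [weakLED_iff hx.signed hw.signed] at hxw
  rw [weakLED_iff hx.signed hz.signed] at hxz
  have h1 : x.symm p ≤ x.symm a := by
    rcases hpa.eq_or_lt with rfl | h
    · exact le_rfl
    · by_contra hcon
      exact absurd (hxw a p ha hp h hap (not_le.1 hcon)) (not_lt.2 hpa')
  have h2 : x.symm b ≤ x.symm q := by
    rcases hbq.eq_or_lt with rfl | h
    · exact le_rfl
    · by_contra hcon
      exact absurd (hxw q b hq hb h (by omega) (not_le.1 hcon)) (not_lt.2 hbq')
  exact hxz p q hp hq hqp hpq (by omega)

/-- A walk through the positions `…, -3, -2, σ, 2, 3, …`, where `σ = ±1`. -/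
def signedWalk (σ k : ℤ) : ℤ := if 2 ≤ k then k else if k = 1 then σ else k - 2

lemma signedWalk_spec {σ : ℤ} (k : ℤ) : (2 ≤ k ∧ signedWalk σ k = k) ∨
    (k = 1 ∧ signedWalk σ k = σ) ∨ (k ≤ 0 ∧ signedWalk σ k = k - 2) := by
  unfold signedWalk
  split_ifs <;> omega

/-- Every descent pair of `w` is inverted by some element below both `w` and `z`. -/
def DescentsInverted (n : ℕ) (w z : Equiv.Perm ℤ) : Prop :=
  ∀ d, IsDescentD n w d → ∃ x, IsDPerm n x ∧ weakLED n x w ∧ weakLED n x z ∧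
    x.symm (w d) < x.symm (w (|d| + 1))

lemma DescentsInverted.exists_signedWalk {n : ℕ} {w z : Equiv.Perm ℤ} (h : DescentsInverted n w z)
    (hw : IsDPerm n w) {σ : ℤ} (hσ : σ = 1 ∨ σ = -1) {k : ℤ} (hlo : -n ≤ signedWalk σ k)
    (hhi : signedWalk σ (k + 1) ≤ n)
    (hlt : w (signedWalk σ (k + 1)) < w (signedWalk σ k)) :
    ∃ x, IsDPerm n x ∧ weakLED n x w ∧ weakLED n x z ∧
      x.symm (w (signedWalk σ k)) < x.symm (w (signedWalk σ (k + 1))) := by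
  have hk := signedWalk_spec (σ := σ) k
  have hk' := signedWalk_spec (σ := σ) (k + 1)
  have key : ∃ d, (d = -1 ∨ (1 ≤ d ∧ d ≤ (n : ℤ) - 1)) ∧
      ((signedWalk σ k = d ∧ signedWalk σ (k + 1) = |d| + 1) ∨
        (signedWalk σ k = -(|d| + 1) ∧ signedWalk σ (k + 1) = -d)) := by
    rcases hk with ⟨h1, h2⟩ | ⟨h1, h2⟩ | ⟨h1, h2⟩
    · have := abs_of_pos (a := k) (by omega)
      exact ⟨k, by omega, by omega⟩
    · have : |σ| = 1 := by rcases hσ with rfl | rfl <;> rfl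
      exact ⟨σ, by omega, by omega⟩
    · by_cases h3 : k = 0
      · have : |-σ| = 1 := by rcases hσ with rfl | rfl <;> rfl
        exact ⟨-σ, by omega, by omega⟩
      · have := abs_of_pos (a := 1 - k) (by omega)
        exact ⟨1 - k, by omega, by omega⟩
  obtain ⟨d, hd, ⟨h1, h2⟩ | ⟨h1, h2⟩⟩ := key
  · rw [h1, h2] at hlt ⊢
    exact h d ⟨hd, hlt⟩
  · rw [h1, h2, hw.signed.2, hw.signed.2] at hlt ⊢
    obtain ⟨x, hx, hxw, hxz, hlt'⟩ := h d ⟨hd, by omega⟩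
    refine ⟨x, hx, hxw, hxz, ?_⟩
    rw [hx.signed.symm_neg, hx.signed.symm_neg]
    omega

lemma exists_last_of_not {P : ℤ → Prop} {k₁ k₂ : ℤ} (hk : k₁ ≤ k₂) (h₁ : P k₁) (h₂ : ¬ P k₂) :
    ∃ k, k₁ ≤ k ∧ k < k₂ ∧ P k ∧ ¬ P (k + 1) := by
  by_contra hcon
  push Not at hcon
  have key : ∀ k, k₁ ≤ k → k ≤ k₂ → P k := by
    intro k hk
    induction k, hk using Int.leInduction with
    | base => exact fun _ => h₁
    | succ k hk ih => exact fun h => hcon k hk (by omega) (ih (by omega))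
  exact h₂ (key k₂ hk le_rfl)

lemma inverted_of_signedWalk {n : ℕ} {w z : Equiv.Perm ℤ} (hw : IsDPerm n w) (hz : IsDPerm n z)
    (h : DescentsInverted n w z) {i j : ℤ} (hi : PmRange n i) (hj : PmRange n j)
    (hlt : w j < w i) (hij : i ≠ -j) {σ : ℤ} (hσ : σ = 1 ∨ σ = -1) {k₁ k₂ : ℤ} (hk : k₁ ≤ k₂)
    (hi₁ : i ≤ signedWalk σ k₁) (hj₂ : signedWalk σ k₂ ≤ j) (h₁ : w i ≤ w (signedWalk σ k₁))
    (h₂ : w (signedWalk σ k₂) ≤ w j)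
    (hmid : ∀ k, k₁ ≤ k → k ≤ k₂ → (w i ≤ w (signedWalk σ k) ∧ signedWalk σ k ≠ -i) ∨
      (w (signedWalk σ k) ≤ w j ∧ signedWalk σ k ≠ -j)) :
    z.symm (w i) < z.symm (w j) := by
  obtain ⟨k, hk1, hk2, hk3, hk4⟩ := exists_last_of_not (P := fun k => w i ≤ w (signedWalk σ k)) hk
    h₁ (by omega)
  have hlo : i ≤ signedWalk σ k := by
    have e1 := signedWalk_spec (σ := σ) k
    have e2 := signedWalk_spec (σ := σ) k₁
    omega
  have hhi : signedWalk σ (k + 1) ≤ j := by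
    have e1 := signedWalk_spec (σ := σ) (k + 1)
    have e2 := signedWalk_spec (σ := σ) k₂
    omega
  have hstep : signedWalk σ k < signedWalk σ (k + 1) := by
    have e1 := signedWalk_spec (σ := σ) k
    have e2 := signedWalk_spec (σ := σ) (k + 1)
    omega
  have hr : PmRange n (signedWalk σ k) := by
    have e1 := signedWalk_spec (σ := σ) k
    unfold PmRange at hi hj ⊢
    omega
  have hr' : PmRange n (signedWalk σ (k + 1)) := by
    have e1 := signedWalk_spec (σ := σ) (k + 1)
    unfold PmRange at hi hj ⊢
    omega
  obtain ⟨x, hx, hxw, hxz, hlt'⟩ := h.exists_signedWalk hw hσ (hr.2.1) hr'.2.2 (by omega)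
  have hm := hmid k hk1 (by omega)
  have hm' := hmid (k + 1) (by omega) (by omega)
  have hne : ∀ r s, w r = -(w s) → r = -s := fun r s e => by
    rw [← hw.signed.2] at e
    exact w.injective e
  refine inverted_of_inverted_between hx hw hz hxw hxz (hw.signed.pmRange_apply hi)
    (hw.signed.pmRange_apply hj) (hw.signed.pmRange_apply hr) (hw.signed.pmRange_apply hr') hlt'
    hlt (fun e => hij (hne _ _ e)) hk3 ?_ ?_ ?_ ?_ ?_
  · simpa using hlo
  · intro e
    have := hne _ _ e
    omega
  · omega
  · simpa using hhi
  · intro e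
    have := hne _ _ e
    omega

lemma inverted_of_between {n : ℕ} {w z : Equiv.Perm ℤ} (hw : IsDPerm n w)
    (hz : IsDPerm n z) (h : DescentsInverted n w z) {i j : ℤ} (hi : PmRange n i)
    (hj : PmRange n j) (hij : i < j) (hlt : w j < w i) (hpos : 0 < i + j)
    (hmid : ∀ r, r ≠ 0 → i < r → r < j → r ≠ -i → r ≠ -j → w i < w r ∨ w r < w j) :
    z.symm (w i) < z.symm (w j) := by
  have hi0 := hi.1
  have hmid' : ∀ r, r ≠ 0 → i ≤ r → r ≤ j → r ≠ -i → r ≠ -j → w i ≤ w r ∨ w r ≤ w j := by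
    intro r h0 h1 h2 h3 h4
    rcases h1.eq_or_lt with rfl | h1
    · exact Or.inl le_rfl
    rcases h2.eq_or_lt with rfl | h2
    · exact Or.inr le_rfl
    exact (hmid r h0 h1 h2 h3 h4).imp le_of_lt le_of_lt
  have walk : ∀ σ, (σ = 1 ∨ σ = -1) → ∀ k₁ k₂, k₁ ≤ k₂ → i ≤ signedWalk σ k₁ →
      signedWalk σ k₂ ≤ j → w i ≤ w (signedWalk σ k₁) → w (signedWalk σ k₂) ≤ w j →
      (∀ k, k₁ ≤ k → k ≤ k₂ → signedWalk σ k = -i → w (signedWalk σ k) ≤ w j) →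
      z.symm (w i) < z.symm (w j) := by
    intro σ hσ k₁ k₂ hk hi₁ hj₂ h₁ h₂ hex
    refine inverted_of_signedWalk hw hz h hi hj hlt (by omega) hσ hk hi₁ hj₂ h₁ h₂ ?_
    intro k hk1 hk2
    have e0 := signedWalk_spec (σ := σ) k
    have e1 := signedWalk_spec (σ := σ) k₁
    have e2 := signedWalk_spec (σ := σ) k₂
    have hlo : i ≤ signedWalk σ k := by clear * - e0 e1 e2 hσ hk1 hk2 hi₁; omega
    have hhi : signedWalk σ k ≤ j := by clear * - e0 e1 e2 hσ hk1 hk2 hj₂; omega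
    have h0 : signedWalk σ k ≠ 0 := by clear * - e0 hσ; omega
    have hj' : signedWalk σ k ≠ -j := by clear * - hlo hpos; omega
    by_cases he : signedWalk σ k = -i
    · exact Or.inr ⟨hex k hk1 hk2 he, hj'⟩
    · rcases hmid' _ h0 hlo hhi he hj' with h3 | h3
      · exact Or.inl ⟨h3, he⟩
      · exact Or.inr ⟨h3, hj'⟩
  have spec : ∀ σ k, _ := fun σ k => signedWalk_spec (σ := σ) k
  rcases lt_trichotomy i (-1) with him | rfl | hip
  · have s1 : ∀ σ, signedWalk σ (i + 2) = i := fun σ => by have := spec σ (i + 2); omega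
    by_cases hp : -(w i) < w j
    · have s2 : signedWalk 1 j = j := by have := spec 1 j; omega
      refine walk 1 (Or.inl rfl) (i + 2) j (by omega) (by rw [s1]) (by rw [s2]) (by rw [s1])
        (by rw [s2]) ?_
      intro k hk1 hk2 he
      rw [he, hw.signed.2]
      exact hp.le
    have hpj : w (-i) ≠ w j := fun e => by have := w.injective e; omega
    rw [hw.signed.2] at hpj
    by_cases hr : ∃ r, r ≠ 0 ∧ i < r ∧ r < -i ∧ w r ≤ w j
    · obtain ⟨r, h0, h1, h2, h3⟩ := hr
      obtain ⟨σ, k, hσ, hk, hs⟩ : ∃ σ k, (σ = 1 ∨ σ = -1) ∧ i + 2 ≤ k ∧ signedWalk σ k = r := by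
        rcases lt_trichotomy r (-1) with h4 | rfl | h4
        · exact ⟨1, r + 2, Or.inl rfl, by omega, by have := spec 1 (r + 2); omega⟩
        · exact ⟨-1, 1, Or.inr rfl, by omega, by have := spec (-1) 1; omega⟩
        · exact ⟨1, r, Or.inl rfl, by omega, by have := spec 1 r; omega⟩
      refine walk σ hσ (i + 2) k hk (by rw [s1]) (by omega) (by rw [s1]) (by rwa [hs]) ?_
      intro k' hk1 hk2 he
      have e1 := spec σ k
      have e2 := spec σ k'
      omega
    push Not at hr
    have hin : ∀ r, r ≠ 0 → i < r → r < -i → w i < w r := by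
      intro r h0 h1 h2
      have := hmid r h0 h1 (by omega) (by omega) (by omega)
      have := hr r h0 h1 h2
      omega
    by_cases hb : w j < w (-i + 1)
    · have hne : -i + 1 ≠ j := fun e => by rw [e] at hb; omega
      have h1 := hmid (-i + 1) (by omega) (by omega) (by omega) (by omega) (by omega)
      have s2 : signedWalk 1 j = j := by have := spec 1 j; omega
      have s3 : signedWalk 1 (-i + 1) = -i + 1 := by have := spec 1 (-i + 1); omega
      refine walk 1 (Or.inl rfl) (-i + 1) j (by omega) (by omega) (by rw [s2]) (by rw [s3]; omega)
        (by rw [s2]) ?_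
      intro k hk1 hk2 he
      have := spec 1 k
      omega
    · have habs : |-i| = -i := abs_of_pos (by omega)
      have hjn := hj.2.2
      obtain ⟨x, hx, hxw, hxz, hinv⟩ := h (-i) ⟨Or.inr (by omega), by
        rw [habs, hw.signed.2]; omega⟩
      rw [habs] at hinv
      have r1 : PmRange n 1 := ⟨by omega, by omega, by omega⟩
      have r2 : PmRange n (-i + 1) := ⟨by omega, by omega, by omega⟩
      have c1 := hin 1 (by omega) (by omega) (by omega)
      have c2 := hin (-1) (by omega) (by omega) (by omega)
      rw [hw.signed.2] at c2
      have pi := hw.signed.pmRange_apply hi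
      have pj := hw.signed.pmRange_apply hj
      have p1 := hw.signed.pmRange_apply r1
      have pb := hw.signed.pmRange_apply r2
      have hxw' := (weakLED_iff hx.signed hw.signed).1 hxw
      have hxz' := (weakLED_iff hx.signed hz.signed).1 hxz
      have hni : w.symm (-(w i)) = -i := by rw [hw.signed.symm_neg, Equiv.symm_apply_apply]
      have f1 := hxw' (-(w i)) (w 1) pi.neg p1 (by omega) (by omega)
      have f2 := hxw' (w 1) (w i) p1 pi (by omega) (by omega)
      have f3 := hxw' (w j) (w (-i + 1)) pj pb
      rw [hni, Equiv.symm_apply_apply] at f1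
      simp only [Equiv.symm_apply_apply] at f2 f3
      rw [hw.signed.2] at hinv
      have hbj : w j ≠ -(w (-i + 1)) := by
        rw [← hw.signed.2]
        intro e
        have := w.injective e
        omega
      have f4 : x.symm (w (-i + 1)) ≤ x.symm (w j) := by
        by_cases e : w (-i + 1) = w j
        · rw [e]
        · by_contra hcon
          have := f3 (by omega) hbj (by omega)
          omega
      have hij' : w i ≠ -(w j) := by
        rw [← hw.signed.2]
        intro e
        have := w.injective e
        omega
      refine hxz' _ _ pi pj hlt hij' ?_
      have f5 : ¬ x.symm (-(w i)) < x.symm (w 1) := fun e => by have := f1 e; omega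
      have f6 : ¬ x.symm (w 1) < x.symm (w i) := fun e => by have := f2 e; omega
      omega
  · have s1 : signedWalk (-1) 1 = -1 := by have := spec (-1) 1; omega
    have s2 : signedWalk (-1) j = j := by have := spec (-1) j; omega
    refine walk (-1) (Or.inr rfl) 1 j (by omega) (by rw [s1]) (by rw [s2]) (by rw [s1])
      (by rw [s2]) ?_
    intro k hk1 hk2 he
    have := spec (-1) k
    omega
  · have s1 : ∀ k, 1 ≤ k → signedWalk 1 k = k := fun k hk => by have := spec 1 k; omega
    refine walk 1 (Or.inl rfl) i j (by omega) (by rw [s1 i (by omega)])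
      (by rw [s1 j (by omega)]) (by rw [s1 i (by omega)]) (by rw [s1 j (by omega)]) ?_
    intro k hk1 hk2 he
    have := s1 k (by omega)
    omega

lemma DescentsInverted.weakLED {n : ℕ} {w z : Equiv.Perm ℤ} (h : DescentsInverted n w z)
    (hw : IsDPerm n w) (hz : IsDPerm n z) : weakLED n w z := by
  have key : ∀ N : ℕ, ∀ i j, PmRange n i → PmRange n j → i < j → j - i < N → w j < w i → i ≠ -j →
      z.symm (w i) < z.symm (w j) := by
    intro N
    induction N with
    | zero => intro i j _ _ h1 h2; omega
    | succ N ih =>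
      have pos : ∀ i j, PmRange n i → PmRange n j → i < j → j - i < (N + 1 : ℕ) → w j < w i →
          0 < i + j → z.symm (w i) < z.symm (w j) := by
        intro i j hi hj hij hN hlt hpos
        by_contra hcon
        refine hcon (inverted_of_between hw hz h hi hj hij hlt hpos ?_)
        intro r h0 h1 h2 h3 h4
        by_contra hr
        push Not at hr
        have hrn : PmRange n r := ⟨h0, by have := hi.2.1; omega, by have := hj.2.2; omega⟩
        have e1 : w r ≠ w i := fun e => by have := w.injective e; omega
        have e2 : w r ≠ w j := fun e => by have := w.injective e; omega
        have f1 := ih i r hi hrn h1 (by omega) (by omega) (by omega)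
        have f2 := ih r j hrn hj h2 (by omega) (by omega) (by omega)
        omega
      intro i j hi hj hij hN hlt hne
      rcases lt_or_gt_of_ne (show i + j ≠ 0 by omega) with hs | hs
      · have := pos (-j) (-i) hj.neg hi.neg (by omega) (by omega)
          (by rw [hw.signed.2, hw.signed.2]; omega) (by omega)
        rw [hw.signed.2, hw.signed.2, hz.signed.symm_neg, hz.signed.symm_neg] at this
        omega
      · exact pos i j hi hj hij hN hlt hs
  rw [weakLED_iff hw.signed hz.signed]
  intro p q hp hq hqp hpq hinv
  have := key (w.symm q - w.symm p + 1).toNat (w.symm p) (w.symm q) (hw.signed.pmRange_symm hp)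
    (hw.signed.pmRange_symm hq) hinv (by omega) (by simpa using hqp) (by
      rw [← hw.signed.symm_neg]
      exact fun e => hpq (w.symm.injective e))
  simpa using this

lemma IsJoinIrrWithR.eq {n : ℕ} (hn : 2 ≤ n) {u v : Equiv.Perm ℤ} {R : Set ℤ}
    (hu : IsJoinIrrWithR n u R) (hv : IsJoinIrrWithR n v R) : u = v := by
  obtain ⟨hu, -, l, hl, hlu, rfl⟩ := hu
  obtain ⟨hv, -, l', hl', hlu', hR⟩ := hv
  exact eq_of_single_descent hn hu hv hl hl' hlu hlu' hR.symm

/-- Below every `y ≤ w` inverting the pair at a descent `d` of `w` lies a join-irreducible element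
with `R = R_d` inverting that pair. -/
lemma exists_isJoinIrrWithR {n : ℕ} (hn : 2 ≤ n) {w y : Equiv.Perm ℤ} (hw : IsDPerm n w)
    (hy : IsDPerm n y) (hyw : weakLED n y w) {d : ℤ} (hd : IsDescentD n w d)
    (hinv : y.symm (w d) < y.symm (w (|d| + 1))) :
    ∃ x, IsJoinIrrWithR n x (RsetD n w d) ∧ weakLED n x y ∧
      x.symm (w d) < x.symm (w (|d| + 1)) := by
  obtain ⟨ha, hb, hab⟩ := hd.pmRange_apply hn hw
  obtain ⟨x, hx, hxy, hxinv, l, hl, hlu, hval⟩ := exists_single_descent hn ha hb hd.2 hab hy hinv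
  exact ⟨x, ⟨hx, isJoinIrreducibleD_of_single_descent hn hx hl hlu, l, hl, hlu,
    image_eq_RsetD hn hx hw (hxy.trans hyw) hd hl hlu hval⟩, hxy, hxinv⟩

lemma IsDescentD.symm_apply_lt {n : ℕ} {w : Equiv.Perm ℤ} {d : ℤ} (hd : IsDescentD n w d) :
    w.symm (w d) < w.symm (w (|d| + 1)) := by
  have := hd.abs_eq
  rw [Equiv.symm_apply_apply, Equiv.symm_apply_apply]
  omega

lemma finite_setOf_isDescentD (n : ℕ) (w : Equiv.Perm ℤ) : {d | IsDescentD n w d}.Finite := by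
  refine (Set.finite_Icc (-1 : ℤ) n).subset fun d hd => ?_
  have h := hd.1
  exact ⟨by omega, by omega⟩

/-- Let `w ∈ W(D_n)`.  For each descent `d` of `w` there is a unique join-irreducible element
`w_d ∈ W(D_n)` with `R(w_d) = R_d`, and the set `{w_d : d a descent of w}` is the canonical
join representation of `w` in the right weak order on `W(D_n)`. -/
theorem canonical_join_rep_D (n : ℕ) (hn : 4 ≤ n) (w : Equiv.Perm ℤ) (hw : IsDPerm n w) :
    (∀ d : ℤ, IsDescentD n w d → ∃! u : Equiv.Perm ℤ, IsJoinIrrWithR n u (RsetD n w d)) ∧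
    ∀ f : ℤ → Equiv.Perm ℤ, (∀ d : ℤ, IsDescentD n w d → IsJoinIrrWithR n (f d) (RsetD n w d)) →
      IsCanonicalJoinRepD n w {x | ∃ d : ℤ, IsDescentD n w d ∧ x = f d} := by
  have hn2 : 2 ≤ n := by omega
  have hex : ∀ d, IsDescentD n w d → ∃ x, IsJoinIrrWithR n x (RsetD n w d) ∧ weakLED n x w ∧
      x.symm (w d) < x.symm (w (|d| + 1)) := fun d hd =>
    exists_isJoinIrrWithR hn2 hw hw (weakLED.refl n w) hd hd.symm_apply_lt
  refine ⟨fun d hd => ?_, fun f hf => ?_⟩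
  · obtain ⟨x, hx, -, -⟩ := hex d hd
    exact ⟨x, hx, fun y hy => IsJoinIrrWithR.eq hn2 hy hx⟩
  have hle : ∀ d, IsDescentD n w d →
      weakLED n (f d) w ∧ (f d).symm (w d) < (f d).symm (w (|d| + 1)) := by
    intro d hd
    obtain ⟨x, hx, hxw, hinv⟩ := hex d hd
    rw [IsJoinIrrWithR.eq hn2 (hf d hd) hx]
    exact ⟨hxw, hinv⟩
  have hmin : ∀ d, IsDescentD n w d → ∀ y, IsDPerm n y → weakLED n y w →
      y.symm (w d) < y.symm (w (|d| + 1)) → weakLED n (f d) y := by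
    intro d hd y hy hyw hinv
    obtain ⟨x, hx, hxy, -⟩ := exists_isJoinIrrWithR hn2 hw hy hyw hd hinv
    rwa [IsJoinIrrWithR.eq hn2 (hf d hd) hx]
  refine ⟨?_, ?_, ⟨?_, ?_⟩, ?_, ?_⟩
  · refine ((finite_setOf_isDescentD n w).image f).subset ?_
    rintro _ ⟨d, hd, rfl⟩
    exact ⟨d, hd, rfl⟩
  · rintro _ ⟨d, hd, rfl⟩
    exact (hf d hd).1
  · rintro _ ⟨d, hd, rfl⟩
    exact (hle d hd).1
  · intro z hz h
    exact DescentsInverted.weakLED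
      (fun d hd => ⟨f d, (hf d hd).1, (hle d hd).1, h _ ⟨d, hd, rfl⟩, (hle d hd).2⟩) hw hz
  · rintro U' hU' ⟨-, hlub⟩
    obtain ⟨_, ⟨d, hd, rfl⟩, hdU⟩ := Set.exists_of_ssubset hU'
    refine not_weakLED_mul_simpleRefl hn2 hw hd (hlub _ (hw.mul_simpleRefl hn2 hd) ?_)
    intro x hx
    obtain ⟨e, he, rfl⟩ := hU'.1 hx
    have hde : d ≠ e := by
      rintro rfl
      exact hdU hx
    obtain ⟨ha, hb, hab⟩ := he.pmRange_apply hn2 hw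
    refine hmin e he _ (hw.mul_simpleRefl hn2 hd) (mul_simpleRefl_weakLED hn2 hw hd) ?_
    exact mul_simpleRefl_inverted hw hd ha hb hab he.symm_apply_lt
      (fun h => hde (hd.eq_of_values hw.signed he (Or.inl h)))
      (fun h => hde (hd.eq_of_values hw.signed he (Or.inr h)))
  · rintro V - hVD ⟨hV, hlub⟩ - _ ⟨d, hd, rfl⟩
    by_contra hcon
    push Not at hcon
    refine not_weakLED_mul_simpleRefl hn2 hw hd (hlub _ (hw.mul_simpleRefl hn2 hd) ?_)
    intro v hv
    exact weakLED_mul_simpleRefl hn2 (hVD v hv) hw (hV v hv) hd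
      fun h => hcon v hv (hmin d hd v (hVD v hv) (hV v hv) h)
end

section
/- For a join-irreducible element w ∈ W(D_n) of type l, set a = w(l), b = w(|l|+1), R = w({|l|+1,…,n}), r = max{k ≥ 0 : {1,…,k} ⊆ R ∪ (−R)}, and define its shape σ(w) = (a, b, r′) ∈ ℤ³, where r′ = 0 if b ≥ −1 and r′ = min(r, |b|−1) if b ≤ −2. Then: (1) a triple (a,b,r′) is the shape of some join-irreducible element of W(D_n) if and only if 2 ≤ a ≤ n and one of the following holds: (i) −1 ≤ b < a, b ≠ 0, r′ = 0; (ii) −a < b ≤ −2 and 0 ≤ r′ ≤ |b|−1; (iii) −n ≤ b < −a and 0 ≤ r′ ≤ a−2. (2) For such a triple σ = (a,b,r′), setting x = max(a,|b|) and y = min(a,|b|), the number of join-irreducible elements of W(D_n) with shape σ equals 2^{x−y−1} if b ≥ −1, and equals 2^{r′} · 3^{max(y−r′−2, 0)} · 2^{x−y−1} if b ≤ −2. -/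
/-- `w` (a join-irreducible element of `W(D_n)`, with unique descent `l`, `a = w(l)`,
`b = w(|l|+1)`, `R = w({|l|+1,…,n})` and `r = max{k ≥ 0 : {1,…,k} ⊆ R ∪ (−R)}`) has shape
`σ = (a, b, r′)`, where `r′ = 0` if `b ≥ −1` and `r′ = min(r, |b|−1)` if `b ≤ −2`. -/
def HasShapeD (n : ℕ) (w : Equiv.Perm ℤ) (σ : ℤ × ℤ × ℤ) : Prop :=
  ∃ l r : ℤ, IsDescentD n w l ∧ (∀ l', IsDescentD n w l' → l' = l) ∧
    0 ≤ r ∧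
    (∀ k : ℤ, 1 ≤ k → k ≤ r →
      (k ∈ ⇑w '' Set.Icc (|l| + 1) (n : ℤ) ∨ -k ∈ ⇑w '' Set.Icc (|l| + 1) (n : ℤ))) ∧
    ¬(r + 1 ∈ ⇑w '' Set.Icc (|l| + 1) (n : ℤ) ∨
      -(r + 1) ∈ ⇑w '' Set.Icc (|l| + 1) (n : ℤ)) ∧
    σ = (w l, w (|l| + 1),
      if -1 ≤ w (|l| + 1) then 0 else min r (|w (|l| + 1)| - 1))

/-- The condition for a triple `(a, b, r′)` to be the shape of a join-irreducible element of
`W(D_n)`: `2 ≤ a ≤ n` and (i) `−1 ≤ b < a`, `b ≠ 0`, `r′ = 0`; or (ii) `−a < b ≤ −2` and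
`0 ≤ r′ ≤ |b|−1`; or (iii) `−n ≤ b < −a` and `0 ≤ r′ ≤ a−2`. -/
def IsValidShapeD (n : ℕ) (σ : ℤ × ℤ × ℤ) : Prop :=
  2 ≤ σ.1 ∧ σ.1 ≤ (n : ℤ) ∧
    ((-1 ≤ σ.2.1 ∧ σ.2.1 < σ.1 ∧ σ.2.1 ≠ 0 ∧ σ.2.2 = 0) ∨
     (-σ.1 < σ.2.1 ∧ σ.2.1 ≤ -2 ∧ 0 ≤ σ.2.2 ∧ σ.2.2 ≤ |σ.2.1| - 1) ∨
     (-(n : ℤ) ≤ σ.2.1 ∧ σ.2.1 < -σ.1 ∧ 0 ≤ σ.2.2 ∧ σ.2.2 ≤ σ.1 - 2))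

section Basic

variable {n : ℕ} {u w : Equiv.Perm ℤ}

theorem IsDPerm.map_zero (hw : IsDPerm n w) : w 0 = 0 := hw.1 0 (by simp)

theorem IsDPerm.symm_neg (hw : IsDPerm n w) (i : ℤ) : w.symm (-i) = -w.symm i := by
  rw [Equiv.symm_apply_eq, hw.2.1, Equiv.apply_symm_apply]

theorem IsDPerm.mem_range (hw : IsDPerm n w) {i : ℤ} (hi : 1 ≤ |i| ∧ |i| ≤ (n : ℤ)) :
    1 ≤ |w i| ∧ |w i| ≤ (n : ℤ) := by
  by_contra h
  have h1 := w.injective (hw.1 _ h)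
  rw [h1] at h
  exact h hi

theorem IsDPerm.symm_mem_range (hw : IsDPerm n w) {i : ℤ} (hi : 1 ≤ |i| ∧ |i| ≤ (n : ℤ)) :
    1 ≤ |w.symm i| ∧ |w.symm i| ≤ (n : ℤ) := by
  by_contra h
  have h1 := hw.1 _ h
  rw [Equiv.apply_symm_apply] at h1
  rw [← h1] at h
  exact h hi

theorem IsDPerm.abs_inj (hw : IsDPerm n w) {i j : ℤ} (h : |w i| = |w j|) : |i| = |j| := by
  rcases abs_eq_abs.1 h with h | h
  · rw [w.injective h]
  · rw [← hw.2.1] at h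
    rw [w.injective h, abs_neg]

/-- Negating the value at `1` changes the parity of the number of negative values. -/
theorem even_card_neg_iff_not (hn : 1 ≤ n) {f g : ℤ → ℤ}
    (h : ∀ i : ℤ, 2 ≤ i → i ≤ (n : ℤ) → f i = g i) (h1 : f 1 = -g 1) (h0 : g 1 ≠ 0) :
    Even ((Finset.Icc (1 : ℤ) (n : ℤ)).filter (fun i => f i < 0)).card ↔
      ¬ Even ((Finset.Icc (1 : ℤ) (n : ℤ)).filter (fun i => g i < 0)).card := by
  have hI : Finset.Icc (1 : ℤ) (n : ℤ) = insert 1 (Finset.Icc (2 : ℤ) n) := by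
    ext k
    simp only [Finset.mem_Icc, Finset.mem_insert]
    omega
  have hc : (Finset.Icc (2 : ℤ) (n : ℤ)).filter (fun i => f i < 0) =
      (Finset.Icc (2 : ℤ) (n : ℤ)).filter (fun i => g i < 0) := by
    apply Finset.filter_congr
    intro i hi
    rw [Finset.mem_Icc] at hi
    rw [h i hi.1 hi.2]
  have hn1 : ∀ p : ℤ → Prop, [DecidablePred p] →
      (1 : ℤ) ∉ (Finset.Icc (2 : ℤ) (n : ℤ)).filter p := by
    intro p _
    simp
  rw [hI, Finset.filter_insert, Finset.filter_insert, hc, h1]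
  rcases lt_or_gt_of_ne h0 with hg | hg
  · rw [if_neg (by omega), if_pos hg, Finset.card_insert_of_notMem (hn1 _), Nat.even_add_one,
      not_not]
  · rw [if_pos (by omega), if_neg (by omega), Finset.card_insert_of_notMem (hn1 _),
      Nat.even_add_one]

/-- Two elements of `W(D_n)` whose values at `2, …, n` agree and whose values at `1` agree up
to sign are equal. -/
theorem IsDPerm.eq_of_forall (hn : 1 ≤ n) (hu : IsDPerm n u) (hw : IsDPerm n w)
    (h : ∀ i : ℤ, 2 ≤ i → i ≤ (n : ℤ) → u i = w i) (h1 : |u 1| = |w 1|) : u = w := by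
  have h11 : u 1 = w 1 := by
    rcases abs_eq_abs.1 h1 with h1 | h1
    · exact h1
    · have h0 : w 1 ≠ 0 := by
        intro h0
        rw [← hw.map_zero] at h0
        exact absurd (w.injective h0) (by norm_num)
      exact absurd hw.2.2 ((even_card_neg_iff_not hn h h1 h0).1 hu.2.2)
  have hpos : ∀ i : ℤ, 1 ≤ i → i ≤ (n : ℤ) → u i = w i := by
    intro i hi hin
    rcases eq_or_lt_of_le hi with rfl | hi
    · exact h11
    · exact h i hi hin
  ext i
  by_cases hi : 1 ≤ |i| ∧ |i| ≤ (n : ℤ)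
  · rcases abs_cases i with ⟨h2, _⟩ | ⟨h2, _⟩
    · rw [h2] at hi
      exact hpos i hi.1 hi.2
    · rw [h2] at hi
      have := hpos _ hi.1 hi.2
      rw [hu.2.1, hw.2.1] at this
      omega
  · rw [hu.1 i hi, hw.1 i hi]

end Basic

section WeakOrder

variable {n : ℕ} {u w : Equiv.Perm ℤ}

/-- An inclusion of inversion sets, read on arbitrary pairs of values. -/
theorem weakLED.symm_lt (hu : IsDPerm n u) (hw : IsDPerm n w) (h : weakLED n u w) {p q : ℤ}
    (hp : 1 ≤ |p| ∧ |p| ≤ (n : ℤ)) (hq : 1 ≤ |q| ∧ |q| ≤ (n : ℤ)) (hpq : q < p)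
    (hne : |p| ≠ |q|) (hlt : u.symm p < u.symm q) : w.symm p < w.symm q := by
  by_cases hc : |q| < p
  · exact (h (show (p, q) ∈ invSetD n u from ⟨hp, hq, hc, hlt⟩)).2.2.2
  · have h1 : |-p| < -q := by
      rw [abs_neg]
      rcases abs_cases p with ⟨h1, _⟩ | ⟨h1, _⟩ <;> rcases abs_cases q with ⟨h2, _⟩ | ⟨h2, _⟩ <;>
        omega
    have h2 := (h (show (-q, -p) ∈ invSetD n u from
      ⟨by rwa [abs_neg], by rwa [abs_neg], h1, by
        rw [hu.symm_neg, hu.symm_neg]; exact neg_lt_neg hlt⟩)).2.2.2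
    simp only [hw.symm_neg] at h2
    exact neg_lt_neg_iff.1 h2

/-- If `u⁻¹ w` has no descent, then `u = w`. -/
theorem eq_of_forall_symm_lt (hn : 2 ≤ n) (hu : IsDPerm n u) (hw : IsDPerm n w)
    (h : ∀ s : ℤ, (s = -1 ∨ (1 ≤ s ∧ s ≤ (n : ℤ) - 1)) →
      u.symm (w s) < u.symm (w (|s| + 1))) : u = w := by
  have hn' : (2 : ℤ) ≤ n := by exact_mod_cast hn
  set x : ℤ → ℤ := fun i => u.symm (w i) with hx
  have hr : ∀ i : ℤ, 1 ≤ i → i ≤ n → 1 ≤ |x i| ∧ |x i| ≤ (n : ℤ) := fun i h1 h2 =>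
    hu.symm_mem_range (hw.mem_range (by rw [abs_of_pos (by omega)]; exact ⟨h1, h2⟩))
  have hstep : ∀ i : ℤ, 1 ≤ i → i + 1 ≤ n → x i < x (i + 1) := by
    intro i h1 h2
    have := h i (Or.inr ⟨h1, by omega⟩)
    rwa [abs_of_pos (by omega)] at this
  have h1 := hstep 1 le_rfl hn'
  have h2 : -x 1 < x 2 := by
    have := h (-1) (Or.inl rfl)
    rw [hw.2.1, hu.symm_neg] at this
    simpa using this
  have habs : |x 1| < x 2 := abs_lt.2 ⟨by omega, h1⟩
  have hlow : ∀ i : ℤ, 2 ≤ i → i ≤ n → i ≤ x i := by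
    intro i hi
    induction i, hi using Int.leInduction with
    | base => intro _; have := (hr 1 le_rfl (by omega)).1; omega
    | succ k hk ih =>
      intro hkn
      have := hstep k (by omega) hkn
      have := ih (by omega)
      omega
  have hup : ∀ i : ℤ, i ≤ n → 2 ≤ i → x i ≤ i := by
    intro i hi
    induction i, hi using Int.leInductionDown with
    | base => intro _; have := (hr n (by omega) le_rfl).2; have := le_abs_self (x n); omega
    | pred k hk ih =>
      intro hkn
      have h3 := hstep (k - 1) (by omega) (by omega)
      rw [sub_add_cancel] at h3
      have := ih (by omega)
      omega
  have heq : ∀ i : ℤ, 2 ≤ i → i ≤ n → x i = i := fun i h1 h2 =>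
    le_antisymm (hup i h2 h1) (hlow i h1 h2)
  refine hu.eq_of_forall (by omega) hw (fun i hi hin => ?_) ?_
  · have := heq i hi hin
    rw [hx] at this
    exact ((Equiv.symm_apply_eq u).1 this).symm
  · have h3 : |x 1| = 1 := by
      have := (hr 1 le_rfl (by omega)).1
      have := heq 2 le_rfl hn'
      omega
    rcases eq_or_eq_neg_of_abs_eq h3 with h3 | h3
    · rw [(Equiv.symm_apply_eq u).1 h3]
    · rw [(Equiv.symm_apply_eq u).1 h3, hu.2.1, abs_neg]

/-- The simple reflection attached to the index `l`. -/
def simpleReflD (l : ℤ) : Equiv.Perm ℤ :=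
  Equiv.swap l (|l| + 1) * Equiv.swap (-l) (-(|l| + 1))

theorem simpleReflD_apply (l i : ℤ) (hl : l ≠ 0) : simpleReflD l i =
    if i = l then |l| + 1 else if i = |l| + 1 then l else if i = -l then -(|l| + 1) else
      if i = -(|l| + 1) then -l else i := by
  have h := abs_nonneg l
  rw [simpleReflD, Equiv.Perm.mul_apply, Equiv.swap_apply_def, Equiv.swap_apply_def]
  rcases abs_cases l with ⟨h1, _⟩ | ⟨h1, _⟩ <;> rw [h1] <;> split_ifs <;> omega

theorem simpleReflD_symm (l : ℤ) (hl : l ≠ 0) : (simpleReflD l).symm = simpleReflD l := by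
  ext i
  rw [Equiv.symm_apply_eq, simpleReflD_apply _ _ hl, simpleReflD_apply _ _ hl]
  rcases abs_cases l with ⟨h1, _⟩ | ⟨h1, _⟩ <;> rw [h1] <;> split_ifs <;> omega

theorem IsDPerm.mul_simpleReflD (hw : IsDPerm n w) {l : ℤ}
    (hl : l = -1 ∨ (1 ≤ l ∧ l ≤ (n : ℤ) - 1)) (hn : 2 ≤ n) : IsDPerm n (w * simpleReflD l) := by
  have hn' : (2 : ℤ) ≤ n := by exact_mod_cast hn
  have hl0 : l ≠ 0 := by omega
  refine ⟨fun i hi => ?_, fun i => ?_, ?_⟩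
  · rw [Equiv.Perm.mul_apply]
    have : simpleReflD l i = i := by
      rw [simpleReflD_apply _ _ hl0]
      rcases abs_cases l with ⟨h1, _⟩ | ⟨h1, _⟩ <;>
      rcases abs_cases i with ⟨h2, _⟩ | ⟨h2, _⟩ <;> rw [h1] <;> split_ifs <;> omega
    rw [this, hw.1 i hi]
  · rw [Equiv.Perm.mul_apply, Equiv.Perm.mul_apply, ← hw.2.1]
    congr 1
    rw [simpleReflD_apply _ _ hl0, simpleReflD_apply _ _ hl0]
    rcases abs_cases l with ⟨h1, _⟩ | ⟨h1, _⟩ <;> rw [h1] <;> split_ifs <;> omega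
  · rcases hl with rfl | hl
    · have hI : Finset.Icc (1 : ℤ) (n : ℤ) = insert 1 (insert 2 (Finset.Icc (3 : ℤ) n)) := by
        ext k
        simp only [Finset.mem_Icc, Finset.mem_insert]
        omega
      have hc : (Finset.Icc (3 : ℤ) (n : ℤ)).filter (fun i => (w * simpleReflD (-1)) i < 0) =
          (Finset.Icc (3 : ℤ) (n : ℤ)).filter (fun i => w i < 0) := by
        apply Finset.filter_congr
        intro i hi
        rw [Finset.mem_Icc] at hi
        rw [Equiv.Perm.mul_apply, simpleReflD_apply _ _ hl0]
        norm_num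
        rw [if_neg (by omega), if_neg (by omega), if_neg (by omega), if_neg (by omega)]
      have hw1 := (hw.mem_range (i := 1) (by norm_num; omega)).1
      have hw2 := (hw.mem_range (i := 2) (by norm_num; omega)).1
      have e1 : (w * simpleReflD (-1)) 1 = -w 2 := by
        rw [Equiv.Perm.mul_apply, simpleReflD_apply _ _ hl0, ← hw.2.1]; norm_num
      have e2 : (w * simpleReflD (-1)) 2 = -w 1 := by
        rw [Equiv.Perm.mul_apply, simpleReflD_apply _ _ hl0, ← hw.2.1]; norm_num
      have hev := hw.2.2
      rw [hI] at hev ⊢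
      simp only [Finset.filter_insert, hc, e1, e2] at hev ⊢
      rcases abs_cases (w 1) with ⟨h1, _⟩ | ⟨h1, _⟩ <;>
      rcases abs_cases (w 2) with ⟨h2, _⟩ | ⟨h2, _⟩
      · rw [if_neg (by omega), if_neg (by omega)] at hev
        rw [if_pos (by omega), if_pos (by omega)]
        rw [Finset.card_insert_of_notMem (by simp), Finset.card_insert_of_notMem (by simp)]
        simpa [Nat.even_add_one] using hev
      · rw [if_neg (by omega), if_pos (by omega), Finset.card_insert_of_notMem (by simp)] at hev
        rw [if_neg (by omega), if_pos (by omega), Finset.card_insert_of_notMem (by simp)]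
        exact hev
      · rw [if_pos (by omega), if_neg (by omega), Finset.card_insert_of_notMem (by simp)] at hev
        rw [if_pos (by omega), if_neg (by omega), Finset.card_insert_of_notMem (by simp)]
        exact hev
      · rw [if_pos (by omega), if_pos (by omega), Finset.card_insert_of_notMem (by simp),
          Finset.card_insert_of_notMem (by simp)] at hev
        rw [if_neg (by omega), if_neg (by omega)]
        simpa [Nat.even_add_one] using hev
    · convert hw.2.2 using 1
      have hmem : ∀ i : ℤ, 1 ≤ i → i ≤ n → 1 ≤ simpleReflD l i ∧ simpleReflD l i ≤ n := by
        intro i h1 h2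
        rw [simpleReflD_apply _ _ hl0, abs_of_pos (by omega)]
        split_ifs <;> omega
      have hinv : ∀ i, simpleReflD l (simpleReflD l i) = i := fun i => by
        have := (simpleReflD l).symm_apply_apply i
        rwa [simpleReflD_symm _ hl0] at this
      refine Finset.card_bij' (fun i _ => simpleReflD l i) (fun i _ => simpleReflD l i)
        ?_ ?_ (fun i _ => hinv i) (fun i _ => hinv i)
      · intro i hi
        simp only [Finset.mem_filter, Finset.mem_Icc] at hi ⊢
        exact ⟨hmem i hi.1.1 hi.1.2, hi.2⟩
      · intro i hi
        rw [Finset.mem_filter, Finset.mem_Icc] at hi ⊢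
        refine ⟨hmem i hi.1.1 hi.1.2, ?_⟩
        rw [Equiv.Perm.mul_apply, hinv]
        exact hi.2

/-- If `w` has the unique descent `l`, every element strictly below `w` lies below
`w s_l`. -/
theorem weakLED_mul_simpleReflD (hn : 2 ≤ n) (hu : IsDPerm n u) (hw : IsDPerm n w) {l : ℤ}
    (hl : IsDescentD n w l) (huniq : ∀ l', IsDescentD n w l' → l' = l) (hle : weakLED n u w)
    (hne : u ≠ w) : weakLED n u (w * simpleReflD l) := by
  have hn' : (2 : ℤ) ≤ n := by exact_mod_cast hn
  have hl0 : l ≠ 0 := by have := hl.1; omega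
  have hroot : u.symm (w (|l| + 1)) < u.symm (w l) := by
    by_contra hcon
    refine hne (eq_of_forall_symm_lt hn hu hw fun s hs => ?_)
    have hs1 : 1 ≤ |s| ∧ |s| + 1 ≤ n := by
      rcases hs with rfl | hs
      · norm_num; omega
      · rw [abs_of_pos (by omega)]; omega
    have habs : |(|s| + 1)| = |s| + 1 := abs_of_pos (by omega)
    have hsn : u.symm (w s) ≠ u.symm (w (|s| + 1)) := by
      intro h
      have := congrArg abs (w.injective (u.symm.injective h))
      omega
    have hwn : w s ≠ w (|s| + 1) := fun h => hsn (congrArg _ h)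
    rcases lt_or_gt_of_ne hwn with hlt | hgt
    · by_contra hc
      have h2 := hle.symm_lt hu hw (hw.mem_range (i := |s| + 1) (by omega))
        (hw.mem_range (i := s) (by omega)) hlt
        (fun h => by have := hw.abs_inj h; omega) (lt_of_le_of_ne (not_lt.1 hc) hsn.symm)
      simp only [Equiv.symm_apply_apply] at h2
      have := le_abs_self s
      omega
    · have := huniq s ⟨hs, hgt⟩
      subst this
      exact lt_of_le_of_ne (not_lt.1 hcon) hsn
  rintro ⟨p, q⟩ hpq
  refine ⟨hpq.1, hpq.2.1, hpq.2.2.1, ?_⟩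
  have hlt := (hle hpq).2.2.2
  obtain ⟨hp, hq, hqp, hult⟩ := hpq
  simp only at hp hq hqp hult hlt ⊢
  have hi := hw.symm_mem_range hp
  have hj := hw.symm_mem_range hq
  have hp' : w (w.symm p) = p := w.apply_symm_apply p
  have hq' : w (w.symm q) = q := w.apply_symm_apply q
  have e : ∀ y, (w * simpleReflD l).symm y = simpleReflD l (w.symm y) := by
    intro y
    rw [Equiv.symm_apply_eq, Equiv.Perm.mul_apply]
    have := (simpleReflD l).apply_symm_apply (w.symm y)
    rw [simpleReflD_symm _ hl0] at this
    rw [this, w.apply_symm_apply]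
  rw [e, e]
  have hsum : w.symm p + w.symm q ≠ 0 := by
    intro h
    have h1 : w.symm p = w.symm (-q) := by rw [hw.symm_neg]; omega
    have h2 := w.symm.injective h1
    have := neg_le_abs q
    omega
  have c1 : ¬ (w.symm p = l ∧ w.symm q = |l| + 1) := by
    rintro ⟨h1, h2⟩
    rw [h1] at hp'
    rw [h2] at hq'
    rw [hp', hq'] at hroot
    omega
  have c2 : ¬ (w.symm p = -(|l| + 1) ∧ w.symm q = -l) := by
    rintro ⟨h1, h2⟩
    rw [h1, hw.2.1] at hp'
    rw [h2, hw.2.1] at hq'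
    have h3 : u.symm (w (|l| + 1)) = - u.symm p := by rw [← hu.symm_neg, ← hp', neg_neg]
    have h4 : u.symm (w l) = - u.symm q := by rw [← hu.symm_neg, ← hq', neg_neg]
    omega
  generalize w.symm p = i at *
  generalize w.symm q = j at *
  have hi0 : i ≠ 0 := by rintro rfl; norm_num at hi
  have hj0 : j ≠ 0 := by rintro rfl; norm_num at hj
  rw [simpleReflD_apply _ _ hl0, simpleReflD_apply _ _ hl0]
  rcases hl.1 with rfl | hl
  · norm_num at c1 c2 ⊢
    split_ifs <;> omega
  · have hlabs : |l| = l := abs_of_pos (by omega)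
    rw [hlabs] at c1 c2 ⊢
    split_ifs <;> omega

/-- An element of `W(D_n)` with a unique descent is join-irreducible. -/
theorem isJoinIrreducibleD_of_unique_descent (hn : 2 ≤ n) (hw : IsDPerm n w) {l : ℤ}
    (hl : IsDescentD n w l) (huniq : ∀ l', IsDescentD n w l' → l' = l) :
    IsJoinIrreducibleD n w := by
  have hn' : (2 : ℤ) ≤ n := by exact_mod_cast hn
  have hl0 : l ≠ 0 := by have := hl.1; omega
  have hl1 : 1 ≤ |l| ∧ |l| + 1 ≤ n := by
    rcases hl.1 with rfl | hs
    · norm_num; omega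
    · rw [abs_of_pos (by omega)]; omega
  have habs : |(|l| + 1)| = |l| + 1 := abs_of_pos (by omega)
  constructor
  · rintro rfl
    have h1 := hl.2
    have h2 := le_abs_self l
    simp only [Equiv.Perm.one_apply] at h1
    omega
  · intro u v hu hv hlub
    by_contra hcon
    push Not at hcon
    have hz := hw.mul_simpleReflD hl.1 hn
    have hle : weakLED n w (w * simpleReflD l) := by
      refine hlub.2 _ hz ?_
      rintro y (rfl | rfl)
      · exact weakLED_mul_simpleReflD hn hu hw hl huniq (hlub.1 _ (by simp)) hcon.1
      · exact weakLED_mul_simpleReflD hn hv hw hl huniq (hlub.1 _ (by simp)) hcon.2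
    have h := hle.symm_lt hw hz (hw.mem_range (i := l) (by omega))
      (hw.mem_range (i := |l| + 1) (by omega)) hl.2
      (fun h => by have := hw.abs_inj h; omega)
      (by simp only [Equiv.symm_apply_apply]; have := le_abs_self l; omega)
    have e1 : (w * simpleReflD l).symm (w l) = |l| + 1 := by
      rw [Equiv.symm_apply_eq, Equiv.Perm.mul_apply, simpleReflD_apply _ _ hl0]
      have := le_abs_self l
      rw [if_neg (by omega), if_pos rfl]
    have e2 : (w * simpleReflD l).symm (w (|l| + 1)) = l := by
      rw [Equiv.symm_apply_eq, Equiv.Perm.mul_apply, simpleReflD_apply _ _ hl0, if_pos rfl]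
    rw [e1, e2] at h
    have := le_abs_self l
    omega

end WeakOrder
section Grassmannian

variable {n : ℕ} {w w' : Equiv.Perm ℤ} {m m' : ℤ}

/-- The values of `w` on `{m+1,…,n}` increase, those on `{1,…,m}` increase in absolute value and
are positive except possibly the first one, and there is a single descent, at `±m`. -/
structure IsGrassmannianD (n : ℕ) (w : Equiv.Perm ℤ) (m : ℤ) : Prop where
  one_le : 1 ≤ m
  lt : m + 1 ≤ n
  right : StrictMonoOn w (Set.Icc (m + 1) n)
  left : StrictMonoOn (fun i => |w i|) (Set.Icc 1 m)
  pos : ∀ i, 2 ≤ i → i ≤ m → 0 < w i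
  desc : w (m + 1) < |w m|
  one : m = 1 → -|w 1| < w 2

theorem IsDPerm.abs_pos (hw : IsDPerm n w) {i : ℤ} (hi : i ≠ 0) : 0 < |w i| := by
  rw [_root_.abs_pos]
  intro h
  rw [← hw.map_zero] at h
  exact hi (w.injective h)

theorem strictMonoOn_Icc_of_lt {f : ℤ → ℤ} {a b : ℤ}
    (h : ∀ i, a ≤ i → i + 1 ≤ b → f i < f (i + 1)) : StrictMonoOn f (Set.Icc a b) :=
  strictMonoOn_of_lt_add_one Set.ordConnected_Icc fun i _ hi hi1 => h i hi.1 hi1.2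

theorem isGrassmannianD_of_unique_descent (hn : 2 ≤ n) (hw : IsDPerm n w) {l : ℤ}
    (hl : IsDescentD n w l) (huniq : ∀ l', IsDescentD n w l' → l' = l) :
    IsGrassmannianD n w |l| ∧ w l = |w (|l|)| := by
  have hn' : (2 : ℤ) ≤ n := by exact_mod_cast hn
  have hl1 : 1 ≤ |l| ∧ |l| + 1 ≤ n := by
    rcases hl.1 with rfl | hs
    · norm_num; omega
    · rw [abs_of_pos (by omega)]; omega
  have hstep : ∀ i : ℤ, 1 ≤ i → i + 1 ≤ n → i ≠ l → w i < w (i + 1) := by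
    intro i h1 h2 hne
    by_contra hcon
    refine hne (huniq i ⟨Or.inr ⟨h1, by omega⟩, ?_⟩)
    rw [abs_of_pos (by omega)]
    refine lt_of_le_of_ne (not_lt.1 hcon) fun h => ?_
    have := w.injective h
    omega
  have hneg : l ≠ -1 → -w 1 < w 2 := by
    intro hne
    by_contra hcon
    refine hne (huniq (-1) ⟨Or.inl rfl, ?_⟩).symm
    norm_num
    rw [hw.2.1]
    refine lt_of_le_of_ne (not_lt.1 hcon) fun h => ?_
    rw [← hw.2.1] at h
    have := w.injective h
    omega
  have hpos : ∀ i, 2 ≤ i → i ≤ |l| → |w 1| < w i := by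
    intro i hi
    induction i, hi using Int.leInduction with
    | base =>
      intro h2
      have hl1' : l ≠ -1 := by rintro rfl; norm_num at h2
      have hl1 : 1 ≠ l := by rintro rfl; norm_num at h2
      have h3 := hneg hl1'
      have h4 := hstep 1 le_rfl hn' hl1
      norm_num at h4
      exact abs_lt.2 ⟨by omega, h4⟩
    | succ k hk ih =>
      intro h2
      have h3 := ih (by omega)
      have h4 := hstep k (by omega) (by omega)
        (by rintro rfl; rw [abs_of_pos (by omega)] at h2; omega)
      omega
  have hwl : w l = |w (|l|)| := by
    rcases hl.1 with rfl | hs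
    · have h3 := hstep 1 le_rfl hn' (by norm_num)
      have h4 := hl.2
      rw [hw.2.1] at h4 ⊢
      norm_num at h3 h4 ⊢
      rw [abs_of_neg (by omega)]
    · rw [abs_of_pos (a := l) (by omega)]
      rcases eq_or_lt_of_le hs.1 with rfl | hs2
      · have h3 := hneg (by norm_num)
        have h4 := hl.2
        norm_num at h4
        rw [abs_of_pos (by omega)]
      · have h3 := hpos l hs2 (le_abs_self l)
        have := abs_nonneg (w 1)
        rw [abs_of_pos (by omega)]
  refine ⟨⟨hl1.1, hl1.2, ?_, ?_, ?_, ?_, ?_⟩, hwl⟩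
  · refine strictMonoOn_Icc_of_lt fun i h1 h2 => hstep i (by omega) h2 ?_
    have := le_abs_self l
    omega
  · refine strictMonoOn_Icc_of_lt fun i h1 h2 => ?_
    have h3 := hpos (i + 1) (by omega) h2
    have h4 := le_abs_self (w (i + 1))
    rcases eq_or_lt_of_le h1 with rfl | h5
    · exact h3.trans_le h4
    · have h6 := hpos i h5 (by omega)
      have h7 := abs_nonneg (w 1)
      rw [abs_of_pos (a := w i) (by omega)]
      refine (hstep i h1 (by omega) ?_).trans_le h4
      rintro rfl
      rw [abs_of_pos (by omega)] at h2
      omega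
  · intro i h1 h2
    have := hpos i h1 h2
    have := abs_nonneg (w 1)
    omega
  · rw [← hwl]
    exact hl.2
  · intro h1
    rw [h1] at hwl
    rcases abs_eq_abs.1 (h1.trans abs_one.symm) with rfl | rfl
    · have := hneg (by norm_num)
      omega
    · have h3 := hstep 1 le_rfl hn' (by norm_num)
      rw [hw.2.1] at hwl
      norm_num at h3
      omega

theorem IsGrassmannianD.exists_unique_descent (hn : 2 ≤ n) (hw : IsDPerm n w)
    (h : IsGrassmannianD n w m) :
    ∃ l, |l| = m ∧ w l = |w m| ∧ IsDescentD n w l ∧ ∀ l', IsDescentD n w l' → l' = l := by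
  have hn' : (2 : ℤ) ≤ n := by exact_mod_cast hn
  obtain ⟨hm1, hmn, hright, hleft, hpos, hdesc, hone⟩ := h
  have hr : ∀ i : ℤ, m < i → i + 1 ≤ n → w i < w (i + 1) := fun i h1 h2 =>
    hright ⟨by omega, by omega⟩ ⟨by omega, h2⟩ (by omega)
  have hlf : ∀ i : ℤ, 1 ≤ i → i + 1 ≤ m → |w i| < w (i + 1) := fun i h1 h2 => by
    have h3 := hleft (a := i) (b := i + 1) ⟨by omega, by omega⟩ ⟨by omega, h2⟩ (by omega)
    simp only at h3
    rwa [abs_of_pos (hpos (i + 1) (by omega) h2)] at h3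
  rcases eq_or_lt_of_le hm1 with rfl | hm2
  · have h1 := hone rfl
    norm_num at hdesc
    rcases abs_cases (w 1) with ⟨h2, _⟩ | ⟨h2, _⟩
    · refine ⟨1, by norm_num, h2.symm, ⟨Or.inr (by omega), by norm_num; omega⟩, ?_⟩
      rintro l' ⟨rfl | h3, h4⟩
      · rw [hw.2.1] at h4
        norm_num at h4
        omega
      · rw [abs_of_pos (by omega)] at h4
        by_contra hne
        have := hr l' (by omega) (by omega)
        omega
    · refine ⟨-1, by norm_num, by rw [hw.2.1]; omega, ⟨Or.inl rfl, ?_⟩, ?_⟩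
      · rw [hw.2.1]; norm_num; omega
      rintro l' ⟨rfl | h3, h4⟩
      · rfl
      · rw [abs_of_pos (by omega)] at h4
        rcases eq_or_lt_of_le h3.1 with rfl | h5
        · norm_num at h4
          omega
        · have := hr l' (by omega) (by omega)
          omega
  · refine ⟨m, abs_of_pos (by omega), (abs_of_pos (hpos m hm2 le_rfl)).symm,
      ⟨Or.inr (by omega), ?_⟩, ?_⟩
    · rwa [abs_of_pos (by omega), ← abs_of_pos (hpos m hm2 le_rfl)]
    · rintro l' ⟨rfl | h3, h4⟩
      · rw [hw.2.1] at h4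
        norm_num at h4
        have := hlf 1 le_rfl hm2
        norm_num at this
        have := neg_le_abs (w 1)
        omega
      · rw [abs_of_pos (by omega)] at h4
        by_contra hne
        rcases lt_or_gt_of_ne hne with h5 | h5
        · have := hlf l' h3.1 h5
          have := le_abs_self (w l')
          omega
        · have := hr l' h5 (by omega)
          omega

/-- The relation between the right part `R` of `w`, the value `b` and the last entry of the
shape. -/
def HasRankD (R : Set ℤ) (b r' : ℤ) : Prop :=
  ∃ r : ℤ, 0 ≤ r ∧ (∀ k : ℤ, 1 ≤ k → k ≤ r → (k ∈ R ∨ -k ∈ R)) ∧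
    ¬(r + 1 ∈ R ∨ -(r + 1) ∈ R) ∧ r' = if -1 ≤ b then 0 else min r (|b| - 1)

theorem hasShapeD_iff (hn : 2 ≤ n) (hw : IsDPerm n w) {a b r' : ℤ} :
    HasShapeD n w (a, b, r') ↔ ∃ m, IsGrassmannianD n w m ∧ a = |w m| ∧ b = w (m + 1) ∧
      HasRankD (w '' Set.Icc (m + 1) n) b r' := by
  constructor
  · rintro ⟨l, r, hl, hu, h0, h1, h2, h3⟩
    obtain ⟨hg, hwl⟩ := isGrassmannianD_of_unique_descent hn hw hl hu
    simp only [Prod.mk.injEq] at h3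
    obtain ⟨rfl, rfl, rfl⟩ := h3
    exact ⟨|l|, hg, hwl, rfl, r, h0, h1, h2, rfl⟩
  · rintro ⟨m, hg, rfl, rfl, r, h0, h1, h2, rfl⟩
    obtain ⟨l, rfl, hwl, hl, hu⟩ := hg.exists_unique_descent hn hw
    exact ⟨l, r, hl, hu, h0, h1, h2, by rw [hwl]⟩

theorem HasShapeD.isJoinIrreducibleD (hn : 2 ≤ n) (hw : IsDPerm n w) {σ : ℤ × ℤ × ℤ}
    (h : HasShapeD n w σ) : IsJoinIrreducibleD n w := by
  obtain ⟨l, _, hl, hu, _⟩ := h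
  exact isJoinIrreducibleD_of_unique_descent hn hw hl hu

theorem IsGrassmannianD.unique (hn : 2 ≤ n) (hw : IsDPerm n w) (h : IsGrassmannianD n w m)
    (h' : IsGrassmannianD n w m') : m = m' := by
  obtain ⟨l, rfl, _, hl, hu⟩ := h.exists_unique_descent hn hw
  obtain ⟨l', rfl, _, hl', hu'⟩ := h'.exists_unique_descent hn hw
  rw [hu l' hl']

/-- The absolute values of `w` on `{1,…,m}` are those not occurring on `{m+1,…,n}`. -/
theorem IsDPerm.mem_abs_image_iff (hw : IsDPerm n w) (h1 : 1 ≤ m) (hn : m ≤ n) (k : ℤ) :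
    k ∈ (fun i => |w i|) '' Set.Icc 1 m ↔ (1 ≤ k ∧ k ≤ n) ∧
      k ∉ w '' Set.Icc (m + 1) n ∧ -k ∉ w '' Set.Icc (m + 1) n := by
  constructor
  · rintro ⟨i, hi, rfl⟩
    refine ⟨hw.mem_range (by rw [abs_of_pos (by have := hi.1; omega)]; exact ⟨hi.1, hi.2.trans hn⟩),
      ?_, ?_⟩
    · rintro ⟨j, hj, hji⟩
      have := hw.abs_inj (i := j) (j := i) (by rw [hji, abs_abs])
      rw [abs_of_pos (by have := hj.1; omega), abs_of_pos (by have := hi.1; omega)] at this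
      have := hi.2
      have := hj.1
      omega
    · rintro ⟨j, hj, hji⟩
      have := hw.abs_inj (i := j) (j := i) (by rw [hji, abs_neg, abs_abs])
      rw [abs_of_pos (by have := hj.1; omega), abs_of_pos (by have := hi.1; omega)] at this
      have := hi.2
      have := hj.1
      omega
  · rintro ⟨hk, hk1, hk2⟩
    have hi := hw.symm_mem_range (i := k) (by rwa [abs_of_pos (by omega)])
    have hwk : w (w.symm k) = k := w.apply_symm_apply k
    generalize w.symm k = i at *
    rcases abs_cases i with ⟨h3, _⟩ | ⟨h3, _⟩
    · by_cases him : i ≤ m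
      · exact ⟨i, ⟨by omega, him⟩, by simp only; rw [hwk, abs_of_pos (by omega)]⟩
      · exact absurd ⟨i, ⟨by omega, by omega⟩, hwk⟩ hk1
    · by_cases him : -i ≤ m
      · exact ⟨-i, ⟨by omega, him⟩, by simp only; rw [hw.2.1, hwk, abs_neg, abs_of_pos (by omega)]⟩
      · exact absurd ⟨-i, ⟨by omega, by omega⟩, by rw [hw.2.1, hwk]⟩ hk2

theorem StrictMonoOn.eqOn_Icc_of_image_eq {f g : ℤ → ℤ} {a b : ℤ}
    (hf : StrictMonoOn f (Set.Icc a b)) (hg : StrictMonoOn g (Set.Icc a b))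
    (h : f '' Set.Icc a b = g '' Set.Icc a b) : Set.EqOn f g (Set.Icc a b) := by
  have hfin : Finite (Set.Icc a b) := (Set.finite_Icc a b).to_subtype
  have := (StrictMono.range_inj (f := (Set.Icc a b).domRestrict f)
    (g := (Set.Icc a b).domRestrict g) (fun x y hxy => hf x.2 y.2 hxy)
    (fun x y hxy => hg x.2 y.2 hxy)).1 (by rw [Set.range_domRestrict, Set.range_domRestrict, h])
  intro x hx
  exact congrFun this ⟨x, hx⟩

theorem IsGrassmannianD.eq_of_image_eq (hw : IsDPerm n w) (hw' : IsDPerm n w')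
    (h : IsGrassmannianD n w m) (h' : IsGrassmannianD n w' m')
    (heq : w '' Set.Icc (m + 1) n = w' '' Set.Icc (m' + 1) n) : w = w' := by
  have hmm : m = m' := by
    have h1 := congrArg Set.ncard heq
    rw [Set.ncard_image_of_injective _ w.injective, Set.ncard_image_of_injective _ w'.injective,
      ← Finset.coe_Icc, ← Finset.coe_Icc, Set.ncard_coe_finset, Set.ncard_coe_finset,
      Int.card_Icc, Int.card_Icc] at h1
    have := h.lt
    have := h'.lt
    omega
  subst hmm
  have hm1 := h.one_le
  have hmn := h.lt
  have hR := h.right.eqOn_Icc_of_image_eq h'.right heq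
  have hL := h.left.eqOn_Icc_of_image_eq h'.left (by
    ext k
    rw [hw.mem_abs_image_iff hm1 (by omega), hw'.mem_abs_image_iff hm1 (by omega), heq])
  refine hw.eq_of_forall (by omega) hw' (fun i h2 hin => ?_) (hL ⟨le_rfl, hm1⟩)
  by_cases him : i ≤ m
  · have := hL (x := i) ⟨by omega, him⟩
    simp only at this
    rwa [abs_of_pos (h.pos i h2 him), abs_of_pos (h'.pos i h2 him)] at this
  · exact hR ⟨by omega, hin⟩

/-- The sets `R` occurring as right parts `w({m+1,…,n})` of elements `w` with a unique descent
at `±m` such that `|w(m)| = a` and `w(m+1) = b`. -/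
structure IsRightPartD (n : ℕ) (R : Set ℤ) (a b : ℤ) : Prop where
  mem_range : ∀ x ∈ R, 1 ≤ |x| ∧ |x| ≤ (n : ℤ)
  neg_notMem : ∀ x ∈ R, -x ∉ R
  one_le : 1 ≤ a
  le : a ≤ n
  notMem : a ∉ R
  neg_notMem' : -a ∉ R
  mem_of_lt : ∀ k, a < k → k ≤ n → k ∈ R ∨ -k ∈ R
  mem : b ∈ R
  min : ∀ x ∈ R, b ≤ x
  lt : b < a
  neg_lt : -a < b ∨ ∃ k, 1 ≤ k ∧ k < a ∧ k ∉ R ∧ -k ∉ R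

theorem IsGrassmannianD.isRightPartD (hw : IsDPerm n w) (h : IsGrassmannianD n w m) :
    IsRightPartD n (w '' Set.Icc (m + 1) n) |w m| (w (m + 1)) := by
  have hm1 := h.one_le
  have hmn := h.lt
  have hiff := hw.mem_abs_image_iff hm1 (by omega)
  have ha := (hiff |w m|).1 ⟨m, ⟨hm1, le_rfl⟩, rfl⟩
  have hmem : w (m + 1) ∈ w '' Set.Icc (m + 1) n := ⟨m + 1, ⟨le_rfl, hmn⟩, rfl⟩
  refine ⟨?_, ?_, ha.1.1, ha.1.2, ha.2.1, ha.2.2, ?_, hmem, ?_, h.desc, ?_⟩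
  · rintro _ ⟨i, hi, rfl⟩
    have := hi.1
    exact hw.mem_range (by rw [abs_of_pos (by omega)]; exact ⟨by omega, hi.2⟩)
  · rintro _ ⟨i, hi, rfl⟩ ⟨j, hj, hji⟩
    rw [← hw.2.1] at hji
    have := w.injective hji
    have := hi.1
    have := hj.1
    omega
  · intro k hk hkn
    by_contra hcon
    push Not at hcon
    obtain ⟨i, hi, hik⟩ := (hiff k).2 ⟨⟨by omega, hkn⟩, hcon⟩
    have := h.left.monotoneOn hi (b := m) ⟨hm1, le_rfl⟩ hi.2
    simp only at hik this
    omega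
  · rintro _ ⟨i, hi, rfl⟩
    exact h.right.monotoneOn ⟨le_rfl, hmn⟩ hi hi.1
  · rcases eq_or_lt_of_le hm1 with rfl | hm2
    · exact Or.inl (h.one rfl)
    · have h1 := (hiff |w 1|).1 ⟨1, ⟨le_rfl, hm1⟩, rfl⟩
      exact Or.inr ⟨|w 1|, h1.1.1, h.left ⟨le_rfl, hm1⟩ ⟨hm1, le_rfl⟩ hm2, h1.2⟩

end Grassmannian

section Existence

variable {n : ℕ}

theorem exists_strictMonoOn_image_eq (S : Finset ℤ) (c : ℤ) :
    ∃ g : ℤ → ℤ, StrictMonoOn g (Set.Icc (c + 1) (c + S.card)) ∧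
      g '' Set.Icc (c + 1) (c + S.card) = S := by
  induction S using Finset.induction_on_max with
  | empty => exact ⟨id, strictMono_id.strictMonoOn _, by simp⟩
  | insert x S hx ih =>
    obtain ⟨g, hg, hgS⟩ := ih
    have hxS : x ∉ S := fun h => lt_irrefl x (hx x h)
    rw [Finset.card_insert_of_notMem hxS]
    have hlt : ∀ i ∈ Set.Icc (c + 1) (c + (S.card : ℤ)), g i ∈ S := fun i hi => by
      rw [← Finset.mem_coe, ← hgS]
      exact ⟨i, hi, rfl⟩
    refine ⟨fun i => if i ≤ c + S.card then g i else x, ?_, ?_⟩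
    · intro i hi j hj hij
      simp only [Set.mem_Icc] at hi hj ⊢
      push_cast at hi hj
      rw [if_pos (by omega)]
      split_ifs with hj2
      · exact hg ⟨hi.1, by omega⟩ ⟨hj.1, hj2⟩ hij
      · exact hx _ (hlt i ⟨hi.1, by omega⟩)
    · ext y
      rw [Finset.coe_insert, ← hgS]
      constructor
      · rintro ⟨i, hi, rfl⟩
        simp only
        split_ifs with h
        · exact Or.inr ⟨i, ⟨hi.1, h⟩, rfl⟩
        · exact Or.inl rfl
      · rintro (rfl | ⟨i, hi, rfl⟩)
        · refine ⟨c + S.card + 1, ⟨by omega, by push_cast; omega⟩, ?_⟩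
          simp only
          rw [if_neg (by omega)]
        · refine ⟨i, ⟨hi.1, by have := hi.2; push_cast; omega⟩, ?_⟩
          simp only
          rw [if_pos hi.2]

theorem exists_signed_perm {g : ℤ → ℤ}
    (hr : ∀ i : ℤ, 1 ≤ i → i ≤ n → 1 ≤ |g i| ∧ |g i| ≤ (n : ℤ))
    (hinj : ∀ i j : ℤ, 1 ≤ i → i ≤ n → 1 ≤ j → j ≤ n → |g i| = |g j| → i = j) :
    ∃ w : Equiv.Perm ℤ, (∀ i : ℤ, ¬(1 ≤ |i| ∧ |i| ≤ (n : ℤ)) → w i = i) ∧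
      (∀ i : ℤ, w (-i) = -(w i)) ∧ ∀ i : ℤ, 1 ≤ i → i ≤ n → w i = g i := by
  set F : ℤ → ℤ := fun i => if 1 ≤ i ∧ i ≤ n then g i else
    if 1 ≤ -i ∧ -i ≤ n then -g (-i) else i with hF
  have hpos : ∀ i : ℤ, 1 ≤ i → i ≤ n → F i = g i := fun i h1 h2 => if_pos ⟨h1, h2⟩
  have hnegv : ∀ i : ℤ, 1 ≤ -i → -i ≤ n → F i = -g (-i) := fun i h1 h2 => by
    rw [hF]
    simp only
    rw [if_neg (by omega), if_pos ⟨h1, h2⟩]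
  have hout : ∀ i : ℤ, ¬(1 ≤ |i| ∧ |i| ≤ (n : ℤ)) → F i = i := fun i hi => by
    rw [hF]
    simp only
    rcases abs_cases i with ⟨h, _⟩ | ⟨h, _⟩ <;> rw [if_neg (by omega), if_neg (by omega)]
  have hodd : ∀ i, F (-i) = -F i := by
    intro i
    by_cases hi : 1 ≤ |i| ∧ |i| ≤ (n : ℤ)
    · rcases abs_cases i with ⟨h, _⟩ | ⟨h, _⟩ <;> rw [h] at hi
      · rw [hpos i hi.1 hi.2, hnegv (-i) (by omega) (by omega), neg_neg]
      · rw [hpos (-i) hi.1 hi.2, hnegv i (by omega) (by omega), neg_neg]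
    · rw [hout i hi, hout (-i) (by rwa [abs_neg])]
  have habs : ∀ i : ℤ, 1 ≤ |i| → |i| ≤ (n : ℤ) → |F i| = |g (|i|)| := by
    intro i h1 h2
    rcases abs_cases i with ⟨h, _⟩ | ⟨h, _⟩ <;> rw [h] at h1 h2 ⊢
    · rw [hpos i h1 h2]
    · rw [hnegv i h1 h2, abs_neg]
  have hFinj : Function.Injective F := by
    intro i j hij
    by_cases hi : 1 ≤ |i| ∧ |i| ≤ (n : ℤ) <;> by_cases hj : 1 ≤ |j| ∧ |j| ≤ (n : ℤ)
    · have h1 := hinj |i| |j| hi.1 hi.2 hj.1 hj.2 (by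
        rw [← habs i hi.1 hi.2, ← habs j hj.1 hj.2, hij])
      rcases abs_eq_abs.1 h1 with h | h
      · exact h
      · subst h
        rw [hodd] at hij
        have h2 := (hr _ hj.1 hj.2).1
        rw [← habs j hj.1 hj.2] at h2
        have : F j = 0 := by omega
        rw [this] at h2
        norm_num at h2
    · rw [hout j hj] at hij
      rw [← hij, habs i hi.1 hi.2] at hj
      exact absurd (hr _ hi.1 hi.2) hj
    · rw [hout i hi] at hij
      rw [hij, habs j hj.1 hj.2] at hi
      exact absurd (hr _ hj.1 hj.2) hi
    · rwa [hout i hi, hout j hj] at hij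
  have hFsurj : Function.Surjective F := by
    intro y
    by_cases hy : |y| ≤ (n : ℤ)
    · have hmaps : Set.MapsTo F (Finset.Icc (-(n : ℤ)) n) (Finset.Icc (-(n : ℤ)) n) := by
        intro i hi
        rw [Finset.mem_coe, Finset.mem_Icc, ← abs_le] at hi ⊢
        by_cases hi1 : 1 ≤ |i|
        · rw [habs i hi1 hi]
          exact (hr _ hi1 hi).2
        · rwa [hout i (by omega)]
      obtain ⟨i, _, hi⟩ := Finset.surjOn_of_injOn_of_card_le F hmaps hFinj.injOn le_rfl
        (show y ∈ ((Finset.Icc (-(n : ℤ)) n : Finset ℤ) : Set ℤ) by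
          rw [Finset.mem_coe, Finset.mem_Icc, ← abs_le]; exact hy)
      exact ⟨i, hi⟩
    · exact ⟨y, hout y (by omega)⟩
  exact ⟨Equiv.ofBijective F ⟨hFinj, hFsurj⟩, hout, hodd, hpos⟩

/-- Prescribed values extend to an element of `W(D_n)`, up to a sign at `1`. -/
theorem exists_isDPerm (hn : 1 ≤ n) {g : ℤ → ℤ}
    (hr : ∀ i : ℤ, 1 ≤ i → i ≤ n → 1 ≤ |g i| ∧ |g i| ≤ (n : ℤ))
    (hinj : ∀ i j : ℤ, 1 ≤ i → i ≤ n → 1 ≤ j → j ≤ n → |g i| = |g j| → i = j) :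
    ∃ w : Equiv.Perm ℤ, IsDPerm n w ∧ (∀ i : ℤ, 2 ≤ i → i ≤ n → w i = g i) ∧ |w 1| = |g 1| := by
  have hn' : (1 : ℤ) ≤ n := by exact_mod_cast hn
  obtain ⟨w, h1, h2, h3⟩ := exists_signed_perm hr hinj
  by_cases hev : Even ((Finset.Icc (1 : ℤ) (n : ℤ)).filter (fun i => w i < 0)).card
  · exact ⟨w, ⟨h1, h2, hev⟩, fun i h _ => h3 i (by omega) (by omega), by rw [h3 1 le_rfl hn']⟩
  · set g' : ℤ → ℤ := Function.update g 1 (-g 1) with hg'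
    have hg'1 : g' 1 = -g 1 := Function.update_self ..
    have hg'2 : ∀ i, i ≠ 1 → g' i = g i := fun i hi => Function.update_of_ne hi ..
    have habs : ∀ i, |g' i| = |g i| := by
      intro i
      by_cases hi : i = 1
      · rw [hi, hg'1, abs_neg]
      · rw [hg'2 i hi]
    obtain ⟨w', h1', h2', h3'⟩ := exists_signed_perm (n := n) (g := g')
      (by simpa only [habs] using hr) (by simpa only [habs] using hinj)
    refine ⟨w', ⟨h1', h2', (even_card_neg_iff_not hn (g := w) (fun i h h' => ?_) ?_ ?_).2 hev⟩,
      fun i h h' => ?_, ?_⟩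
    · rw [h3' i (by omega) h', h3 i (by omega) h', hg'2 i (by omega)]
    · rw [h3' 1 le_rfl hn', h3 1 le_rfl hn', hg'1]
    · rw [h3 1 le_rfl hn']
      intro h0
      have := (hr 1 le_rfl hn').1
      rw [h0] at this
      norm_num at this
    · rw [h3' i (by omega) h', hg'2 i (by omega)]
    · rw [h3' 1 le_rfl hn', habs]

theorem IsRightPartD.exists_isGrassmannianD {R : Set ℤ} {a b : ℤ} (h : IsRightPartD n R a b) :
    ∃ w m, IsDPerm n w ∧ IsGrassmannianD n w m ∧ w '' Set.Icc (m + 1) n = R ∧ a = |w m| ∧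
      b = w (m + 1) := by
  classical
  have hn : 1 ≤ n := by have := h.one_le; have := h.le; omega
  set C : Finset ℤ := (Finset.Icc (1 : ℤ) n).filter (fun k => ¬(k ∈ R ∨ -k ∈ R)) with hC
  set S : Finset ℤ := (Finset.Icc (-(n : ℤ)) n).filter (fun k => k ∈ R) with hS
  have hCmem : ∀ k, k ∈ C ↔ (1 ≤ k ∧ k ≤ n) ∧ k ∉ R ∧ -k ∉ R := fun k => by
    rw [hC, Finset.mem_filter, Finset.mem_Icc, not_or]
  have hSmem : ∀ k, k ∈ S ↔ k ∈ R := fun k => by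
    rw [hS, Finset.mem_filter, Finset.mem_Icc, ← abs_le]
    exact ⟨fun h => h.2, fun hk => ⟨(h.mem_range k hk).2, hk⟩⟩
  have hcard : C.card + S.card = n := by
    have h1 : ((Finset.Icc (1 : ℤ) n).filter (fun k => k ∈ R ∨ -k ∈ R)).card + C.card = n := by
      have h1 := Finset.card_filter_add_card_filter_not (s := Finset.Icc (1 : ℤ) n)
        (fun k => k ∈ R ∨ -k ∈ R)
      rw [Int.card_Icc, add_sub_cancel_right, Int.toNat_natCast] at h1
      convert h1
    have h2 : S.card = ((Finset.Icc (1 : ℤ) n).filter (fun k => k ∈ R ∨ -k ∈ R)).card := by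
      refine Finset.card_bij (fun k _ => |k|) ?_ ?_ ?_
      · intro k hk
        rw [hSmem] at hk
        rw [Finset.mem_filter, Finset.mem_Icc]
        refine ⟨h.mem_range k hk, ?_⟩
        rcases abs_choice k with h3 | h3 <;> rw [h3]
        · exact Or.inl hk
        · exact Or.inr (by rwa [neg_neg])
      · intro k hk j hj hkj
        rw [hSmem] at hk hj
        rcases abs_eq_abs.1 hkj with h3 | h3
        · exact h3
        · rw [h3] at hk
          exact absurd hk (h.neg_notMem j hj)
      · intro k hk
        rw [Finset.mem_filter, Finset.mem_Icc] at hk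
        rcases hk.2 with h3 | h3
        · exact ⟨k, (hSmem k).2 h3, abs_of_pos (by omega)⟩
        · exact ⟨-k, (hSmem _).2 h3, by rw [abs_neg, abs_of_pos (by omega)]⟩
    omega
  obtain ⟨f, hf, hfC⟩ := exists_strictMonoOn_image_eq C 0
  obtain ⟨e, he, heS⟩ := exists_strictMonoOn_image_eq S C.card
  rw [show (C.card : ℤ) + S.card = n by omega] at he heS
  rw [zero_add, zero_add] at hf hfC
  have haC : a ∈ C := (hCmem a).2 ⟨⟨h.one_le, h.le⟩, h.notMem, h.neg_notMem'⟩
  have hm1 : 1 ≤ C.card := Finset.card_pos.2 ⟨a, haC⟩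
  have hS1 : 1 ≤ S.card := Finset.card_pos.2 ⟨b, (hSmem b).2 h.mem⟩
  have hfmem : ∀ i : ℤ, 1 ≤ i → i ≤ C.card → f i ∈ C := fun i h1 h2 => by
    rw [← Finset.mem_coe, ← hfC]
    exact ⟨i, ⟨h1, h2⟩, rfl⟩
  have hemem : ∀ i : ℤ, C.card + 1 ≤ i → i ≤ n → e i ∈ R := fun i h1 h2 => by
    rw [← hSmem, ← Finset.mem_coe, ← heS]
    exact ⟨i, ⟨h1, h2⟩, rfl⟩
  set g : ℤ → ℤ := fun i => if i ≤ C.card then f i else e i with hg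
  have hgf : ∀ i : ℤ, i ≤ C.card → g i = f i := fun i hi => if_pos hi
  have hge : ∀ i : ℤ, C.card + 1 ≤ i → g i = e i := fun i hi => if_neg (by omega)
  have hcross : ∀ i j : ℤ, 1 ≤ i → i ≤ C.card → C.card + 1 ≤ j → j ≤ n → |g i| ≠ |g j| := by
    intro i j h1 h2 h3 h4 h5
    have h6 := (hCmem _).1 (hfmem i h1 h2)
    have h7 := hemem j h3 h4
    rw [hgf i h2, hge j h3, abs_of_pos (by omega)] at h5
    rcases abs_choice (e j) with h8 | h8
    · rw [h5, h8] at h6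
      exact h6.2.1 h7
    · rw [h5, h8, neg_neg] at h6
      exact h6.2.2 h7
  have hfpos : ∀ i : ℤ, 1 ≤ i → i ≤ C.card → 0 < f i := fun i h1 h2 => by
    have := (hCmem _).1 (hfmem i h1 h2)
    omega
  obtain ⟨w, hw, hwg, hw1⟩ := exists_isDPerm hn (g := g) (by
      intro i h1 h2
      by_cases hi : i ≤ C.card
      · have h3 := (hCmem _).1 (hfmem i h1 hi)
        rw [hgf i hi, abs_of_pos (by omega)]
        exact h3.1
      · rw [hge i (by omega)]
        exact h.mem_range _ (hemem i (by omega) h2)) (by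
      intro i j h1 h2 h3 h4 h5
      by_cases hi : i ≤ C.card <;> by_cases hj : j ≤ C.card
      · rw [hgf i hi, hgf j hj, abs_of_pos (hfpos i h1 hi), abs_of_pos (hfpos j h3 hj)] at h5
        exact hf.injOn ⟨h1, hi⟩ ⟨h3, hj⟩ h5
      · exact absurd h5 (hcross i j h1 hi (by omega) h4)
      · exact absurd h5.symm (hcross j i h3 hj (by omega) h2)
      · rw [hge i (by omega), hge j (by omega)] at h5
        have h6 := hemem i (by omega) h2
        have h7 := hemem j (by omega) h4
        rcases abs_eq_abs.1 h5 with h8 | h8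
        · exact he.injOn ⟨by omega, h2⟩ ⟨by omega, h4⟩ h8
        · rw [h8] at h6
          exact absurd h6 (h.neg_notMem _ h7))
  have hwe : Set.EqOn w e (Set.Icc (C.card + 1) n) := fun i hi => by
    have := hi.1
    rw [hwg i (by omega) hi.2, hge i hi.1]
  have hwf : Set.EqOn (fun i => |w i|) f (Set.Icc 1 C.card) := fun i hi => by
    simp only
    rw [← abs_of_pos (hfpos i hi.1 hi.2), ← hgf i hi.2]
    rcases eq_or_lt_of_le hi.1 with rfl | h2
    · exact hw1
    · rw [hwg i h2 (by have := hi.2; omega)]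
  have hRimg : w '' Set.Icc (C.card + 1) n = R := by
    rw [hwe.image_eq, heS]
    ext k
    exact hSmem k
  have hb : b = w (C.card + 1) := by
    have hlast : (C.card : ℤ) + 1 ∈ Set.Icc ((C.card : ℤ) + 1) n := ⟨le_rfl, by omega⟩
    apply le_antisymm
    · exact h.min _ (by rw [← hRimg]; exact ⟨_, hlast, rfl⟩)
    · obtain ⟨i, hi, rfl⟩ := hRimg.symm ▸ h.mem
      rw [hwe hi, hwe hlast]
      exact he.monotoneOn hlast hi hi.1
  have hlast : (C.card : ℤ) ∈ Set.Icc 1 (C.card : ℤ) := ⟨by omega, le_rfl⟩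
  have ha : a = |w C.card| := by
    have h1 : |w C.card| = f C.card := hwf hlast
    rw [h1]
    apply le_antisymm
    · rw [← Finset.mem_coe, ← hfC] at haC
      obtain ⟨i, hi, rfl⟩ := haC
      exact hf.monotoneOn hi hlast hi.2
    · have h2 := (hCmem _).1 (hfmem C.card hlast.1 le_rfl)
      by_contra hcon
      rcases h.mem_of_lt _ (not_le.1 hcon) h2.1.2 with h3 | h3
      · exact h2.2.1 h3
      · exact h2.2.2 h3
  refine ⟨w, C.card, hw, ⟨hlast.1, by omega, he.congr hwe.symm, hf.congr hwf.symm, ?_, ?_, ?_⟩,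
    hRimg, ha, hb⟩
  · intro i h1 h2
    rw [hwg i h1 (by omega), hgf i h2]
    exact hfpos i (by omega) h2
  · rw [← ha, ← hb]
    exact h.lt
  · intro h1
    rw [h1] at ha hb
    norm_num at hb
    rw [← ha, ← hb]
    rcases h.neg_lt with h2 | ⟨k, hk1, hk2, hk3⟩
    · exact h2
    · have hkC : k ∈ C := (hCmem k).2 ⟨⟨hk1, by have := h.le; omega⟩, hk3⟩
      have := Finset.card_le_one.1 (by omega : C.card ≤ 1) k hkC a haC
      omega

end Existence
section Counting

variable {n : ℕ} {R : Set ℤ} {a b r' : ℤ}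

theorem IsRightPartD.ne_zero (h : IsRightPartD n R a b) : b ≠ 0 := by
  rintro rfl
  simpa using (h.mem_range 0 h.mem).1

theorem IsRightPartD.ne_neg (h : IsRightPartD n R a b) : b ≠ -a := fun hb =>
  h.neg_notMem' (hb ▸ h.mem)

theorem IsRightPartD.isValidShapeD (h : IsRightPartD n R a b) (hr : HasRankD R b r') :
    IsValidShapeD n (a, b, r') := by
  obtain ⟨r, hr0, hr1, hr2, rfl⟩ := hr
  have hb0 := h.ne_zero
  have hba := h.ne_neg
  have h1 := h.one_le
  have h2 := h.le
  have h3 := h.lt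
  have h4 := (h.mem_range b h.mem).2
  have hmiss : ∀ k, 1 ≤ k → k ∉ R → -k ∉ R → r < k := by
    intro k hk hk1 hk2
    by_contra hcon
    exact (hr1 k hk (by omega)).elim hk1 hk2
  refine ⟨?_, h2, ?_⟩
  · rcases h.neg_lt with h5 | ⟨k, hk1, hk2, _⟩ <;> simp only <;> omega
  · simp only
    split_ifs with hb
    · exact Or.inl ⟨hb, h3, hb0, rfl⟩
    · rw [abs_of_neg (by omega)] at *
      rcases h.neg_lt with h5 | ⟨k, hk1, hk2, hk3, hk4⟩
      · exact Or.inr (Or.inl ⟨h5, by omega, by omega, by omega⟩)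
      · have := hmiss k hk1 hk3 hk4
        by_cases h5 : -a < b
        · exact Or.inr (Or.inl ⟨h5, by omega, by omega, by omega⟩)
        · exact Or.inr (Or.inr ⟨by omega, by omega, by omega, by omega⟩)

open Classical in
/-- The sign with which `k` occurs in `R`, or `0` if neither `k` nor `-k` lies in `R`. -/
noncomputable def signIn (R : Set ℤ) (k : ℤ) : ℤ :=
  if k ∈ R then 1 else if -k ∈ R then -1 else 0

theorem signIn_eq_one {k : ℤ} : signIn R k = 1 ↔ k ∈ R := by
  unfold signIn
  split_ifs <;> simp_all

theorem signIn_eq_neg_one (hR : ∀ x ∈ R, -x ∉ R) {k : ℤ} : signIn R k = -1 ↔ -k ∈ R := by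
  unfold signIn
  split_ifs with h1 h2
  · simpa using hR k h1
  · simpa using h2
  · simpa using h2

theorem signIn_eq_zero {k : ℤ} : signIn R k = 0 ↔ k ∉ R ∧ -k ∉ R := by
  unfold signIn
  split_ifs <;> simp_all

theorem signIn_cases (R : Set ℤ) (k : ℤ) : signIn R k = 1 ∨ signIn R k = -1 ∨ signIn R k = 0 := by
  unfold signIn
  split_ifs <;> simp

/-- The possible signs of `k` in a right part of shape `(a, b, r')`. -/
def signOptions (a b r' k : ℤ) : Finset ℤ :=
  if k = a then {0} else if k = |b| then {b.sign} else if max a |b| < k then {1} else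
    if min a |b| < k then (if a < -b then {1, -1} else {0, 1}) else
      if -1 ≤ b then {0} else if k ≤ r' then {1, -1} else if k = r' + 1 then {0} else {1, -1, 0}

theorem IsRightPartD.signIn_mem (h : IsRightPartD n R a b) (hr : HasRankD R b r') {k : ℤ}
    (hk1 : 1 ≤ k) (hkn : k ≤ n) : signIn R k ∈ signOptions a b r' k := by
  obtain ⟨r, hr0, hr1, hr2, rfl⟩ := hr
  have hb0 := h.ne_zero
  have hba := h.ne_neg
  have hlt := h.lt
  have hR := h.neg_notMem
  have habs := abs_cases b
  have hneg : b ≠ -k → -k < b → -k ∉ R := fun _ h1 h2 => by have := h.min _ h2; omega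
  unfold signOptions
  split_ifs with c1 c2 c3 c4 c5 c6 c7 c8
  · rw [Finset.mem_singleton, signIn_eq_zero, c1]
    exact ⟨h.notMem, h.neg_notMem'⟩
  · rw [Finset.mem_singleton]
    rcases lt_or_gt_of_ne hb0 with h1 | h1
    · rw [Int.sign_eq_neg_one_of_neg h1, signIn_eq_neg_one hR, show -k = b by omega]
      exact h.mem
    · rw [Int.sign_eq_one_of_pos h1, signIn_eq_one, show k = b by omega]
      exact h.mem
  · rw [Finset.mem_singleton, signIn_eq_one]
    exact (h.mem_of_lt k (by omega) hkn).resolve_right (hneg (by omega) (by omega))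
  · rw [Finset.mem_insert, Finset.mem_singleton, signIn_eq_one, signIn_eq_neg_one hR]
    exact h.mem_of_lt k (by omega) hkn
  · rw [Finset.mem_insert, Finset.mem_singleton]
    have h1 : signIn R k ≠ -1 := by
      rw [Ne, signIn_eq_neg_one hR]
      exact hneg (by omega) (by omega)
    have := signIn_cases R k
    omega
  · rw [Finset.mem_singleton, signIn_eq_zero]
    exact ⟨fun h1 => by have := h.min _ h1; omega, fun h1 => by have := h.min _ h1; omega⟩
  · rw [Finset.mem_insert, Finset.mem_singleton, signIn_eq_one, signIn_eq_neg_one hR]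
    exact hr1 k hk1 (by omega)
  · rw [Finset.mem_singleton, signIn_eq_zero, ← not_or, c8, min_eq_left (by omega)]
    exact hr2
  · simpa using signIn_cases R k

theorem exists_first_notMem {P : ℤ → Prop} (ha : 1 ≤ a) (h : ¬ P a) :
    ∃ r : ℤ, 0 ≤ r ∧ (∀ k, 1 ≤ k → k ≤ r → P k) ∧ ¬ P (r + 1) := by
  classical
  have hex : ∃ j : ℕ, ¬ P (j + 1) := ⟨(a - 1).toNat, by
    rwa [Int.toNat_of_nonneg (by omega), sub_add_cancel]⟩
  refine ⟨Nat.find hex, by omega, fun k h1 h2 => ?_, Nat.find_spec hex⟩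
  have := Nat.find_min hex (m := (k - 1).toNat) (by omega)
  rwa [Int.toNat_of_nonneg (by omega), sub_add_cancel, not_not] at this

theorem isRightPartD_of_signIn_mem (hv : IsValidShapeD n (a, b, r'))
    (hmem : ∀ x ∈ R, 1 ≤ |x| ∧ |x| ≤ (n : ℤ)) (hR : ∀ x ∈ R, -x ∉ R)
    (h : ∀ k : ℤ, 1 ≤ k → k ≤ n → signIn R k ∈ signOptions a b r' k) :
    IsRightPartD n R a b ∧ HasRankD R b r' := by
  obtain ⟨ha2, han, hv⟩ := hv
  simp only at ha2 han hv
  have habs := abs_cases b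
  have hsb : b.sign = 1 ∧ 0 < b ∨ b.sign = -1 ∧ b < 0 := by
    rcases lt_or_gt_of_ne (show b ≠ 0 by omega) with h1 | h1
    · exact Or.inr ⟨Int.sign_eq_neg_one_of_neg h1, h1⟩
    · exact Or.inl ⟨Int.sign_eq_one_of_pos h1, h1⟩
  have ha := h a (by omega) han
  simp only [signOptions, if_true, Finset.mem_singleton, signIn_eq_zero] at ha
  have hb : b ∈ R := by
    have hb1 := h |b| (by omega) (by omega)
    rw [signOptions, if_neg (by omega), if_pos rfl, Finset.mem_singleton] at hb1
    rcases hsb with ⟨h1, h2⟩ | ⟨h1, h2⟩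
    · rwa [h1, signIn_eq_one, abs_of_pos h2] at hb1
    · rwa [h1, signIn_eq_neg_one hR, abs_of_neg h2, neg_neg] at hb1
  have hlow : ∀ k, 1 ≤ k → k ≤ r' → k ∈ R ∨ -k ∈ R := by
    intro k hk hkr
    have hk1 := h k hk (by omega)
    rwa [signOptions, if_neg (by omega), if_neg (by omega), if_neg (by omega), if_neg (by omega),
      if_neg (by omega), if_pos hkr, Finset.mem_insert, Finset.mem_singleton, signIn_eq_one,
      signIn_eq_neg_one hR] at hk1
  have hmiss : b ≤ -2 → r' + 1 < |b| → r' + 1 ∉ R ∧ -(r' + 1) ∉ R := by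
    intro hb2 hrb
    have hk1 := h (r' + 1) (by omega) (by omega)
    rwa [signOptions, if_neg (by omega), if_neg (by omega), if_neg (by omega), if_neg (by omega),
      if_neg (by omega), if_neg (by omega), if_pos rfl, Finset.mem_singleton,
      signIn_eq_zero] at hk1
  refine ⟨⟨hmem, hR, by omega, han, ha.1, ha.2, ?_, hb, ?_, by omega, ?_⟩, ?_⟩
  · intro k hk hkn
    rw [← signIn_eq_one, ← signIn_eq_neg_one hR]
    have hk1 := h k (by omega) hkn
    unfold signOptions at hk1
    split_ifs at hk1 <;> simp only [Finset.mem_insert, Finset.mem_singleton] at hk1 <;> omega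
  · intro x hx
    by_contra hcon
    have hxm := hmem x hx
    have hk1 := h |x| hxm.1 hxm.2
    rcases abs_cases x with ⟨hxa, hx0⟩ | ⟨hxa, hx0⟩
    · rw [hxa] at hxm hk1
      rw [signIn_eq_one.2 hx] at hk1
      unfold signOptions at hk1
      split_ifs at hk1 <;> simp only [Finset.mem_insert, Finset.mem_singleton] at hk1 <;> omega
    · rw [hxa] at hxm hk1
      rw [(signIn_eq_neg_one hR).2 (by rwa [neg_neg])] at hk1
      unfold signOptions at hk1
      split_ifs at hk1 <;> simp only [Finset.mem_insert, Finset.mem_singleton] at hk1 <;> omega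
  · by_cases h1 : -a < b
    · exact Or.inl h1
    · exact Or.inr ⟨r' + 1, by omega, by omega, hmiss (by omega) (by omega)⟩
  · obtain ⟨r, hr0, hr1, hr2⟩ := exists_first_notMem (P := fun k => k ∈ R ∨ -k ∈ R)
      (show 1 ≤ a by omega) (not_or.2 ha)
    refine ⟨r, hr0, hr1, hr2, ?_⟩
    split_ifs with hb1
    · omega
    · have h1 : r' ≤ r := by
        by_contra hcon
        exact hr2 (hlow (r + 1) (by omega) (by omega))
      by_cases h2 : r' + 1 < |b|
      · have h3 : r ≤ r' := by
          by_contra hcon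
          have := hr1 (r' + 1) (by omega) (by omega)
          have := hmiss (by omega) h2
          tauto
        omega
      · omega

theorem prod_Icc_ite_mem_Icc (c : ℕ) {p q : ℤ} (hp : 1 ≤ p) (hq : q ≤ n) :
    ∏ k ∈ Finset.Icc (1 : ℤ) n, (if k ∈ Finset.Icc p q then c else 1) = c ^ (q + 1 - p).toNat := by
  rw [Finset.prod_ite_mem, Finset.inter_eq_right.2 (Finset.Icc_subset_Icc hp hq),
    Finset.prod_const, Int.card_Icc]

theorem prod_card_signOptions (hv : IsValidShapeD n (a, b, r')) :
    ∏ k ∈ Finset.Icc (1 : ℤ) n, (signOptions a b r' k).card =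
      if -1 ≤ b then 2 ^ (max a |b| - min a |b| - 1).toNat
      else 2 ^ r'.toNat * 3 ^ (min a |b| - r' - 2).toNat *
        2 ^ (max a |b| - min a |b| - 1).toNat := by
  obtain ⟨ha2, han, hv⟩ := hv
  simp only at ha2 han hv
  have habs := abs_cases b
  have hC := prod_Icc_ite_mem_Icc (n := n) 2 (p := min a |b| + 1) (q := max a |b| - 1)
    (by omega) (by omega)
  rw [show max a |b| - 1 + 1 - (min a |b| + 1) = max a |b| - min a |b| - 1 by ring] at hC
  split_ifs with hb
  · rw [← hC]
    refine Finset.prod_congr rfl fun k hk => ?_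
    rw [Finset.mem_Icc] at hk
    unfold signOptions
    simp only [Finset.mem_Icc]
    split_ifs <;> first | rfl | omega
  · have hA := prod_Icc_ite_mem_Icc (n := n) 2 (p := 1) (q := r') le_rfl (by omega)
    have hB := prod_Icc_ite_mem_Icc (n := n) 3 (p := r' + 2) (q := min a |b| - 1)
      (by omega) (by omega)
    rw [add_sub_cancel_right] at hA
    rw [show min a |b| - 1 + 1 - (r' + 2) = min a |b| - r' - 2 by ring] at hB
    rw [← hA, ← hB, ← hC, ← Finset.prod_mul_distrib, ← Finset.prod_mul_distrib]
    refine Finset.prod_congr rfl fun k hk => ?_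
    rw [Finset.mem_Icc] at hk
    unfold signOptions
    simp only [Finset.mem_Icc]
    split_ifs <;> first | rfl | omega

theorem mem_signOptions_cases {k s : ℤ} (h : s ∈ signOptions a b r' k) (hb : b ≠ 0) :
    s = 1 ∨ s = -1 ∨ s = 0 := by
  have hsb : b.sign = 1 ∨ b.sign = -1 := by
    rcases lt_or_gt_of_ne hb with h1 | h1
    · exact Or.inr (Int.sign_eq_neg_one_of_neg h1)
    · exact Or.inl (Int.sign_eq_one_of_pos h1)
  unfold signOptions at h
  split_ifs at h <;> simp only [Finset.mem_insert, Finset.mem_singleton] at h <;> omega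

theorem ncard_isRightPartD (hv : IsValidShapeD n (a, b, r')) :
    {R : Set ℤ | IsRightPartD n R a b ∧ HasRankD R b r'}.ncard =
      ∏ k ∈ Finset.Icc (1 : ℤ) n, (signOptions a b r' k).card := by
  have hb0 : b ≠ 0 := by
    have := hv.2.2
    have := hv.1
    simp only at *
    omega
  rw [← Finset.prod_coe_sort, ← Fintype.card_piFinset, ← Set.ncard_coe_finset]
  refine Set.ncard_congr (fun R _ (k : Finset.Icc (1 : ℤ) n) => signIn R k) ?_ ?_ ?_
  · rintro R ⟨h, hr⟩
    rw [Finset.mem_coe, Fintype.mem_piFinset]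
    intro k
    have := Finset.mem_Icc.1 k.2
    exact h.signIn_mem hr this.1 this.2
  · rintro R R' ⟨h, _⟩ ⟨h', _⟩ heq
    have hk : ∀ k, 1 ≤ k → k ≤ (n : ℤ) → signIn R k = signIn R' k := fun k h1 h2 =>
      congrFun heq ⟨k, Finset.mem_Icc.2 ⟨h1, h2⟩⟩
    have hx : ∀ x : ℤ, 1 ≤ |x| → |x| ≤ (n : ℤ) → (x ∈ R ↔ x ∈ R') := by
      intro x h1 h2
      have h3 := hk _ h1 h2
      rcases abs_choice x with h4 | h4 <;> rw [h4] at h3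
      · rw [← signIn_eq_one, h3, signIn_eq_one]
      · rw [← neg_neg x, ← signIn_eq_neg_one h.neg_notMem, h3, signIn_eq_neg_one h'.neg_notMem]
    ext x
    exact ⟨fun hR => (hx x (h.mem_range x hR).1 (h.mem_range x hR).2).1 hR,
      fun hR => (hx x (h'.mem_range x hR).1 (h'.mem_range x hR).2).2 hR⟩
  · intro f hf
    rw [Finset.mem_coe, Fintype.mem_piFinset] at hf
    set R : Set ℤ := {x | ∃ h : |x| ∈ Finset.Icc (1 : ℤ) n, f ⟨|x|, h⟩ = x.sign} with hRdef
    have hRm : ∀ x ∈ R, 1 ≤ |x| ∧ |x| ≤ (n : ℤ) := by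
      rintro x ⟨h, _⟩
      exact Finset.mem_Icc.1 h
    have hneg : ∀ x ∈ R, -x ∉ R := by
      rintro x ⟨h1, h2⟩ ⟨h3, h4⟩
      have h5 : f ⟨|-x|, h3⟩ = f ⟨|x|, h1⟩ := by
        congr 2
        exact abs_neg x
      rw [h5, h2, Int.sign_neg] at h4
      have h6 : x ≠ 0 := by
        rintro rfl
        simp at h1
      have := Int.sign_eq_zero_iff_zero.not.2 h6
      omega
    have hpos : ∀ (k : ℤ) (hk : k ∈ Finset.Icc (1 : ℤ) n),
        (k ∈ R ↔ f ⟨k, hk⟩ = 1) ∧ (-k ∈ R ↔ f ⟨k, hk⟩ = -1) := by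
      intro k hk
      have h1 : 0 < k := by have := (Finset.mem_Icc.1 hk).1; omega
      have h2 : |k| = k := abs_of_pos h1
      have h3 : |-k| = k := by rw [abs_neg, h2]
      constructor
      · rw [hRdef, Set.mem_ofPred_eq, Int.sign_eq_one_of_pos h1]
        simp only [h2]
        exact ⟨fun ⟨_, h⟩ => h, fun h => ⟨hk, h⟩⟩
      · rw [hRdef, Set.mem_ofPred_eq, Int.sign_eq_neg_one_of_neg (by omega)]
        simp only [h3]
        exact ⟨fun ⟨_, h⟩ => h, fun h => ⟨hk, h⟩⟩
    have hsign : ∀ (k : ℤ) (hk : k ∈ Finset.Icc (1 : ℤ) n), signIn R k = f ⟨k, hk⟩ := by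
      intro k hk
      obtain ⟨h1, h2⟩ := hpos k hk
      rcases mem_signOptions_cases (hf ⟨k, hk⟩) hb0 with h3 | h3 | h3
      · rw [h3, signIn_eq_one, h1, h3]
      · rw [h3, signIn_eq_neg_one hneg, h2, h3]
      · rw [h3, signIn_eq_zero, h1, h2, h3]
        norm_num
    refine ⟨R, isRightPartD_of_signIn_mem hv hRm hneg fun k h1 h2 => ?_, ?_⟩
    · rw [hsign k (Finset.mem_Icc.2 ⟨h1, h2⟩)]
      exact hf ⟨k, Finset.mem_Icc.2 ⟨h1, h2⟩⟩
    · funext k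
      exact hsign k k.2

theorem ncard_hasShapeD (hn : 2 ≤ n) :
    {u : Equiv.Perm ℤ | IsDPerm n u ∧ IsJoinIrreducibleD n u ∧ HasShapeD n u (a, b, r')}.ncard =
      {R : Set ℤ | IsRightPartD n R a b ∧ HasRankD R b r'}.ncard := by
  have key : ∀ u ∈ {u : Equiv.Perm ℤ | IsDPerm n u ∧ IsJoinIrreducibleD n u ∧
      HasShapeD n u (a, b, r')}, ∃ m, IsGrassmannianD n u m ∧ a = |u m| ∧ b = u (m + 1) ∧
        HasRankD (u '' Set.Icc (m + 1) n) b r' := fun u hu => (hasShapeD_iff hn hu.1).1 hu.2.2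
  choose! m hm using key
  refine Set.ncard_congr (fun u _ => u '' Set.Icc (m u + 1) n) ?_ ?_ ?_
  · intro u hu
    obtain ⟨h1, h2, h3, h4⟩ := hm u hu
    have h5 := h1.isRightPartD hu.1
    rw [← h2, ← h3] at h5
    exact ⟨h5, h4⟩
  · intro u v hu hv heq
    exact (hm u hu).1.eq_of_image_eq hu.1 hv.1 (hm v hv).1 heq
  · rintro R ⟨h, hr⟩
    obtain ⟨w, m', hw, hg, rfl, h1, h2⟩ := h.exists_isGrassmannianD
    have hs : HasShapeD n w (a, b, r') := (hasShapeD_iff hn hw).2 ⟨m', hg, h1, h2, hr⟩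
    have hu : w ∈ {u : Equiv.Perm ℤ | IsDPerm n u ∧ IsJoinIrreducibleD n u ∧
      HasShapeD n u (a, b, r')} := ⟨hw, hs.isJoinIrreducibleD hn hw, hs⟩
    refine ⟨w, hu, ?_⟩
    rw [(hm w hu).1.unique hn hw hg]

end Counting

/-- (1) A triple `(a,b,r′) ∈ ℤ³` is the shape of some join-irreducible element of `W(D_n)`
if and only if `2 ≤ a ≤ n` and one of: (i) `−1 ≤ b < a`, `b ≠ 0`, `r′ = 0`;
(ii) `−a < b ≤ −2`, `0 ≤ r′ ≤ |b|−1`; (iii) `−n ≤ b < −a`, `0 ≤ r′ ≤ a−2`.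
(2) For such a triple `σ = (a,b,r′)`, with `x = max(a,|b|)` and `y = min(a,|b|)`, the number
of join-irreducible elements of `W(D_n)` with shape `σ` equals `2^{x−y−1}` if `b ≥ −1`, and
`2^{r′}·3^{max(y−r′−2,0)}·2^{x−y−1}` if `b ≤ −2`. -/
theorem shape_classification_and_count_D (n : ℕ) (hn : 4 ≤ n) :
    (∀ σ : ℤ × ℤ × ℤ,
      (∃ u : Equiv.Perm ℤ, IsDPerm n u ∧ IsJoinIrreducibleD n u ∧ HasShapeD n u σ) ↔
        IsValidShapeD n σ) ∧
    (∀ σ : ℤ × ℤ × ℤ, IsValidShapeD n σ →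
      {u : Equiv.Perm ℤ | IsDPerm n u ∧ IsJoinIrreducibleD n u ∧ HasShapeD n u σ}.ncard =
        if -1 ≤ σ.2.1 then
          2 ^ (max σ.1 |σ.2.1| - min σ.1 |σ.2.1| - 1).toNat
        else
          2 ^ σ.2.2.toNat * 3 ^ (min σ.1 |σ.2.1| - σ.2.2 - 2).toNat *
            2 ^ (max σ.1 |σ.2.1| - min σ.1 |σ.2.1| - 1).toNat) := by
  have hn2 : 2 ≤ n := by omega
  have hcount : ∀ a b r' : ℤ, IsValidShapeD n (a, b, r') →
      {u : Equiv.Perm ℤ | IsDPerm n u ∧ IsJoinIrreducibleD n u ∧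
        HasShapeD n u (a, b, r')}.ncard = if -1 ≤ b then 2 ^ (max a |b| - min a |b| - 1).toNat
      else 2 ^ r'.toNat * 3 ^ (min a |b| - r' - 2).toNat *
        2 ^ (max a |b| - min a |b| - 1).toNat := fun a b r' hv => by
    rw [ncard_hasShapeD hn2, ncard_isRightPartD hv, prod_card_signOptions hv]
  refine ⟨?_, fun ⟨a, b, r'⟩ hv => hcount a b r' hv⟩
  rintro ⟨a, b, r'⟩
  constructor
  · rintro ⟨u, hu, _, hs⟩
    obtain ⟨m, hg, rfl, rfl, hr⟩ := (hasShapeD_iff hn2 hu).1 hs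
    exact (hg.isRightPartD hu).isValidShapeD hr
  · intro hv
    refine Set.nonempty_of_ncard_ne_zero (s := {u : Equiv.Perm ℤ | IsDPerm n u ∧
      IsJoinIrreducibleD n u ∧ HasShapeD n u (a, b, r')}) ?_
    rw [hcount a b r' hv]
    split_ifs <;> positivity
end
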